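/- arXiv:2005.08878 — 5 statements merged into one kernel-verified Lean document; each statement's English description precedes it below -/
import Mathlib

section
/- Let K be an algebraic function field over a field k, and let k^c be the field of constants of K/k. Then K is an algebraic function field over k^c, and cvg_k(K) = cvg_{k^c}(K), where on the left K is regarded as an algebraic function field over k and on the right as one over k^c. -/
universe u v

/-- `K` is an algebraic function field over `k`, i.e. a finitely generated field extension. -/
def IsAlgFunctionField (k : Type u) (K : Type v) [Field k] [Field K] [Algebra k K] : Prop :=
  (⊤ : IntermediateField k K).FG

/-- There is a covering diagram for `K/k` of degree `e`: algebraic function fields `K_B`, `K_C`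
over `k`, a `k`-algebra embedding `K ↪ K_C` which is module-finite, and a `k`-algebra
embedding `K_B(t) ↪ K_C` with `[K_C : K_B(t)] = e`. -/
def HasCvgDiagram (k : Type u) (K : Type v) [Field k] [Field K] [Algebra k K] (e : ℕ) : Prop :=
  ∃ (K_B K_C : Type (max u v)) (_ : Field K_B) (_ : Field K_C)
    (_ : Algebra k K_B) (_ : Algebra k K_C),
    IsAlgFunctionField k K_B ∧ IsAlgFunctionField k K_C ∧
    ∃ (f : K →ₐ[k] K_C) (π : RatFunc K_B →ₐ[k] K_C),
      f.toRingHom.Finite ∧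
      (letI := π.toRingHom.toAlgebra
       Module.finrank (RatFunc K_B) K_C = e)

/-- A covering diagram with `K_C/K` moreover separable. -/
def HasSepCvgDiagram (k : Type u) (K : Type v) [Field k] [Field K] [Algebra k K] (e : ℕ) :
    Prop :=
  ∃ (K_B K_C : Type (max u v)) (_ : Field K_B) (_ : Field K_C)
    (_ : Algebra k K_B) (_ : Algebra k K_C),
    IsAlgFunctionField k K_B ∧ IsAlgFunctionField k K_C ∧
    ∃ (f : K →ₐ[k] K_C) (π : RatFunc K_B →ₐ[k] K_C),
      f.toRingHom.Finite ∧
      (letI := f.toRingHom.toAlgebra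
       Algebra.IsSeparable K K_C) ∧
      (letI := π.toRingHom.toAlgebra
       Module.finrank (RatFunc K_B) K_C = e)

/-- The covering gonality of `K` over `k`. -/
noncomputable def cvg (k : Type u) (K : Type v) [Field k] [Field K] [Algebra k K] : ℕ :=
  sInf {e : ℕ | 0 < e ∧ HasCvgDiagram k K e}

/-- The separable covering gonality of `K` over `k`. -/
noncomputable def scvg (k : Type u) (K : Type v) [Field k] [Field K] [Algebra k K] : ℕ :=
  sInf {e : ℕ | 0 < e ∧ HasSepCvgDiagram k K e}


set_option linter.style.haveILetI false

open scoped IntermediateField.algebraAdjoinAdjoin in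
theorem finite_constants (k : Type u) (K : Type v) [Field k] [Field K] [Algebra k K]
    [Algebra.EssFiniteType k K] : Module.Finite k (algebraicClosure k K) := by
  obtain ⟨s, hs⟩ := exists_finset_isTranscendenceBasis k K
  have hfin : Module.Finite (IntermediateField.adjoin k (s : Set K)) K := by
    apply +allowSynthFailures Algebra.finite_of_essFiniteType_of_isAlgebraic
    · exact .of_comp k _ _
    · convert! hs.isAlgebraic_field <;> simp
  let b := Module.Basis.ofVectorSpace k (algebraicClosure k K)
  have hx := hs.1.algebraicClosure
  have h1 : LinearIndependent (Algebra.adjoin k (s : Set K)) (fun j => (b j : K)) := by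
    rw [linearIndependent_iff']
    intro t g hg i hi
    have hp : ∀ j, ∃ p : MvPolynomial s k, MvPolynomial.aeval ((↑) : s → K) p = (g j : K) := by
      intro j
      have h := (g j).2
      have e := Algebra.adjoin_range_eq_range_aeval k ((↑) : s → K)
      simp only [Subtype.range_coe_subtype, Finset.setOfPred_mem] at e
      exact e.le h
    choose p hp using hp
    have hq : ∑ j ∈ t, MvPolynomial.map (algebraMap k (algebraicClosure k K)) (p j) *
        MvPolynomial.C (b j) = 0 := by
      apply (algebraicIndependent_iff_injective_aeval.1 hx)
      rw [map_zero, map_sum, ← hg]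
      refine Finset.sum_congr rfl fun j _ => ?_
      rw [map_mul, MvPolynomial.aeval_map_algebraMap, hp]
      simp [Algebra.smul_def]
    have hpi : p i = 0 := by
      ext m
      have hm := congrArg (MvPolynomial.coeff m) hq
      rw [MvPolynomial.coeff_sum] at hm
      have := linearIndependent_iff'.1 b.linearIndependent t (fun j => (p j).coeff m) (by
        rw [← MvPolynomial.coeff_zero m (R := algebraicClosure k K), ← hm]
        refine Finset.sum_congr rfl fun j _ => ?_
        rw [mul_comm, MvPolynomial.coeff_C_mul, MvPolynomial.coeff_map, Algebra.smul_def, mul_comm])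
      simpa using this i hi
    apply Subtype.ext
    rw [← hp i, hpi]
    simp
  have h2 := (LinearIndependent.iff_fractionRing (Algebra.adjoin k (s : Set K))
    (IntermediateField.adjoin k (s : Set K))).1 h1
  have := h2.finite
  exact Module.Finite.of_basis b

theorem transport_diagram {k : Type u} {K : Type v} [Field k] [Field K] [Algebra k K] {e : ℕ}
    {B : Type*} {C : Type*} [Field B] [Field C] [Algebra k B] [Algebra k C]
    [Small.{max u v} B] [Small.{max u v} C]
    (hB : Algebra.EssFiniteType k B) (hC : Algebra.EssFiniteType k C)
    (f : K →ₐ[k] C) (π : RatFunc B →ₐ[k] C) (hf : f.toRingHom.Finite)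
    (he : letI := π.toRingHom.toAlgebra; Module.finrank (RatFunc B) C = e) :
    HasCvgDiagram k K e := by
  let eB := Shrink.algEquiv.{max u v} k B
  let eC := Shrink.algEquiv.{max u v} k C
  let eR : RatFunc (Shrink.{max u v} B) ≃ₐ[k] RatFunc B :=
    IsFractionRing.algEquivOfAlgEquiv (Polynomial.mapAlgEquiv eB)
  refine ⟨Shrink.{max u v} B, Shrink.{max u v} C, inferInstance, inferInstance, inferInstance,
    inferInstance, ?_, ?_, eC.symm.toAlgHom.comp f,
    eC.symm.toAlgHom.comp (π.comp eR.toAlgHom), ?_, ?_⟩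
  · exact IntermediateField.fg_top_iff.2 ((Algebra.EssFiniteType.iff_of_algEquiv eB).2 hB)
  · exact IntermediateField.fg_top_iff.2 ((Algebra.EssFiniteType.iff_of_algEquiv eC).2 hC)
  · exact (RingHom.Finite.of_surjective eC.symm.toAlgHom.toRingHom eC.symm.surjective).comp hf
  · rw [← he]
    letI := π.toRingHom.toAlgebra
    letI := (eC.symm.toAlgHom.comp (π.comp eR.toAlgHom)).toRingHom.toAlgebra
    refine Algebra.finrank_eq_of_equiv_equiv eR.toRingEquiv eC.toRingEquiv ?_
    ext x
    change π (eR x) = eC (eC.symm (π (eR x)))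
    simp

theorem diagram_down {k : Type u} {K : Type v} [Field k] [Field K] [Algebra k K] {e : ℕ}
    [Algebra.EssFiniteType k K] (h : HasCvgDiagram (algebraicClosure k K) K e) :
    HasCvgDiagram k K e := by
  obtain ⟨B, C, _, _, _, _, hB, hC, f, π, hf, he⟩ := h
  have := finite_constants k K
  letI : Algebra k B := Algebra.compHom B (algebraMap k (algebraicClosure k K))
  letI : Algebra k C := Algebra.compHom C (algebraMap k (algebraicClosure k K))
  haveI : IsScalarTower k (algebraicClosure k K) B := .of_algebraMap_eq fun _ => rfl
  haveI : IsScalarTower k (algebraicClosure k K) C := .of_algebraMap_eq fun _ => rfl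
  haveI : IsScalarTower k (algebraicClosure k K) (RatFunc B) := .of_algebraMap_eq fun x => by
    rw [IsScalarTower.algebraMap_apply k B (RatFunc B),
      IsScalarTower.algebraMap_apply (algebraicClosure k K) B (RatFunc B)]
    rfl
  have hB' := IntermediateField.fg_top_iff.1 hB
  have hC' := IntermediateField.fg_top_iff.1 hC
  exact transport_diagram (.comp k (algebraicClosure k K) B) (.comp k (algebraicClosure k K) C)
    (f.restrictScalars k) (π.restrictScalars k) hf he

theorem finrank_tower {R S C : Type*} [Field R] [Field S] [Field C] (m : R →+* S) (p : S →+* C)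
    (q : R →+* C) (h : p.comp m = q) {e : ℕ}
    (he : letI := q.toAlgebra; Module.finrank R C = e) (he0 : 0 < e) :
    (letI := p.toAlgebra; 0 < Module.finrank S C) ∧
    (letI := p.toAlgebra; Module.finrank S C ≤ e) := by
  letI := q.toAlgebra
  letI := p.toAlgebra
  letI := m.toAlgebra
  haveI : IsScalarTower R S C :=
    .of_algebraMap_eq fun x => (congrArg (fun g => g x) h).symm
  have hfr : Module.finrank R C = e := he
  haveI : Module.Finite R C := Module.finite_of_finrank_pos (by omega)
  haveI : Module.Finite S C := Module.Finite.of_restrictScalars_finite R _ _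
  refine ⟨Module.finrank_pos, ?_⟩
  rw [← hfr]
  have := Module.finrank_mul_finrank R S C
  exact Nat.le_of_dvd (by omega) ⟨_, by rw [← this, mul_comm]⟩

theorem diagram_up {k : Type u} {K : Type v} [Field k] [Field K] [Algebra k K] {e : ℕ}
    (he0 : 0 < e) (h : HasCvgDiagram k K e) :
    ∃ e', 0 < e' ∧ e' ≤ e ∧ HasCvgDiagram (algebraicClosure k K) K e' := by
  obtain ⟨B, C, _, _, _, _, hB, hC, f, π, hf, he⟩ := h
  haveI hC' : Algebra.EssFiniteType k C := IntermediateField.fg_top_iff.1 hC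
  haveI hsC : Small.{v} C := by
    letI := f.toRingHom.toAlgebra
    haveI : Module.Finite K C := hf
    obtain ⟨n, g, hg⟩ := Module.Finite.exists_fin' K C
    exact small_of_surjective hg
  letI aC : Algebra (algebraicClosure k K) C :=
    (f.toRingHom.comp (algebraMap (algebraicClosure k K) K)).toAlgebra
  haveI : IsScalarTower k (algebraicClosure k K) C := .of_algebraMap_eq fun x =>
    (f.commutes x).symm
  let f' : K →ₐ[algebraicClosure k K] C := { f.toRingHom with commutes' := fun _ => rfl }
  let iB : B →ₐ[k] C := π.comp (IsScalarTower.toAlgHom k B (RatFunc B))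
  let B' : IntermediateField (algebraicClosure k K) C :=
    IntermediateField.adjoin (algebraicClosure k K) (Set.range iB)
  have hB' : B'.FG := by
    obtain ⟨s, hs⟩ := hB
    refine IntermediateField.fg_def.2 ⟨iB '' s, s.finite_toSet.image _, le_antisymm ?_ ?_⟩
    · exact IntermediateField.adjoin.mono _ _ _ (Set.image_subset_range _ _)
    · refine IntermediateField.adjoin_le_iff.2 ?_
      rintro _ ⟨x, rfl⟩
      have hx : x ∈ IntermediateField.adjoin k (s : Set B) := by rw [hs]; trivial
      have hx' : iB x ∈ IntermediateField.adjoin k (iB '' s) := by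
        rw [← IntermediateField.adjoin_map]
        exact ⟨x, hx, rfl⟩
      have hle : IntermediateField.adjoin k (iB '' s) ≤
          (IntermediateField.adjoin (algebraicClosure k K) (iB '' s)).restrictScalars k :=
        IntermediateField.adjoin_le_iff.2 (IntermediateField.subset_adjoin _ _)
      exact hle hx'
  let j : B →+* B' := iB.toRingHom.codRestrict B'.toSubfield
    (fun x => IntermediateField.subset_adjoin _ _ ⟨x, rfl⟩)
  let t : C := π RatFunc.X
  have htB : letI := iB.toRingHom.toAlgebra; Transcendental B t := by
    letI := iB.toRingHom.toAlgebra
    let πB : RatFunc B →ₐ[B] C := { π.toRingHom with commutes' := fun _ => rfl }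
    intro h
    exact RatFunc.transcendental_X ((isAlgebraic_algHom_iff πB πB.toRingHom.injective).1 h)
  have ht : Transcendental B' t := by
    letI := iB.toRingHom.toAlgebra
    haveI : IsScalarTower k B C := .of_algebraMap_eq fun x => (iB.commutes x).symm
    have h1 := htB.algebraicClosure
    have hle : ∀ x ∈ B', x ∈ algebraicClosure B C := by
      intro x hx
      have : B'.toSubfield ≤ (algebraicClosure B C).toSubfield := by
        change (IntermediateField.adjoin _ _).toSubfield ≤ _
        rw [IntermediateField.adjoin_toSubfield, Subfield.closure_le]
        rintro y (⟨z, rfl⟩ | ⟨z, rfl⟩)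
        · have hz : IsAlgebraic k z := Algebra.IsAlgebraic.isAlgebraic z
          have hz' : IsAlgebraic k (algebraMap (algebraicClosure k K) C z) := hz.algebraMap
          exact (mem_algebraicClosure_iff).2 (hz'.tower_top B)
        · exact (algebraicClosure B C).algebraMap_mem z
      exact this hx
    intro halg
    letI : Algebra B' (algebraicClosure B C) := RingHom.toAlgebra
      (B'.toSubfield.subtype.codRestrict (algebraicClosure B C).toSubfield fun x => hle _ x.2)
    haveI : IsScalarTower B' (algebraicClosure B C) C := .of_algebraMap_eq fun _ => rfl
    exact h1 (halg.tower_top _)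
  let π' : RatFunc B' →ₐ[algebraicClosure k K] C :=
    (((IntermediateField.adjoin B' {t}).val).comp
      (RatFunc.algEquivOfTranscendental t ht).toAlgHom).restrictScalars _
  have hπ'C : ∀ x : B', π' (algebraMap B' (RatFunc B') x) = x := fun x =>
    AlgHom.commutes (((IntermediateField.adjoin B' {t}).val).comp
      (RatFunc.algEquivOfTranscendental t ht).toAlgHom) x
  have hπ'X : π' RatFunc.X = t := by
    simp [π']
  let m : RatFunc B →+* RatFunc B' := RatFunc.liftRingHom
    ((algebraMap (Polynomial B') (RatFunc B')).comp (Polynomial.mapRingHom j))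
    (nonZeroDivisors_le_comap_nonZeroDivisors_of_injective _
      ((RatFunc.algebraMap_injective B').comp (Polynomial.map_injective _ j.injective)))
  have hm : π'.toRingHom.comp m = π.toRingHom := by
    apply IsLocalization.ringHom_ext (nonZeroDivisors (Polynomial B))
    apply Polynomial.ringHom_ext
    · intro a
      have h1 : m (algebraMap (Polynomial B) (RatFunc B) (Polynomial.C a)) =
          algebraMap B' (RatFunc B') (j a) := by
        rw [RatFunc.liftRingHom_algebraMap]
        simp [RatFunc.algebraMap_eq_C]
      change π' (m (algebraMap (Polynomial B) (RatFunc B) (Polynomial.C a))) = π _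
      rw [h1, hπ'C]
      rfl
    · have h1 : m (algebraMap (Polynomial B) (RatFunc B) Polynomial.X) = RatFunc.X := by
        rw [RatFunc.liftRingHom_algebraMap]
        simp
      change π' (m (algebraMap (Polynomial B) (RatFunc B) Polynomial.X)) = π _
      rw [h1, hπ'X, RatFunc.algebraMap_X]
  obtain ⟨h0, hle⟩ := finrank_tower m π'.toRingHom π.toRingHom hm he he0
  refine ⟨_, h0, hle, ?_⟩
  · exact transport_diagram (B := B') (C := C) (IntermediateField.essFiniteType_iff.2 hB')
      (.of_comp k _ _) f' π' hf rfl

/-- Covering gonality is unchanged when the base field is replaced by the field of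
constants `k^c` (the relative algebraic closure of `k` in `K`). -/
theorem stmt3 (k : Type u) (K : Type v) [Field k] [Field K] [Algebra k K]
    (hK : IsAlgFunctionField k K) :
    IsAlgFunctionField ↥(algebraicClosure k K) K ∧
    cvg k K = cvg ↥(algebraicClosure k K) K := by
  haveI : Algebra.EssFiniteType k K := IntermediateField.fg_top_iff.1 hK
  refine ⟨IntermediateField.fg_top_iff.2 (.of_comp k _ _), ?_⟩
  unfold cvg
  rcases Set.eq_empty_or_nonempty {e : ℕ | 0 < e ∧ HasCvgDiagram k K e} with h | h
  · have h' : {e : ℕ | 0 < e ∧ HasCvgDiagram (algebraicClosure k K) K e} = ∅ := by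
      refine Set.eq_empty_of_forall_notMem fun e he => ?_
      have : e ∈ {e : ℕ | 0 < e ∧ HasCvgDiagram k K e} := ⟨he.1, diagram_down he.2⟩
      rw [h] at this
      exact this
    rw [h, h']
  · apply le_antisymm
    · obtain ⟨e, he⟩ := h
      obtain ⟨e', h0, -, h1⟩ := diagram_up he.1 he.2
      have := Nat.sInf_mem (s := {e : ℕ | 0 < e ∧ HasCvgDiagram (algebraicClosure k K) K e})
        ⟨e', h0, h1⟩
      exact Nat.sInf_le ⟨this.1, diagram_down this.2⟩
    · have := Nat.sInf_mem h
      obtain ⟨e', h0, hle, h1⟩ := diagram_up this.1 this.2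
      exact (Nat.sInf_le (s := {e : ℕ | 0 < e ∧ HasCvgDiagram (algebraicClosure k K) K e})
        ⟨h0, h1⟩).trans hle
end

section
/- Let K be an algebraic function field over a field k, and let k^c be the field of constants of K/k. Then K is an algebraic function field over k^c, and scvg_k(K) = scvg_{k^c}(K), where on the left K is regarded as an algebraic function field over k and on the right as one over k^c. -/
universe u v

open Polynomial in
/-- Build a diagram (with fields in arbitrary small universes). -/
theorem mkDiag {k : Type u} {K : Type v} [Field k] [Field K] [Algebra k K]
    (hK : Algebra.EssFiniteType k K)
    (B : Type*) (C : Type*) [Field B] [Field C] [Algebra k B] [Algebra k C] [Algebra K C]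
    [IsScalarTower k K C] [Small.{max u v} B] [Small.{max u v} C]
    [Algebra.EssFiniteType k B] [Module.Finite K C] [Algebra.IsSeparable K C]
    (π : RatFunc B →ₐ[k] C) (e : ℕ)
    (h : letI := π.toRingHom.toAlgebra
       Module.finrank (RatFunc B) C = e) : HasSepCvgDiagram k K e := by
  have hC : Algebra.EssFiniteType k C := Algebra.EssFiniteType.comp k K C
  let eB : Shrink.{max u v} B ≃ₐ[k] B := Shrink.algEquiv k B
  obtain ⟨C', _, _, ⟨eC⟩⟩ : ∃ (C' : Type (max u v)) (_ : Field C') (_ : Algebra k C'),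
      Nonempty (C' ≃ₐ[k] C) :=
    ⟨Shrink.{max u v} C, inferInstance, inferInstance, ⟨Shrink.algEquiv k C⟩⟩
  let eR : RatFunc (Shrink.{max u v} B) ≃ₐ[k] RatFunc B :=
    IsFractionRing.algEquivOfAlgEquiv (Polynomial.mapAlgEquiv eB)
  refine ⟨Shrink.{max u v} B, C', inferInstance, inferInstance, inferInstance,
    inferInstance, ?_, ?_, eC.symm.toAlgHom.comp (IsScalarTower.toAlgHom k K C),
    (eC.symm.toAlgHom.comp π).comp eR.toAlgHom, ?_, ?_, ?_⟩
  · exact IntermediateField.fg_top_iff.2 ((Algebra.EssFiniteType.iff_of_algEquiv eB).2 inferInstance)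
  · exact IntermediateField.fg_top_iff.2 ((Algebra.EssFiniteType.iff_of_algEquiv eC).2 inferInstance)
  · let _ := (eC.symm.toAlgHom.comp (IsScalarTower.toAlgHom k K C)).toRingHom.toAlgebra
    change Module.Finite K _
    exact Module.Finite.of_equiv_equiv (RingEquiv.refl K) (eC.symm : C ≃+* _)
      (by ext x; rfl)
  · let _ := (eC.symm.toAlgHom.comp (IsScalarTower.toAlgHom k K C)).toRingHom.toAlgebra
    exact Algebra.IsSeparable.of_equiv_equiv (RingEquiv.refl K) (eC.symm : C ≃+* _)
      (by ext x; rfl)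
  · let _ := ((eC.symm.toAlgHom.comp π).comp eR.toAlgHom).toRingHom.toAlgebra
    let _ := π.toRingHom.toAlgebra
    rw [← h]
    refine Algebra.finrank_eq_of_equiv_equiv (eR : _ ≃+* _) (eC : _ ≃+* C) ?_
    ext x
    · change π (eR x) = eC (eC.symm (π (eR x)))
      simp

open scoped IntermediateField.algebraAdjoinAdjoin in
theorem finite_algClosure {k : Type u} {K : Type v} [Field k] [Field K] [Algebra k K]
    [Algebra.EssFiniteType k K] : Module.Finite k (algebraicClosure k K) := by
  obtain ⟨s, hs⟩ := exists_isTranscendenceBasis k K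
  let A := Algebra.adjoin k s
  let E := IntermediateField.adjoin k s
  have alg : Algebra.IsAlgebraic E K := by
    have alg := hs.isAlgebraic_field
    rwa [Subtype.range_coe] at alg
  have : Algebra.EssFiniteType E K := Algebra.EssFiniteType.of_comp k E K
  have : Module.Finite E K := Algebra.finite_of_essFiniteType_of_isAlgebraic
  let F := algebraicClosure k K
  let b := Module.Basis.ofVectorSpace k F
  have hsF : AlgebraicIndependent F ((↑) : s → K) := hs.1.algebraicClosure
  have li : LinearIndependent A (fun i => (b i : K)) := by
    rw [linearIndependent_iff']
    intro t g hg i hi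
    have hp : ∀ i, ∃ p : MvPolynomial s k, MvPolynomial.aeval ((↑) : s → K) p = (g i : K) := by
      intro i
      obtain ⟨y, hy⟩ := g i
      have hA : A = Algebra.adjoin k (Set.range ((↑) : s → K)) := by simp [A]
      change ∃ p, _ = y
      rw [hA, Algebra.adjoin_range_eq_range_aeval] at hy
      exact hy
    choose p hp using hp
    have h0 : ∑ i ∈ t, b i • MvPolynomial.map (algebraMap k F) (p i) = 0 := by
      apply hsF
      rw [map_sum, map_zero, ← hg]
      refine Finset.sum_congr rfl fun i _ => ?_
      rw [map_smul, MvPolynomial.aeval_map_algebraMap, hp, Algebra.smul_def, Algebra.smul_def,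
        mul_comm]
      rfl
    have h1 : p i = 0 := by
      ext m
      have h2 := congrArg (MvPolynomial.coeff m) h0
      rw [MvPolynomial.coeff_sum] at h2
      simp only [MvPolynomial.coeff_smul, MvPolynomial.coeff_map, MvPolynomial.coeff_zero] at h2
      have h3 := linearIndependent_iff'.1 b.linearIndependent t (fun i => (p i).coeff m) (by
        rw [← h2]
        refine Finset.sum_congr rfl fun i _ => ?_
        rw [Algebra.smul_def, smul_eq_mul, mul_comm]) i hi
      simpa using h3
    apply Subtype.ext
    rw [← hp i, h1]; simp
  have li' : LinearIndependent E (fun i => (b i : K)) :=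
    (LinearIndependent.iff_fractionRing A E).1 li
  have := li'.finite
  exact Module.Finite.of_basis b

open IntermediateField in
theorem extendBase {k L B C : Type*} [Field k] [Field L] [Field B] [Field C]
    [Algebra k L] [Algebra k B] [Algebra k C] [Algebra L C] [IsScalarTower k L C]
    [Algebra.IsAlgebraic k L] [Algebra.EssFiniteType k B] (π : RatFunc B →ₐ[k] C) (e : ℕ)
    (h : letI := π.toRingHom.toAlgebra
       Module.finrank (RatFunc B) C = e) (he : 0 < e) :
    ∃ (B' : IntermediateField L C) (π' : RatFunc B' →ₐ[L] C) (e' : ℕ),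
      Algebra.EssFiniteType L B' ∧ 0 < e' ∧ e' ≤ e ∧
      (letI := π'.toRingHom.toAlgebra
       Module.finrank (RatFunc B') C = e') := by
  obtain ⟨s, hs⟩ := IntermediateField.fg_top k B
  let i : B →ₐ[k] C := π.comp (IsScalarTower.toAlgHom k B (RatFunc B))
  let B' : IntermediateField L C := IntermediateField.adjoin L (i '' s)
  have hB' : Algebra.EssFiniteType L B' :=
    essFiniteType_iff.2 (fg_adjoin_of_finite (s.finite_toSet.image i))
  have hi : ∀ b, i b ∈ B' := by
    intro b
    have h1 : IntermediateField.adjoin k (s : Set B) ≤ (B'.restrictScalars k).comap i := by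
      rw [adjoin_le_iff]
      intro x hx
      exact subset_adjoin L _ ⟨x, hx, rfl⟩
    exact h1 (hs ▸ mem_top)
  let : Algebra B C := i.toRingHom.toAlgebra
  let : Algebra B B' := (i.toRingHom.codRestrict B'.toSubfield hi).toAlgebra
  have : IsScalarTower B B' C := IsScalarTower.of_algebraMap_eq fun x => rfl
  have : IsScalarTower k B C := IsScalarTower.of_algebraMap_eq fun x => (i.commutes x).symm
  have halg : Algebra.IsAlgebraic B B' := by
    constructor
    rintro ⟨x, hx⟩
    rw [← isAlgebraic_algHom_iff (IsScalarTower.toAlgHom B B' C) Subtype.val_injective]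
    change IsAlgebraic B x
    induction hx using IntermediateField.adjoin_induction with
    | mem x hx =>
      obtain ⟨y, _, rfl⟩ := hx
      exact isAlgebraic_algebraMap (R := B) (A := C) y
    | algebraMap x =>
      have := (Algebra.IsAlgebraic.isAlgebraic (R := k) x).algebraMap (A := C)
      exact this.tower_top B
    | add x y _ _ hx hy => exact hx.add hy
    | inv x _ hx => exact hx.inv
    | mul x y _ _ hx hy => exact hx.mul hy
  let t : C := π RatFunc.X
  have ht : Transcendental B t := by
    let π' : RatFunc B →ₐ[B] C := { π.toRingHom with commutes' := fun r => rfl }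
    exact fun h => RatFunc.transcendental_X ((isAlgebraic_algHom_iff π' π'.toRingHom.injective).1 h)
  have ht' : Transcendental B' t := ht.extendScalars B'
  let eR := RatFunc.algEquivOfTranscendental t ht'
  let π' : RatFunc B' →ₐ[L] C := ((B'⟮t⟯).val.comp eR.toAlgHom).restrictScalars L
  have hmem : ∀ x, π x ∈ B'⟮t⟯ := by
    have hpoly : ∀ p : Polynomial B, π (algebraMap _ _ p) ∈ B'⟮t⟯ := by
      intro p
      induction p using Polynomial.induction_on' with
      | add p q hp hq => rw [map_add, map_add]; exact add_mem hp hq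
      | monomial n a =>
        rw [RatFunc.algebraMap_monomial, map_mul, map_pow]
        exact mul_mem ((B'⟮t⟯).algebraMap_mem ⟨i a, hi a⟩)
          (pow_mem (mem_adjoin_simple_self B' t) n)
    intro x
    rw [← RatFunc.num_div_denom x, map_div₀]
    exact div_mem (hpoly _) (hpoly _)
  let aR : Algebra (RatFunc B) C := π.toRingHom.toAlgebra
  let aR' : Algebra (RatFunc B) B'⟮t⟯ := (π.toRingHom.codRestrict (B'⟮t⟯).toSubfield hmem).toAlgebra
  have : IsScalarTower (RatFunc B) B'⟮t⟯ C := IsScalarTower.of_algebraMap_eq fun x => rfl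
  have hmul := Module.finrank_mul_finrank (RatFunc B) B'⟮t⟯ C
  have hpos : 0 < Module.finrank B'⟮t⟯ C := by
    rcases Nat.eq_zero_or_pos (Module.finrank B'⟮t⟯ C) with h0 | h0
    · rw [h0] at hmul; simp at hmul; omega
    · exact h0
  refine ⟨B', π', Module.finrank B'⟮t⟯ C, hB', hpos, ?_, ?_⟩
  · rw [← h]
    apply Nat.le_of_dvd (h ▸ he)
    exact ⟨_, by rw [← hmul, mul_comm]⟩
  · let _ := π'.toRingHom.toAlgebra
    exact Algebra.finrank_eq_of_equiv_equiv (eR : _ ≃+* _) (RingEquiv.refl C) (by ext x; rfl)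

/-- Separable covering gonality is unchanged when the base field is replaced by the field of
constants `k^c` (the relative algebraic closure of `k` in `K`). -/
theorem stmt4 (k : Type u) (K : Type v) [Field k] [Field K] [Algebra k K]
    (hK : IsAlgFunctionField k K) :
    IsAlgFunctionField ↥(algebraicClosure k K) K ∧
    scvg k K = scvg ↥(algebraicClosure k K) K := by
  have hK' : Algebra.EssFiniteType k K := IntermediateField.fg_top_iff.1 hK
  let L := algebraicClosure k K
  have hfin : Module.Finite k L := finite_algClosure
  have hLK : Algebra.EssFiniteType L K := Algebra.EssFiniteType.of_comp k L K
  have down : ∀ e, HasSepCvgDiagram L K e → HasSepCvgDiagram k K e := by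
    rintro e ⟨B, C, _, _, _, _, hB, hC, f, π, hf, hsep, he⟩
    let : Algebra k B := ((algebraMap L B).comp (algebraMap k L)).toAlgebra
    let : Algebra k C := ((algebraMap L C).comp (algebraMap k L)).toAlgebra
    have : IsScalarTower k L B := IsScalarTower.of_algebraMap_eq fun x => rfl
    have : IsScalarTower k L C := IsScalarTower.of_algebraMap_eq fun x => rfl
    have : Algebra.EssFiniteType L B := IntermediateField.fg_top_iff.1 hB
    have : Algebra.EssFiniteType k B := Algebra.EssFiniteType.comp k L B
    let : Algebra K C := f.toRingHom.toAlgebra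
    have : IsScalarTower k K C := IsScalarTower.of_algebraMap_eq fun x =>
      (f.commutes (algebraMap k L x)).symm
    have : Module.Finite K C := hf
    have : Algebra.IsSeparable K C := hsep
    have : IsScalarTower k L (RatFunc B) := IsScalarTower.of_algebraMap_eq fun x => by
      rw [IsScalarTower.algebraMap_apply k B (RatFunc B),
        IsScalarTower.algebraMap_apply L B (RatFunc B)]; rfl
    exact mkDiag hK' B C (π.restrictScalars k) e he
  have up : ∀ e, 0 < e → HasSepCvgDiagram k K e →
      ∃ e', 0 < e' ∧ e' ≤ e ∧ HasSepCvgDiagram L K e' := by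
    rintro e hpos ⟨B, C, _, _, _, _, hB, hC, f, π, hf, hsep, he⟩
    let : Algebra K C := f.toRingHom.toAlgebra
    have : IsScalarTower k K C := IsScalarTower.of_algebraMap_eq fun x => (f.commutes x).symm
    have : IsScalarTower L K C := inferInstance
    have : IsScalarTower k L C := IsScalarTower.of_algebraMap_eq fun x => (f.commutes x).symm
    have : Module.Finite K C := hf
    have : Algebra.IsSeparable K C := hsep
    have : Algebra.EssFiniteType k B := IntermediateField.fg_top_iff.1 hB
    have : Small.{v} C := small_map (Module.finBasis K C).equivFun.toEquiv
    obtain ⟨B', π', e', hB', hp, hle, hfr⟩ := extendBase (L := L) π e he hpos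
    have : Small.{v} B' := small_subtype C (fun x => x ∈ B')
    exact ⟨e', hp, hle, mkDiag hLK B' C π' e' hfr⟩
  refine ⟨IntermediateField.fg_top_iff.2 hLK, ?_⟩
  unfold scvg
  by_cases hne : {e : ℕ | 0 < e ∧ HasSepCvgDiagram k K e}.Nonempty
  · apply le_antisymm
    · obtain ⟨e, he, hd⟩ := hne
      obtain ⟨e', h1, h2, h3⟩ := up e he hd
      have := Nat.sInf_mem (s := {e : ℕ | 0 < e ∧ HasSepCvgDiagram L K e}) ⟨e', h1, h3⟩
      exact Nat.sInf_le ⟨this.1, down _ this.2⟩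
    · obtain ⟨he, hd⟩ := Nat.sInf_mem hne
      obtain ⟨e', h1, h2, h3⟩ := up _ he hd
      have h4 : sInf {e : ℕ | 0 < e ∧ HasSepCvgDiagram L K e} ≤ e' := Nat.sInf_le ⟨h1, h3⟩
      exact h4.trans h2
  · have h0 : {e : ℕ | 0 < e ∧ HasSepCvgDiagram L K e} = ∅ := by
      rw [Set.eq_empty_iff_forall_notMem]
      rintro e ⟨h1, h2⟩
      exact hne ⟨e, h1, down _ h2⟩
    rw [Set.not_nonempty_iff_eq_empty.1 hne, h0]
end

section
/- Let K be an algebraic function field over a field k whose field of constants equals k. Let L be an arbitrary field extension of k, let p be a minimal prime ideal of the tensor product K ⊗_k L, and let K' be the fraction field of the integral domain (K ⊗_k L)/p, regarded as an algebraic function field over L via the natural map L → K'. Then cvg_L(K') = cvg_k(K). -/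
universe u v

open scoped TensorProduct
section CvgAux
set_option autoImplicit false
open Polynomial

/-- The subfield `E(t)`. -/
def cvgM {Ω : Type*} [Field Ω] (E : Subfield Ω) (t : Ω) : Subfield Ω :=
  Subfield.closure (insert t (E : Set Ω))

/-- `C` is a field spanned by `e` elements over `E(t)`, with `t` transcendental over `E`. -/
def WD {Ω : Type*} [Field Ω] (E C : Subfield Ω) (t : Ω) (e : ℕ) : Prop :=
  Transcendental E t ∧ ∃ b : Fin e → Ω,
    (C : Set Ω) = (Submodule.span (cvgM E t) (Set.range b) : Submodule (cvgM E t) Ω)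

lemma cvgM_le_left {Ω : Type*} [Field Ω] (E : Subfield Ω) (t : Ω) : E ≤ cvgM E t :=
  fun _ hx => Subfield.subset_closure (Set.mem_insert_of_mem _ hx)

lemma mem_cvgM {Ω : Type*} [Field Ω] (E : Subfield Ω) (t : Ω) : t ∈ cvgM E t :=
  Subfield.subset_closure (Set.mem_insert _ _)

lemma cvgM_le {Ω : Type*} [Field Ω] {E F : Subfield Ω} {t : Ω} (h : E ≤ F) (ht : t ∈ F) :
    cvgM E t ≤ F := by
  refine Subfield.closure_le.2 ?_
  rintro x (rfl | hx)
  · exact ht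
  · exact h hx

lemma cvgM_mono {Ω : Type*} [Field Ω] {E F : Subfield Ω} {t : Ω} (h : E ≤ F) :
    cvgM E t ≤ cvgM F t :=
  cvgM_le (h.trans (cvgM_le_left _ _)) (mem_cvgM _ _)

lemma cvgM_map {Ω Ω' : Type*} [Field Ω] [Field Ω'] (φ : Ω →+* Ω') (E : Subfield Ω) (t : Ω) :
    cvgM (E.map φ) (φ t) = (cvgM E t).map φ := by
  simp only [cvgM, RingHom.map_field_closure, Set.image_insert_eq, Subfield.coe_map]

/-- membership in a span over a subfield -/
lemma mem_span_sub {Ω : Type*} [Field Ω] (M : Subfield Ω) {e : ℕ} (b : Fin e → Ω) (x : Ω) :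
    x ∈ Submodule.span M (Set.range b) ↔ ∃ c : Fin e → Ω, (∀ i, c i ∈ M) ∧ x = ∑ i, c i * b i := by
  rw [Submodule.mem_span_range_iff_exists_fun]
  constructor
  · rintro ⟨c, rfl⟩
    exact ⟨fun i => c i, fun i => (c i).2, by simp [Subfield.smul_def]⟩
  · rintro ⟨c, hc, rfl⟩
    exact ⟨fun i => ⟨c i, hc i⟩, by simp [Subfield.smul_def]⟩

/-- A finite-dimensional span containing `1` and closed under products is a field. -/
lemma span_field {Ω : Type*} [Field Ω] (M : Subfield Ω) {e : ℕ} (b : Fin e → Ω)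
    (h1 : (1 : Ω) ∈ Submodule.span M (Set.range b))
    (hm : ∀ i j, b i * b j ∈ Submodule.span M (Set.range b)) :
    ∃ C : Subfield Ω, (C : Set Ω) = (Submodule.span M (Set.range b) : Submodule M Ω) ∧ M ≤ C := by
  set W := Submodule.span M (Set.range b) with hW
  have hmul : ∀ x y, x ∈ W → y ∈ W → x * y ∈ W := by
    intro x y hx hy
    have h2 : W * W ≤ W := by
      rw [hW, Submodule.span_mul_span, Submodule.span_le]
      rintro _ ⟨_, ⟨i, rfl⟩, _, ⟨j, rfl⟩, rfl⟩
      exact hm i j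
    exact h2 (Submodule.mul_mem_mul hx hy)
  let A : Subalgebra M Ω := W.toSubalgebra h1 hmul
  have hfin : Module.Finite M A := by
    have : Module.Finite M W := Module.Finite.span_of_finite M (Set.finite_range b)
    exact this
  have hF : IsField A := isField_of_isIntegral_of_isField' (R := M) (S := A) (Field.toIsField M)
  refine ⟨{ A.toSubring with inv_mem' := ?_ }, rfl, ?_⟩
  · intro x hx
    by_cases h0 : x = 0
    · subst h0; simp
    · obtain ⟨y, hy⟩ := hF.mul_inv_cancel (a := ⟨x, hx⟩) (by simpa [Subtype.ext_iff] using h0)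
      have : x * y = 1 := congrArg Subtype.val hy
      have h3 : x⁻¹ = y := by rw [inv_eq_of_mul_eq_one_right this]
      rw [h3]; exact y.2
  · intro x hx
    exact A.algebraMap_mem ⟨x, hx⟩

lemma closure_finite_support {Ω : Type*} [Field Ω] (E : Subfield Ω) (t : Ω) {x : Ω}
    (hx : x ∈ cvgM E t) :
    ∃ Z : Finset Ω, (Z : Set Ω) ⊆ E ∧ ∀ F : Subfield Ω, (Z : Set Ω) ⊆ F → t ∈ F → x ∈ F := by
  classical
  unfold cvgM at hx
  induction hx using Subfield.closure_induction with
  | mem x hx =>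
    rcases hx with rfl | hx
    · exact ⟨∅, by simp, fun F _ h => h⟩
    · exact ⟨{x}, by simpa using hx, fun F h _ => h (by simp)⟩
  | one => exact ⟨∅, by simp, fun F _ _ => F.one_mem⟩
  | add x y _ _ hx hy =>
    obtain ⟨Z, hZ, hx⟩ := hx
    obtain ⟨Y, hY, hy⟩ := hy
    refine ⟨Z ∪ Y, by simp [hZ, hY], fun F h ht => ?_⟩
    simp only [Finset.coe_union, Set.union_subset_iff] at h
    exact F.add_mem (hx F h.1 ht) (hy F h.2 ht)
  | neg x _ hx =>
    obtain ⟨Z, hZ, hx⟩ := hx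
    exact ⟨Z, hZ, fun F h ht => F.neg_mem (hx F h ht)⟩
  | inv x _ hx =>
    obtain ⟨Z, hZ, hx⟩ := hx
    exact ⟨Z, hZ, fun F h ht => F.inv_mem (hx F h ht)⟩
  | mul x y _ _ hx hy =>
    obtain ⟨Z, hZ, hx⟩ := hx
    obtain ⟨Y, hY, hy⟩ := hy
    refine ⟨Z ∪ Y, by simp [hZ, hY], fun F h ht => ?_⟩
    simp only [Finset.coe_union, Set.union_subset_iff] at h
    exact F.mul_mem (hx F h.1 ht) (hy F h.2 ht)

lemma span_finite_support {Ω : Type*} [Field Ω] (E : Subfield Ω) (t : Ω) {e : ℕ} (b : Fin e → Ω)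
    {x : Ω} (hx : x ∈ Submodule.span (cvgM E t) (Set.range b)) :
    ∃ Z : Finset Ω, (Z : Set Ω) ⊆ E ∧ ∀ F : Subfield Ω, (Z : Set Ω) ⊆ F →
      x ∈ Submodule.span (cvgM F t) (Set.range b) := by
  classical
  obtain ⟨c, hc, rfl⟩ := (mem_span_sub _ _ _).1 hx
  choose Z hZ hZ' using fun i => closure_finite_support E t (hc i)
  refine ⟨Finset.univ.biUnion Z, by simpa using hZ, fun F hF => ?_⟩
  refine (mem_span_sub _ _ _).2 ⟨c, fun i => hZ' i _ ?_ (mem_cvgM _ _), rfl⟩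
  intro z hz
  exact cvgM_le_left _ _ (hF (by simpa using ⟨i, hz⟩))

lemma span_finite_support_finite {Ω : Type*} [Field Ω] (E : Subfield Ω) (t : Ω) {e : ℕ}
    (b : Fin e → Ω) {ι : Type*} [Finite ι] (x : ι → Ω)
    (hx : ∀ i, x i ∈ Submodule.span (cvgM E t) (Set.range b)) :
    ∃ Z : Finset Ω, (Z : Set Ω) ⊆ E ∧ ∀ F : Subfield Ω, (Z : Set Ω) ⊆ F →
      ∀ i, x i ∈ Submodule.span (cvgM F t) (Set.range b) := by
  classical
  have := Fintype.ofFinite ι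
  choose Z hZ hZ' using fun i => span_finite_support E t b (hx i)
  refine ⟨Finset.univ.biUnion Z, by simpa using hZ, fun F hF i => hZ' i F ?_⟩
  intro z hz
  exact hF (by simpa using ⟨i, hz⟩)

/-- Descent: a diagram is defined over a finitely generated field. -/
lemma WD.descent {Ω : Type*} [Field Ω] {E C : Subfield Ω} {t : Ω} {e : ℕ} (h : WD E C t e)
    (G : Finset Ω) (hG : (G : Set Ω) ⊆ C) :
    ∃ (Z : Finset Ω) (b : Fin e → Ω), (Z : Set Ω) ⊆ E ∧ ∀ E0 : Subfield Ω, E0 ≤ E →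
      (Z : Set Ω) ⊆ E0 → ∃ C0 : Subfield Ω, C0 ≤ C ∧ (G : Set Ω) ⊆ C0 ∧ WD E0 C0 t e ∧
        C0 = Subfield.closure (insert t ((E0 : Set Ω) ∪ Set.range b)) := by
  classical
  obtain ⟨ht, b, hb⟩ := h
  have hbC : ∀ i, b i ∈ C := fun i => by
    have : b i ∈ (C : Set Ω) := by rw [hb]; exact Submodule.subset_span ⟨i, rfl⟩
    exact this
  have hC : ∀ x, x ∈ C → x ∈ Submodule.span (cvgM E t) (Set.range b) := fun x hx => by
    have : x ∈ (C : Set Ω) := hx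
    rwa [hb] at this
  obtain ⟨Z1, h1, h1'⟩ := span_finite_support E t b (hC 1 C.one_mem)
  obtain ⟨Z2, h2, h2'⟩ := span_finite_support_finite E t b (fun p : Fin e × Fin e => b p.1 * b p.2)
    (fun p => hC _ (C.mul_mem (hbC _) (hbC _)))
  obtain ⟨Z3, h3, h3'⟩ := span_finite_support_finite E t b (fun p : G => (p : Ω))
    (fun p => hC _ (hG p.2))
  refine ⟨Z1 ∪ (Z2 ∪ Z3), b, by simp [h1, h2, h3], fun E0 hE0 hZ => ?_⟩
  simp only [Finset.coe_union, Set.union_subset_iff] at hZ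
  obtain ⟨C0, hC0, hMC0⟩ := span_field (cvgM E0 t) b (h1' E0 hZ.1)
    (fun i j => h2' E0 hZ.2.1 (i, j))
  have hbC0 : ∀ i, b i ∈ C0 := fun i => by
    have : b i ∈ (C0 : Set Ω) := by rw [hC0]; exact Submodule.subset_span ⟨i, rfl⟩
    exact this
  refine ⟨C0, ?_, ?_, ⟨?_, b, hC0⟩, ?_⟩
  · intro x hx
    have hx : x ∈ (C0 : Set Ω) := hx
    rw [hC0] at hx
    obtain ⟨c, hc, rfl⟩ := (mem_span_sub _ _ _).1 hx
    have : ∑ i, c i * b i ∈ (C : Set Ω) := by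
      rw [hb]
      exact (mem_span_sub _ _ _).2 ⟨c, fun i => cvgM_mono hE0 (hc i), rfl⟩
    exact this
  · intro x hx
    rw [hC0]
    exact h3' E0 hZ.2.2 ⟨x, hx⟩
  · rintro ⟨p, hp, hp0⟩
    refine ht ⟨p.map (Subfield.inclusion hE0), ?_, ?_⟩
    · rwa [Ne, Polynomial.map_eq_zero]
    · rw [← hp0, Polynomial.aeval_def, Polynomial.aeval_def, Polynomial.eval₂_map]
      rfl
  · apply le_antisymm
    · intro x hx
      have hx : x ∈ (C0 : Set Ω) := hx
      rw [hC0] at hx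
      obtain ⟨c, hc, rfl⟩ := (mem_span_sub _ _ _).1 hx
      refine sum_mem fun i _ => mul_mem ?_ (Subfield.subset_closure (by simp))
      refine cvgM_le ?_ ?_ (hc i)
      · intro y hy
        exact Subfield.subset_closure (by simp [hy])
      · exact Subfield.subset_closure (by simp)
    · rw [Subfield.closure_le]
      rintro x (rfl | hx | ⟨i, rfl⟩)
      · exact hMC0 (mem_cvgM _ _)
      · exact hMC0 (cvgM_le_left _ _ hx)
      · exact hbC0 i

lemma transc_map {Ω Ω' : Type*} [Field Ω] [Field Ω'] (φ : Ω →+* Ω') (E : Subfield Ω) (t : Ω) :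
    Transcendental (E.map φ) (φ t) ↔ Transcendental E t := by
  unfold Transcendental
  rw [not_iff_not]
  let ψ : E →+* E.map φ := (φ.comp E.subtype).codRestrict _ (fun x => ⟨x, x.2, rfl⟩)
  have hψ : Function.Surjective ψ := by
    rintro ⟨_, x, hx, rfl⟩
    exact ⟨⟨x, hx⟩, rfl⟩
  constructor
  · rintro ⟨p, hp, hp0⟩
    obtain ⟨q, rfl⟩ := Polynomial.map_surjective ψ hψ p
    refine ⟨q, fun h => hp (by simp [h]), φ.injective ?_⟩
    rw [map_zero, ← hp0, Polynomial.aeval_def, Polynomial.aeval_def, Polynomial.eval₂_map,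
      Polynomial.hom_eval₂]
    rfl
  · rintro ⟨p, hp, hp0⟩
    refine ⟨p.map ψ, ?_, ?_⟩
    · rwa [Ne, Polynomial.map_eq_zero]
    · rw [← map_zero φ, ← hp0, Polynomial.aeval_def, Polynomial.aeval_def, Polynomial.eval₂_map,
        Polynomial.hom_eval₂]
      rfl

lemma WD.map {Ω Ω' : Type*} [Field Ω] [Field Ω'] (φ : Ω →+* Ω') {E C : Subfield Ω} {t : Ω} {e : ℕ}
    (h : WD E C t e) : WD (E.map φ) (C.map φ) (φ t) e := by
  obtain ⟨ht, b, hb⟩ := h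
  refine ⟨(transc_map φ E t).2 ht, φ ∘ b, ?_⟩
  ext x
  simp only [SetLike.mem_coe, mem_span_sub, Subfield.mem_map, cvgM_map]
  have hb' : ∀ x, x ∈ C ↔ ∃ c : Fin e → Ω, (∀ i, c i ∈ cvgM E t) ∧ x = ∑ i, c i * b i := fun x => by
    rw [← mem_span_sub, ← SetLike.mem_coe, hb, SetLike.mem_coe]
  constructor
  · rintro ⟨y, hy, rfl⟩
    obtain ⟨c, hc, rfl⟩ := (hb' y).1 hy
    exact ⟨φ ∘ c, fun i => ⟨c i, hc i, rfl⟩, by simp⟩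
  · rintro ⟨c, hc, rfl⟩
    choose d hd hd' using hc
    refine ⟨∑ i, d i * b i, (hb' _).2 ⟨d, hd, rfl⟩, by simp [hd']⟩

lemma WD.le {Ω : Type*} [Field Ω] {E C : Subfield Ω} {t : Ω} {e : ℕ} (h : WD E C t e) :
    cvgM E t ≤ C := by
  obtain ⟨ht, b, hb⟩ := h
  intro x hx
  have h1 : (1 : Ω) ∈ (C : Set Ω) := C.one_mem
  rw [hb] at h1
  have h2 := Submodule.smul_mem _ (⟨x, hx⟩ : cvgM E t) h1
  have : x ∈ (C : Set Ω) := by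
    rw [hb]; simpa [Subfield.smul_def] using h2
  exact this

lemma WD.restrict {Ω : Type*} [Field Ω] {E C : Subfield Ω} {t : Ω} {e : ℕ}
    (h : WD E C t e) : WD (E.comap C.subtype) ⊤ (⟨t, h.le (mem_cvgM _ _)⟩ : C) e := by
  have hle := h.le
  have hE : (E.comap C.subtype).map C.subtype = E := by
    ext x
    simp only [Subfield.mem_map, Subfield.mem_comap]
    constructor
    · rintro ⟨y, hy, rfl⟩; exact hy
    · intro hx
      exact ⟨⟨x, hle (cvgM_le_left _ _ hx)⟩, hx, rfl⟩
  set t' : C := ⟨t, h.le (mem_cvgM _ _)⟩ with ht'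
  have htt : C.subtype t' = t := rfl
  obtain ⟨ht, b, hb⟩ := h
  have hb' : ∀ x, x ∈ C ↔ ∃ c : Fin e → Ω, (∀ i, c i ∈ cvgM E t) ∧ x = ∑ i, c i * b i := fun x => by
    rw [← mem_span_sub, ← SetLike.mem_coe, hb, SetLike.mem_coe]
  have hbC : ∀ i, b i ∈ C := fun i => by
    have : b i ∈ (C : Set Ω) := by rw [hb]; exact Submodule.subset_span ⟨i, rfl⟩
    exact this
  have hM : cvgM E t = (cvgM (E.comap C.subtype) t').map C.subtype := by
    rw [← cvgM_map, hE, htt]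
  refine ⟨?_, fun i => ⟨b i, hbC i⟩, ?_⟩
  · rw [← transc_map C.subtype, hE, htt]; exact ht
  · ext x
    simp only [SetLike.mem_coe, mem_span_sub, Subfield.mem_top, true_iff]
    obtain ⟨c, hc, hx⟩ := (hb' x).1 x.2
    simp only [hM, Subfield.mem_map] at hc
    choose d hd hd' using hc
    refine ⟨d, hd, Subtype.ext ?_⟩
    rw [hx]
    push_cast
    exact Finset.sum_congr rfl fun i _ => by rw [← hd']; rfl

end CvgAux


section CvgAux
set_option autoImplicit false
set_option linter.style.haveILetI false
open Polynomial

/-- A weak covering diagram: no finite generation, algebraic instead of finite. -/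
def WDiag.{x, u', v'} (k : Type u') (K : Type v') [Field k] [Field K] [Algebra k K] (e : ℕ) : Prop :=
  ∃ (C : Type x) (_ : Field C) (_ : Algebra K C), Algebra.IsAlgebraic K C ∧
    ∃ (E : Subfield C) (t : C), (∀ a : k, algebraMap K C (algebraMap k K a) ∈ E) ∧ WD E ⊤ t e

lemma HasCvgDiagram.wDiag {k : Type u} {K : Type v} [Field k] [Field K] [Algebra k K] {e : ℕ}
    (he : 0 < e) (h : HasCvgDiagram k K e) : WDiag.{max u v} k K e := by
  obtain ⟨K_B, K_C, _, _, _, _, hB, hC, f, π, hf, hr⟩ := h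
  letI := π.toRingHom.toAlgebra
  letI := f.toRingHom.toAlgebra
  have hr : Module.finrank (RatFunc K_B) K_C = e := hr
  have hfin : Module.Finite K K_C := hf
  have hfin2 : FiniteDimensional (RatFunc K_B) K_C := by
    apply FiniteDimensional.of_finrank_pos; omega
  let b := Module.finBasisOfFinrankEq (RatFunc K_B) K_C hr
  have hsm : ∀ (r : RatFunc K_B) (x : K_C), r • x = π r * x := fun r x => Algebra.smul_def r x
  let c : K_B →+* K_C := π.toRingHom.comp RatFunc.C
  have hpoly : ∀ p : K_B[X], π (algebraMap _ _ p) = p.eval₂ c (π RatFunc.X) := by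
    intro p
    induction p using Polynomial.induction_on' with
    | add p q hp hq => simp [hp, hq]
    | monomial n a =>
      rw [Polynomial.eval₂_monomial, ← Polynomial.C_mul_X_pow_eq_monomial]
      simp [c]
  refine ⟨K_C, inferInstance, inferInstance, inferInstance, c.fieldRange, π RatFunc.X, ?_, ?_, b, ?_⟩
  · intro a
    refine ⟨algebraMap k K_B a, ?_⟩
    have h1 : algebraMap K K_C (algebraMap k K a) = algebraMap k K_C a := f.commutes a
    rw [h1, ← π.commutes a]
    change π (RatFunc.C (algebraMap k K_B a)) = _
    congr 1
  · rintro ⟨p, hp, hp0⟩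
    obtain ⟨q, rfl⟩ := Polynomial.map_surjective c.rangeRestrictField
      c.rangeRestrictField_bijective.2 p
    apply hp
    have : π (algebraMap _ _ q) = 0 := by
      rw [hpoly, ← hp0, Polynomial.aeval_def, Polynomial.eval₂_map]
      rfl
    have : algebraMap K_B[X] (RatFunc K_B) q = 0 :=
      π.toRingHom.injective (this.trans (map_zero π).symm)
    have : q = 0 := (IsFractionRing.injective K_B[X] (RatFunc K_B)) (by rw [this, map_zero])
    simp [this]
  · have hM : ∀ r : RatFunc K_B, π r ∈ cvgM c.fieldRange (π RatFunc.X) := by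
      have h1 : ∀ p : K_B[X], π (algebraMap _ _ p) ∈ cvgM c.fieldRange (π RatFunc.X) := by
        intro p
        rw [hpoly, Polynomial.eval₂_eq_sum_range]
        exact sum_mem fun i _ => mul_mem (cvgM_le_left _ _ ⟨_, rfl⟩) (pow_mem (mem_cvgM _ _) _)
      intro r
      rw [← RatFunc.num_div_denom r, map_div₀]
      exact div_mem (h1 _) (h1 _)
    ext x
    simp only [SetLike.mem_coe, mem_span_sub, Subfield.mem_top, true_iff]
    refine ⟨fun i => π (b.repr x i), fun i => hM _, ?_⟩
    conv_lhs => rw [← b.sum_repr x]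
    simp [hsm]

lemma WDiag.hasCvgDiagram.{x} {k : Type u} {K : Type v} [Field k] [Field K] [Algebra k K] {e : ℕ}
    (hK : IsAlgFunctionField k K) (h : WDiag.{x} k K e) :
    ∃ e' ≤ e, 0 < e' ∧ HasCvgDiagram k K e' := by
  classical
  obtain ⟨C, _, _, halg, E, t, hkE, hWD⟩ := h
  let Ω := ULift.{u} (AlgebraicClosure K)
  have hΩ : Algebra.IsAlgebraic K Ω :=
    (ULift.algEquiv (R := K) (A := AlgebraicClosure K)).symm.isAlgebraic
  let φ : C →ₐ[K] Ω := (ULift.algEquiv (R := K) (A := AlgebraicClosure K)).symm.toAlgHom.comp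
    (IsAlgClosed.lift : C →ₐ[K] AlgebraicClosure K)
  have hW := hWD.map (φ : C →+* Ω)
  obtain ⟨g, hg⟩ := hK
  obtain ⟨Z, b, hZ, hdesc⟩ := hW.descent (g.image (algebraMap K Ω)) (by
    intro x hx
    simp only [Finset.coe_image, Set.mem_image] at hx
    obtain ⟨y, hy, rfl⟩ := hx
    exact ⟨algebraMap K C y, trivial, φ.commutes y⟩)
  let E0 : IntermediateField k Ω := IntermediateField.adjoin k Z
  have hE0 : E0.toSubfield ≤ E.map (φ : C →+* Ω) := by
    refine Subfield.closure_le.2 ?_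
    rintro x (⟨a, rfl⟩ | hx)
    · refine ⟨_, hkE a, ?_⟩
      exact (φ.commutes _).trans (IsScalarTower.algebraMap_apply k K Ω a).symm
    · exact hZ hx
  obtain ⟨C1, hC1, hgC, hW0, hcl⟩ := hdesc E0.toSubfield hE0
    (fun x hx => IntermediateField.subset_adjoin k _ hx)
  set t0 : Ω := (φ : C →+* Ω) t with ht0
  let C0 : IntermediateField k Ω := IntermediateField.adjoin k (insert t0 (Z ∪ Set.range b))
  have hC0 : C0.toSubfield = C1 := by
    apply le_antisymm
    · refine Subfield.closure_le.2 ?_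
      have hE : (E0.toSubfield : Set Ω) ⊆ C1 := (cvgM_le_left _ _).trans hW0.le
      rintro x (⟨a, rfl⟩ | rfl | hx | ⟨i, rfl⟩)
      · exact hE (E0.algebraMap_mem a)
      · exact hW0.le (mem_cvgM _ _)
      · exact hE (IntermediateField.subset_adjoin k _ hx)
      · rw [hcl]; exact Subfield.subset_closure (by simp)
    · rw [hcl]
      refine Subfield.closure_le.2 ?_
      rintro x (rfl | hx | ⟨i, rfl⟩)
      · exact IntermediateField.subset_adjoin k _ (by simp)
      · have : E0 ≤ C0 := IntermediateField.adjoin.mono _ _ _ (fun y hy => by simp at hy; simp [hy])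
        exact this hx
      · exact IntermediateField.subset_adjoin k _ (by simp)
  have hmemC0 : ∀ x, x ∈ C0 ↔ x ∈ C1 := fun x => by rw [← hC0]; rfl
  have hEC : E0 ≤ C0 := fun x hx => (hmemC0 x).2 (hW0.le (cvgM_le_left _ _ hx))
  have hEFG : IsAlgFunctionField k E0 := by
    rw [IsAlgFunctionField, IntermediateField.fg_top_iff, IntermediateField.essFiniteType_iff]
    exact IntermediateField.fg_adjoin_of_finite Z.finite_toSet
  have hCess : Algebra.EssFiniteType k C0 := by
    rw [IntermediateField.essFiniteType_iff]
    exact IntermediateField.fg_adjoin_of_finite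
      ((Z.finite_toSet.union (Set.finite_range b)).insert _)
  have hCFG : IsAlgFunctionField k C0 := by
    rw [IsAlgFunctionField, IntermediateField.fg_top_iff]
    exact hCess
  have hKC : ∀ x : K, algebraMap K Ω x ∈ C0 := by
    intro x
    have hx : x ∈ IntermediateField.adjoin k (g : Set K) := by rw [hg]; trivial
    have h2 : IntermediateField.adjoin k (g : Set K) ≤ C0.comap (IsScalarTower.toAlgHom k K Ω) := by
      rw [IntermediateField.adjoin_le_iff]
      intro y hy
      change algebraMap K Ω y ∈ C0
      rw [hmemC0]
      apply hgC
      simp only [Finset.coe_image]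
      exact ⟨y, hy, rfl⟩
    exact h2 hx
  let f : K →ₐ[k] C0 := (IsScalarTower.toAlgHom k K Ω).codRestrict C0.toSubalgebra hKC
  have hfin : f.toRingHom.Finite := by
    letI := f.toRingHom.toAlgebra
    haveI : IsScalarTower k K C0 := IsScalarTower.of_algebraMap_eq fun a => (f.commutes a).symm
    haveI : Algebra.EssFiniteType K C0 := Algebra.EssFiniteType.of_comp k K C0
    let ι : C0 →ₐ[K] Ω := { C0.val.toRingHom with commutes' := fun a => rfl }
    haveI : Algebra.IsAlgebraic K C0 := Algebra.IsAlgebraic.of_injective ι ι.injective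
    exact Algebra.finite_of_essFiniteType_of_isAlgebraic
  let tC : C0 := ⟨t0, (hmemC0 _).2 (hW0.le (mem_cvgM _ _))⟩
  obtain ⟨htr, b', hb'⟩ := hW0
  letI : Algebra E0 C0 := (IntermediateField.inclusion hEC).toRingHom.toAlgebra
  haveI : IsScalarTower k E0 C0 := IsScalarTower.of_algebraMap_eq fun a => rfl
  have hinj : Function.Injective (Polynomial.aeval (R := E0) tC) := by
    rw [injective_iff_map_eq_zero]
    intro p hp
    by_contra hp0
    refine htr ⟨p, hp0, ?_⟩
    have := congrArg (algebraMap C0 Ω) hp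
    rw [map_zero, Polynomial.aeval_def, Polynomial.hom_eval₂] at this
    exact this
  let π : RatFunc E0 →ₐ[k] C0 := RatFunc.liftAlgHom ((Polynomial.aeval (R := E0) tC).restrictScalars k)
    (nonZeroDivisors_le_comap_nonZeroDivisors_of_injective _ hinj)
  have hπ : ∀ p : E0[X], π (algebraMap _ _ p) = Polynomial.aeval tC p := by
    intro p
    have := RatFunc.liftAlgHom_apply_div ((Polynomial.aeval (R := E0) tC).restrictScalars k)
      (nonZeroDivisors_le_comap_nonZeroDivisors_of_injective _ hinj) p 1
    simpa using this
  letI := π.toRingHom.toAlgebra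
  have hsm : ∀ (r : RatFunc E0) (x : C0), r • x = π r * x := fun r x => Algebra.smul_def r x
  have hrange : cvgM E0.toSubfield t0 ≤ (C0.val.toRingHom.comp π.toRingHom).fieldRange := by
    refine cvgM_le ?_ ?_
    · intro x hx
      refine ⟨algebraMap E0[X] _ (Polynomial.C ⟨x, hx⟩), ?_⟩
      change C0.val (π _) = x
      rw [hπ, Polynomial.aeval_C]
      rfl
    · refine ⟨algebraMap E0[X] _ Polynomial.X, ?_⟩
      change C0.val (π _) = t0
      rw [hπ, Polynomial.aeval_X]
      rfl
  have hbC : ∀ i, b' i ∈ C0 := fun i => by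
    rw [hmemC0, ← SetLike.mem_coe, hb']
    exact Submodule.subset_span ⟨i, rfl⟩
  have hspan : Submodule.span (RatFunc E0) (Set.range fun i => (⟨b' i, hbC i⟩ : C0)) = ⊤ := by
    rw [eq_top_iff]
    rintro ⟨x, hx⟩ -
    rw [hmemC0, ← SetLike.mem_coe, hb', SetLike.mem_coe, mem_span_sub] at hx
    obtain ⟨c, hc, hx⟩ := hx
    choose d hd using fun i => hrange (hc i)
    rw [Submodule.mem_span_range_iff_exists_fun]
    refine ⟨d, Subtype.ext ?_⟩
    simp only [hsm]
    rw [hx]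
    push_cast
    exact Finset.sum_congr rfl fun i _ => by rw [← hd]; rfl
  haveI : FiniteDimensional (RatFunc E0) C0 :=
    ⟨⟨(Set.finite_range _).toFinset, by rw [Set.Finite.coe_toFinset]; exact hspan⟩⟩
  refine ⟨Module.finrank (RatFunc E0) C0, ?_, Module.finrank_pos, ?_⟩
  · have := finrank_range_le_card (R := RatFunc E0) (fun i => (⟨b' i, hbC i⟩ : C0))
    rw [Set.finrank, hspan, finrank_top] at this
    simpa using this
  · exact ⟨E0, C0, inferInstance, inferInstance, inferInstance, inferInstance, hEFG, hCFG, f, π,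
      hfin, rfl⟩
end CvgAux


section CvgAux
set_option autoImplicit false
set_option linter.style.haveILetI false
open Polynomial

lemma exists_avoid {k K : Type*} [Field k] [Field K] [Algebra k K] (g : K[X]) (hg : g ≠ 0) :
    ∃ (q : K[X]) (π : k[X]), π ≠ 0 ∧ Irreducible q ∧ q ∣ π.map (algebraMap k K) ∧ IsCoprime q g := by
  have h1 := algebraicClosure.isAlgClosure k (AlgebraicClosure K)
  have h2 := h1.isAlgClosed
  have hinf : Infinite (algebraicClosure k (AlgebraicClosure K)) := inferInstance
  let f : algebraicClosure k (AlgebraicClosure K) → AlgebraicClosure K := fun x => x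
  have hfin : (f ⁻¹' (g.rootSet (AlgebraicClosure K))).Finite :=
    (Polynomial.rootSet_finite g _).preimage (Subtype.val_injective.injOn)
  obtain ⟨a, ha⟩ := hfin.exists_notMem
  have hak : IsIntegral k (a : AlgebraicClosure K) := (mem_algebraicClosure_iff.1 a.2).isIntegral
  have haK : IsIntegral K (a : AlgebraicClosure K) := hak.tower_top
  refine ⟨minpoly K (a : AlgebraicClosure K), minpoly k (a : AlgebraicClosure K),
    minpoly.ne_zero hak, minpoly.irreducible haK, minpoly.dvd_map_of_isScalarTower _ _ _, ?_⟩
  rw [(minpoly.irreducible haK).coprime_iff_not_dvd]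
  rintro ⟨c, hc⟩
  apply ha
  rw [Set.mem_preimage, Polynomial.mem_rootSet]
  refine ⟨hg, ?_⟩
  rw [hc, map_mul]
  simp [f]

lemma exists_place {k K C : Type*} [Field k] [Field K] [Field C] [Algebra k K] [Algebra K C]
    [Algebra k C] [IsScalarTower k K C] (s : C) (hs : Transcendental K s)
    (hC : Algebra.IsAlgebraic (Algebra.adjoin K {s}) C) (Z : Finset C) :
    ∃ (B : ValuationSubring C) (π : k[X]), π ≠ 0 ∧ (∀ a : K, algebraMap K C a ∈ B) ∧ s ∈ B ∧
      (Z : Set C) ⊆ B ∧ aeval s π ∈ B.nonunits := by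
  classical
  have hR : ∀ y : Algebra.adjoin K {s}, ∃ g : K[X], aeval s g = (y : C) := by
    rintro ⟨y, hy⟩
    rw [Algebra.adjoin_singleton_eq_range_aeval] at hy
    exact hy
  have hz : ∀ z : C, ∃ g : K[X], g ≠ 0 ∧ IsIntegral (Algebra.adjoin K {s}) (aeval s g * z) := by
    intro z
    obtain ⟨y, hy, hyz⟩ := (hC.isAlgebraic z).exists_integral_multiple
    obtain ⟨g, hg⟩ := hR y
    refine ⟨g, ?_, ?_⟩
    · rintro rfl
      apply hy
      ext
      rw [← hg]; simp
    · rw [hg]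
      exact hyz
  choose g hg0 hg using hz
  obtain ⟨q, π, hπ, hq, hqπ, hcop⟩ := exists_avoid (k := k) (∏ z ∈ Z, g z)
    (Finset.prod_ne_zero_iff.2 fun z _ => hg0 z)
  have hmem : ∀ f : K[X], aeval s f ∈ Algebra.adjoin K {s} := by
    intro f
    rw [Algebra.adjoin_singleton_eq_range_aeval]
    exact ⟨f, rfl⟩
  let A : Subring C := (Algebra.adjoin K {s}).toSubring
  let Q : A := ⟨aeval s q, hmem q⟩
  have hI : Ideal.span {Q} ≠ ⊤ := by
    intro h
    rw [Ideal.span_singleton_eq_top] at h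
    obtain ⟨y, hy⟩ := h.exists_right_inv
    obtain ⟨f, hf⟩ := hR ⟨y.1, y.2⟩
    have h1 : aeval s (q * f) = aeval s (1 : K[X]) := by
      rw [map_mul, hf, map_one]
      exact congrArg Subtype.val hy
    have h2 : q * f = 1 := (transcendental_iff_injective.1 hs) h1
    exact hq.not_isUnit (IsUnit.of_mul_eq_one _ h2)
  obtain ⟨B, hAB, hIB⟩ := Ideal.image_subset_nonunits_valuationSubring _ hI
  have hB : ∀ f : K[X], aeval s f ∈ B := fun f => hAB (hmem f)
  have hQ : aeval s q ∈ B.nonunits := hIB ⟨Q, Ideal.subset_span rfl, rfl⟩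
  have hQ' := (B.mem_nonunits_iff).1 hQ
  have hle : ∀ f : K[X], B.valuation (aeval s f) ≤ 1 := fun f => (B.valuation_le_one_iff _).2 (hB f)
  refine ⟨B, π, hπ, fun a => by simpa using hB (Polynomial.C a), by simpa using hB X, ?_, ?_⟩
  · intro z hz
    obtain ⟨a, b, hab⟩ := hcop
    have hgz : B.valuation (aeval s (g z)) = 1 := by
      refine le_antisymm (hle _) ?_
      by_contra hlt
      push Not at hlt
      have h1 : B.valuation (aeval s (1 : K[X])) < 1 := by
        rw [← hab, map_add]
        refine Valuation.map_add_lt _ ?_ ?_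
        · rw [map_mul, map_mul]
          exact lt_of_le_of_lt (mul_le_of_le_one_left' (hle a)) hQ'
        · rw [map_mul, map_mul, ← Finset.mul_prod_erase Z g hz, map_mul, map_mul]
          exact lt_of_le_of_lt (mul_le_of_le_one_left' (hle b))
            (lt_of_le_of_lt (mul_le_of_le_one_right' (hle _)) hlt)
      simp at h1
    have hint : IsIntegral B (aeval s (g z) * z) := by
      have h := hg z
      obtain ⟨p, hp, hp0⟩ := h
      let φ : Algebra.adjoin K {s} →+* B := (Subring.inclusion hAB)
      refine ⟨p.map φ, hp.map _, ?_⟩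
      rw [eval₂_map]
      exact hp0
    obtain ⟨y, hy⟩ := (IsIntegrallyClosed.isIntegral_iff (R := B) (K := C)).1 hint
    rw [SetLike.mem_coe, ← B.valuation_le_one_iff]
    have h2 : B.valuation (aeval s (g z) * z) ≤ 1 := by
      rw [← hy]
      exact (B.valuation_le_one_iff _).2 y.2
    rwa [map_mul, hgz, one_mul] at h2
  · rw [B.mem_nonunits_iff]
    obtain ⟨c, hc⟩ := hqπ
    have : aeval s π = aeval s q * aeval s c := by
      rw [← map_mul, ← hc, aeval_map_algebraMap]
    rw [this, map_mul]
    exact lt_of_le_of_lt (mul_le_of_le_one_right' (hle c)) hQ'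

lemma abhyankar {F C ι : Type*} [Field F] [Field C] [Algebra F C] (B : ValuationSubring C)
    [Algebra F B] [IsScalarTower F B C] (σ : C) (h0 : σ ≠ 0) (hσ : σ ∈ B.nonunits) (z : ι → B)
    (hz : AlgebraicIndependent F (fun i => IsLocalRing.residue B (z i))) :
    AlgebraicIndependent F (fun o : Option ι => o.elim σ (fun i => (z i : C))) := by
  have hzB : AlgebraicIndependent F z :=
    AlgebraicIndependent.of_comp (IsScalarTower.toAlgHom F B (IsLocalRing.ResidueField B)) hz
  have hzC : AlgebraicIndependent F (fun i => (z i : C)) :=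
    hzB.map' (f := IsScalarTower.toAlgHom F B C) Subtype.val_injective
  refine AlgebraicIndependent.option_iff.2 ⟨hzC, ?_⟩
  intro halg
  obtain ⟨q, hq0, hq⟩ := IsAlgebraic.exists_nonzero_coeff_and_aeval_eq_zero halg
    (mem_nonZeroDivisors_of_ne_zero h0)
  have hrep : ∀ y : Algebra.adjoin F (Set.range fun i => (z i : C)),
      ∃ P : MvPolynomial ι F, (y : C) = ((MvPolynomial.aeval z P : B) : C) := by
    rintro ⟨y, hy⟩
    rw [Algebra.adjoin_range_eq_range_aeval] at hy
    obtain ⟨P, rfl⟩ := hy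
    refine ⟨P, ?_⟩
    exact (MvPolynomial.aeval_algebraMap_apply (A := B) C z P)
  have hle : ∀ y : Algebra.adjoin F (Set.range fun i => (z i : C)), B.valuation (y : C) ≤ 1 := by
    intro y
    obtain ⟨P, hP⟩ := hrep y
    rw [hP]
    exact (B.valuation_le_one_iff _).2 (Subtype.mem _)
  have hσ' := B.mem_nonunits_iff.1 hσ
  have hσB : σ ∈ B := (B.valuation_le_one_iff _).1 hσ'.le
  have hdiv : B.valuation (aeval σ q.divX) ≤ 1 := by
    rw [B.valuation_le_one_iff, aeval_eq_sum_range]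
    refine sum_mem fun i _ => ?_
    rw [Algebra.smul_def]
    exact mul_mem ((B.valuation_le_one_iff _).1 (hle _)) (pow_mem hσB _)
  have hlt : B.valuation (q.coeff 0 : C) < 1 := by
    have h1 : aeval σ (q.divX * X + Polynomial.C (q.coeff 0)) = 0 := by rw [divX_mul_X_add, hq]
    rw [map_add, map_mul, aeval_X, aeval_C] at h1
    have h2 : (q.coeff 0 : C) = - (aeval σ q.divX * σ) := by
      rw [eq_neg_iff_add_eq_zero, add_comm]; exact h1
    rw [h2, Valuation.map_neg, map_mul]
    exact lt_of_le_of_lt (mul_le_of_le_one_left' hdiv) hσ'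
  obtain ⟨P, hP⟩ := hrep (q.coeff 0)
  rw [hP, ← B.valuation_lt_one_iff, ← IsLocalRing.residue_eq_zero_iff] at hlt
  have h3 : MvPolynomial.aeval (fun i => IsLocalRing.residue B (z i)) P = 0 := by
    rw [← hlt]
    exact (MvPolynomial.aeval_algebraMap_apply (A := B) (IsLocalRing.ResidueField B) z P)
  have h4 : P = 0 := hz (by rw [h3, map_zero])
  apply hq0
  ext
  rw [hP, h4]
  simp

/-- The residue field of `E` inside the residue field of `B`. -/
def resField {C : Type*} [Field C] (B : ValuationSubring C) (E : Subfield C) :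
    Subfield (IsLocalRing.ResidueField B) where
  carrier := {x | ∃ b : B, (b : C) ∈ E ∧ IsLocalRing.residue B b = x}
  mul_mem' := by
    rintro _ _ ⟨b, hb, rfl⟩ ⟨c, hc, rfl⟩
    exact ⟨b * c, E.mul_mem hb hc, map_mul _ _ _⟩
  one_mem' := ⟨1, E.one_mem, map_one _⟩
  add_mem' := by
    rintro _ _ ⟨b, hb, rfl⟩ ⟨c, hc, rfl⟩
    exact ⟨b + c, E.add_mem hb hc, map_add _ _ _⟩
  zero_mem' := ⟨0, E.zero_mem, map_zero _⟩
  neg_mem' := by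
    rintro _ ⟨b, hb, rfl⟩
    exact ⟨-b, E.neg_mem hb, map_neg _ _⟩
  inv_mem' := by
    rintro _ ⟨b, hb, rfl⟩
    by_cases h : IsUnit b
    · obtain ⟨u, rfl⟩ := h
      have hu : ((u⁻¹ : Bˣ) : C) = (u : C)⁻¹ := by
        refine eq_inv_of_mul_eq_one_left ?_
        exact congrArg Subtype.val (Units.inv_mul u)
      refine ⟨(u⁻¹ : Bˣ), by rw [hu]; exact E.inv_mem hb, ?_⟩
      refine eq_inv_of_mul_eq_one_left ?_
      rw [← map_mul, Units.inv_mul, map_one]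
    · have : IsLocalRing.residue B b = 0 := by
        rw [IsLocalRing.residue_eq_zero_iff]; exact h
      rw [this, inv_zero]
      exact ⟨0, E.zero_mem, map_zero _⟩

lemma mem_resField {C : Type*} [Field C] (B : ValuationSubring C) (E : Subfield C)
    (x : IsLocalRing.ResidueField B) :
    x ∈ resField B E ↔ ∃ b : B, (b : C) ∈ E ∧ IsLocalRing.residue B b = x := Iff.rfl

lemma residue_inv {C : Type*} [Field C] (B : ValuationSubring C) (x : C) (hx : x ∈ B)
    (hx' : x⁻¹ ∈ B) : IsLocalRing.residue B ⟨x⁻¹, hx'⟩ = (IsLocalRing.residue B ⟨x, hx⟩)⁻¹ := by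
  by_cases h : x = 0
  · subst h
    have h1 : (⟨0, hx⟩ : B) = 0 := rfl
    have h2 : (⟨0⁻¹, hx'⟩ : B) = 0 := Subtype.ext inv_zero
    rw [h1, h2]; simp
  · refine eq_inv_of_mul_eq_one_left ?_
    rw [← map_mul, ← map_one (IsLocalRing.residue B)]
    congr 1
    exact Subtype.ext (inv_mul_cancel₀ h)

lemma residue_support {C : Type*} [Field C] (E : Subfield C) (t : C) (m : C) (hm : m ∈ cvgM E t) :
    ∃ Z : Finset C, ∀ (B : ValuationSubring C), (Z : Set C) ⊆ B → ∀ ht : t ∈ B, ∃ hmB : m ∈ B,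
      ∀ F : Subfield (IsLocalRing.ResidueField B), resField B E ≤ F →
        IsLocalRing.residue B ⟨t, ht⟩ ∈ F → IsLocalRing.residue B ⟨m, hmB⟩ ∈ F := by
  classical
  unfold cvgM at hm
  induction hm using Subfield.closure_induction with
  | mem x hx =>
    rcases hx with rfl | hx
    · exact ⟨∅, fun B _ ht => ⟨ht, fun F _ h => h⟩⟩
    · exact ⟨{x}, fun B hB ht => ⟨hB (by simp), fun F h _ => h ⟨_, hx, rfl⟩⟩⟩
  | one => exact ⟨∅, fun B _ ht => ⟨B.one_mem, fun F _ _ => F.one_mem⟩⟩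
  | add x y _ _ hx hy =>
    obtain ⟨Z, hx⟩ := hx
    obtain ⟨Y, hy⟩ := hy
    refine ⟨Z ∪ Y, fun B h ht => ?_⟩
    simp only [Finset.coe_union, Set.union_subset_iff] at h
    obtain ⟨h1, h2⟩ := hx B h.1 ht
    obtain ⟨h3, h4⟩ := hy B h.2 ht
    exact ⟨B.add_mem _ _ h1 h3, fun F hF hF' => F.add_mem (h2 F hF hF') (h4 F hF hF')⟩
  | neg x _ hx =>
    obtain ⟨Z, hx⟩ := hx
    refine ⟨Z, fun B h ht => ?_⟩
    obtain ⟨h1, h2⟩ := hx B h ht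
    exact ⟨B.neg_mem _ h1, fun F hF hF' => F.neg_mem (h2 F hF hF')⟩
  | inv x _ hx =>
    obtain ⟨Z, hx⟩ := hx
    refine ⟨insert x⁻¹ Z, fun B h ht => ?_⟩
    simp only [Finset.coe_insert, Set.insert_subset_iff] at h
    obtain ⟨h1, h2⟩ := hx B h.2 ht
    refine ⟨h.1, fun F hF hF' => ?_⟩
    rw [residue_inv B x h1 h.1]
    exact F.inv_mem (h2 F hF hF')
  | mul x y _ _ hx hy =>
    obtain ⟨Z, hx⟩ := hx
    obtain ⟨Y, hy⟩ := hy
    refine ⟨Z ∪ Y, fun B h ht => ?_⟩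
    simp only [Finset.coe_union, Set.union_subset_iff] at h
    obtain ⟨h1, h2⟩ := hx B h.1 ht
    obtain ⟨h3, h4⟩ := hy B h.2 ht
    exact ⟨B.mul_mem _ _ h1 h3, fun F hF hF' => F.mul_mem (h2 F hF hF') (h4 F hF hF')⟩

end CvgAux


section CvgAux
set_option autoImplicit false
set_option linter.style.haveILetI false
open Polynomial

lemma alg_support {C : Type*} [Field C] (E : Subfield C) (t : C) (x : C)
    (hx : IsAlgebraic (cvgM E t) x) :
    ∃ Z : Finset C, ∀ (B : ValuationSubring C), (Z : Set C) ⊆ B → ∀ ht : t ∈ B, ∃ hxB : x ∈ B,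
      ∀ F : Subfield (IsLocalRing.ResidueField B), resField B E ≤ F →
        IsLocalRing.residue B ⟨t, ht⟩ ∈ F → IsAlgebraic F (IsLocalRing.residue B ⟨x, hxB⟩) := by
  classical
  obtain ⟨p, hp, hpx⟩ := hx.isIntegral
  choose Z hZ using fun n => residue_support E t (p.coeff n) (p.coeff n).2
  refine ⟨(Finset.range (p.natDegree + 1)).biUnion Z, fun B hB ht => ?_⟩
  have hco : ∀ n, ∃ hmB : (p.coeff n : C) ∈ B, ∀ F : Subfield (IsLocalRing.ResidueField B), resField B E ≤ F →
        IsLocalRing.residue B ⟨t, ht⟩ ∈ F → IsLocalRing.residue B ⟨p.coeff n, hmB⟩ ∈ F := by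
    intro n
    by_cases hn : n ≤ p.natDegree
    · refine hZ n B ?_ ht
      intro z hz
      refine hB ?_
      simp only [Finset.coe_biUnion, Set.mem_iUnion]
      exact ⟨n, by simpa using Nat.lt_succ_of_le hn, hz⟩
    · have h0 : (p.coeff n : C) = 0 := by
        rw [coeff_eq_zero_of_natDegree_lt (not_le.1 hn)]; rfl
      have h1 : (p.coeff n : C) ∈ B := by rw [h0]; exact B.zero_mem
      refine ⟨h1, fun F _ _ => ?_⟩
      have : (⟨p.coeff n, h1⟩ : B) = 0 := Subtype.ext h0
      rw [this, map_zero]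
      exact F.zero_mem
  choose hcB hcF using hco
  have hlift : ∃ P : B[X], P.map (algebraMap B C) = p.map (algebraMap (cvgM E t) C) := by
    rw [← mem_lifts, lifts_iff_coeff_lifts]
    intro n
    rw [coeff_map]
    exact ⟨⟨_, hcB n⟩, rfl⟩
  obtain ⟨P, hP⟩ := hlift
  have hinj : Function.Injective (algebraMap B C) := Subtype.val_injective
  have hPm : P.Monic := by
    have := hp.map (algebraMap (cvgM E t) C)
    rw [← hP] at this
    exact Polynomial.monic_of_injective hinj this
  have hPx : P.eval₂ (algebraMap B C) x = 0 := by
    rw [← eval_map, hP, eval_map]; exact hpx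
  obtain ⟨y, hy⟩ := (IsIntegrallyClosed.isIntegral_iff (R := B) (K := C)).1 ⟨P, hPm, hPx⟩
  have hxB : x ∈ B := by rw [← hy]; exact y.2
  refine ⟨hxB, fun F hF hFt => ?_⟩
  have hyx : (⟨x, hxB⟩ : B) = y := Subtype.ext hy.symm
  rw [hyx]
  have hPy : P.eval y = 0 := by
    apply hinj
    rw [map_zero, ← hPx, ← hy, eval₂_at_apply]
  have hl2 : ∃ R : F[X], R.map (algebraMap F _) = P.map (IsLocalRing.residue B) := by
    rw [← mem_lifts, lifts_iff_coeff_lifts]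
    intro n
    rw [coeff_map]
    have h1 : P.coeff n = ⟨_, hcB n⟩ := by
      apply Subtype.ext
      have := congrArg (fun q => coeff q n) hP
      simp only [coeff_map] at this
      exact this
    rw [h1]
    exact ⟨⟨_, hcF n F hF hFt⟩, rfl⟩
  obtain ⟨R, hR⟩ := hl2
  refine ⟨R, ?_, ?_⟩
  · rintro rfl
    rw [Polynomial.map_zero] at hR
    exact (hPm.map (IsLocalRing.residue B)).ne_zero hR.symm
  · rw [aeval_def, ← eval_map, hR, eval_map, eval₂_at_apply, hPy, map_zero]

lemma cvgM_frac {C : Type*} [Field C] (E : Subfield C) (t m : C) (hm : m ∈ cvgM E t) :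
    ∃ p q : E[X], aeval t q ≠ 0 ∧ aeval t q * m = aeval t p := by
  have h1 : m ∈ IntermediateField.adjoin E {t} := by
    have h2 : cvgM E t ≤ (IntermediateField.adjoin E {t}).toSubfield := by
      refine cvgM_le ?_ ?_
      · intro x hx
        exact (IntermediateField.adjoin E {t}).algebraMap_mem ⟨x, hx⟩
      · exact IntermediateField.mem_adjoin_simple_self E t
    exact h2 hm
  rw [IntermediateField.mem_adjoin_simple_iff] at h1
  obtain ⟨p, q, h⟩ := h1
  by_cases hq : aeval t q = 0
  · refine ⟨0, 1, by simp, ?_⟩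
    rw [h, hq]; simp
  · exact ⟨p, q, hq, by rw [h]; field_simp⟩

lemma residue_linInd {C I : Type*} [Field C] (B : ValuationSubring C) (E : Subfield C) (t : C)
    (ht : t ∈ B) (htr : Transcendental (resField B E) (IsLocalRing.residue B ⟨t, ht⟩))
    (b : I → B) (hb : LinearIndependent (cvgM (resField B E) (IsLocalRing.residue B ⟨t, ht⟩))
      (fun i => IsLocalRing.residue B (b i))) :
    LinearIndependent (cvgM E t) (fun i => (b i : C)) := by
  classical
  rw [linearIndependent_iff']
  intro s m hm
  by_contra hne
  push Not at hne
  obtain ⟨j, hjs, hj⟩ := hne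
  choose p q hq hpq using fun i => cvgM_frac E t (m i) (m i).2
  -- common denominator
  obtain ⟨P, hP⟩ : ∃ P : I → E[X], ∀ i ∈ s, aeval t (P i) = (∏ l ∈ s, aeval t (q l)) * m i := by
    refine ⟨fun i => p i * ∏ l ∈ s.erase i, q l, ?_⟩
    intro i hi
    simp only [map_mul, map_prod]
    rw [← hpq, ← Finset.mul_prod_erase s (fun l => aeval t (q l)) hi]
    ring
  have hsum : ∑ i ∈ s, aeval t (P i) * (b i : C) = 0 := by
    have : ∑ i ∈ s, aeval t (P i) * (b i : C) =
        (∏ l ∈ s, aeval t (q l)) * ∑ i ∈ s, m i • (b i : C) := by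
      rw [Finset.mul_sum]
      refine Finset.sum_congr rfl fun i hi => ?_
      rw [hP i hi, Subfield.smul_def, smul_eq_mul, mul_assoc]
    rw [this, hm, mul_zero]
  have hPj : P j ≠ 0 := by
    intro h0
    have := hP j hjs
    rw [h0, map_zero] at this
    refine mul_ne_zero (Finset.prod_ne_zero_iff.2 fun l _ => hq l) ?_ this.symm
    simpa using hj
  -- the largest coefficient
  obtain ⟨T, hTs, hT⟩ : ∃ T : Finset (I × ℕ), (∀ x ∈ T, x.1 ∈ s) ∧
      ∀ i ∈ s, ∀ n, n ≤ (P i).natDegree → (i, n) ∈ T := by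
    refine ⟨s ×ˢ Finset.range ((s.sup fun i => (P i).natDegree) + 1), ?_, ?_⟩
    · intro x hx
      exact (Finset.mem_product.1 hx).1
    · intro i hi n hn
      simp only [Finset.mem_product, Finset.mem_range]
      exact ⟨hi, Nat.lt_succ_of_le (hn.trans (Finset.le_sup (f := fun i => (P i).natDegree) hi))⟩
  obtain ⟨⟨i0, n0⟩, h0T, hmax⟩ := Finset.exists_max_image T
    (fun x => B.valuation ((P x.1).coeff x.2 : C)) ⟨_, hT j hjs _ le_rfl⟩
  have hi0 : i0 ∈ s := hTs _ h0T
  obtain ⟨a0, ha0⟩ : ∃ a : E, a = (P i0).coeff n0 := ⟨_, rfl⟩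
  have hval : ∀ i ∈ s, ∀ n, B.valuation ((P i).coeff n : C) ≤ B.valuation (a0 : C) := by
    intro i hi n
    by_cases hn : n ≤ (P i).natDegree
    · have h := hmax (i, n) (hT i hi n hn)
      rw [ha0]
      exact h
    · have h := coeff_eq_zero_of_natDegree_lt (not_le.1 hn)
      rw [h, ZeroMemClass.coe_zero, map_zero]
      exact zero_le
  have ha00 : (a0 : C) ≠ 0 := by
    intro h0
    have h1 := hval j hjs (P j).natDegree
    rw [h0, map_zero] at h1
    have h1' := (Valuation.zero_iff _).1 (le_antisymm h1 zero_le)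
    have h2 : (P j).coeff (P j).natDegree = 0 := Subtype.ext h1'
    exact hPj (leadingCoeff_eq_zero.1 h2)
  have hcB : ∀ i ∈ s, ∀ n, ((a0 : C)⁻¹ * ((P i).coeff n : C)) ∈ B := by
    intro i hi n
    rw [← B.valuation_le_one_iff, map_mul, map_inv₀]
    have h3 := hval i hi n
    have h4 : B.valuation (a0 : C) ≠ 0 := by simpa using ha00
    calc _ ≤ (B.valuation (a0 : C))⁻¹ * B.valuation (a0 : C) := by gcongr
      _ = 1 := inv_mul_cancel₀ h4
  -- reduced polynomials
  have hred : ∀ i ∈ s, ∃ Q : (resField B E)[X], ∃ r : B, (r : C) = (a0 : C)⁻¹ * aeval t (P i) ∧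
      IsLocalRing.residue B r = aeval (IsLocalRing.residue B ⟨t, ht⟩) Q ∧
      ∀ n, ∃ h : (a0 : C)⁻¹ * ((P i).coeff n : C) ∈ B, (Q.coeff n : IsLocalRing.ResidueField B) = IsLocalRing.residue B ⟨_, h⟩ := by
    intro i hi
    have h5 : ∃ R : B[X], ∀ n, ((R.coeff n : B) : C) = (a0 : C)⁻¹ * ((P i).coeff n : C) := by
      have : (Polynomial.C (a0⁻¹) * P i).map (algebraMap E C) ∈ lifts (algebraMap B C) := by
        rw [lifts_iff_coeff_lifts]
        intro n
        rw [coeff_map, coeff_C_mul]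
        exact ⟨⟨_, hcB i hi n⟩, by simp; rfl⟩
      obtain ⟨R, hR⟩ := (mem_lifts _).1 this
      refine ⟨R, fun n => ?_⟩
      have := congrArg (fun q => coeff q n) hR
      simp only [coeff_map, coeff_C_mul] at this
      exact this
    obtain ⟨R, hR⟩ := h5
    have h6 : ∃ Q : (resField B E)[X], Q.map (algebraMap _ (IsLocalRing.ResidueField B)) = R.map (IsLocalRing.residue B) := by
      rw [← mem_lifts, lifts_iff_coeff_lifts]
      intro n
      rw [coeff_map]
      refine ⟨⟨_, R.coeff n, ?_, rfl⟩, rfl⟩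
      rw [hR]
      exact E.mul_mem (E.inv_mem a0.2) (Subtype.mem _)
    obtain ⟨Q, hQ⟩ := h6
    refine ⟨Q, R.eval ⟨t, ht⟩, ?_, ?_, ?_⟩
    · have h7 : algebraMap B C (R.eval ⟨t, ht⟩) = (R.map (algebraMap B C)).eval t := by
        rw [eval_map]
        exact (eval₂_at_apply (algebraMap B C) ⟨t, ht⟩).symm
      refine h7.trans ?_
      have h8 : R.map (algebraMap B C) = (Polynomial.C (a0⁻¹) * P i).map (algebraMap E C) := by
        ext n
        rw [coeff_map, coeff_map, coeff_C_mul]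
        exact (hR n).trans (by simp; rfl)
      rw [h8, eval_map_algebraMap, map_mul, aeval_C]
      congr 1
    · rw [aeval_def, ← eval_map, hQ, eval_map, eval₂_at_apply]
    · intro n
      refine ⟨hcB i hi n, ?_⟩
      have := congrArg (fun q => coeff q n) hQ
      simp only [coeff_map] at this
      refine this.trans ?_
      congr 1
      exact Subtype.ext (hR n)
  choose! Q r hr hrQ hQc using hred
  have hsum2 : ∑ i ∈ s, r i * b i = 0 := by
    apply Subtype.ext
    push_cast
    have : ∑ i ∈ s, (r i : C) * (b i : C) = (a0 : C)⁻¹ * ∑ i ∈ s, aeval t (P i) * (b i : C) := by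
      rw [Finset.mul_sum]
      exact Finset.sum_congr rfl fun i hi => by rw [hr i hi, mul_assoc]
    rw [this, hsum, mul_zero]
  have hsum3 : ∑ i ∈ s, aeval (IsLocalRing.residue B ⟨t, ht⟩) (Q i) * IsLocalRing.residue B (b i) = 0 := by
    rw [← map_zero (IsLocalRing.residue B), ← hsum2, map_sum]
    exact Finset.sum_congr rfl fun i hi => by rw [map_mul, hrQ i hi]
  have hN : ∀ q : (resField B E)[X], aeval (IsLocalRing.residue B ⟨t, ht⟩) q ∈
      cvgM (resField B E) (IsLocalRing.residue B ⟨t, ht⟩) := by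
    intro q
    rw [aeval_eq_sum_range]
    refine sum_mem fun n _ => ?_
    rw [Algebra.smul_def]
    exact mul_mem (cvgM_le_left _ _ (Subtype.mem _)) (pow_mem (mem_cvgM _ _) _)
  have hz := linearIndependent_iff'.1 hb s (fun i => ⟨_, hN (Q i)⟩) hsum3 i0 hi0
  have hz' : aeval (IsLocalRing.residue B ⟨t, ht⟩) (Q i0) = 0 := congrArg Subtype.val hz
  have hQ0 : Q i0 = 0 := (transcendental_iff_injective.1 htr) (by rw [hz', map_zero])
  obtain ⟨h9, h10⟩ := hQc i0 hi0 n0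
  have h11 : (⟨_, h9⟩ : B) = 1 := Subtype.ext (by
    change (a0 : C)⁻¹ * ((P i0).coeff n0 : C) = 1
    rw [← ha0]; exact inv_mul_cancel₀ ha00)
  rw [h11, map_one, hQ0] at h10
  simp at h10

lemma residue_span {C : Type*} [Field C] (B : ValuationSubring C) (E : Subfield C) (t : C)
    (ht : t ∈ B) (htr : Transcendental (resField B E) (IsLocalRing.residue B ⟨t, ht⟩))
    {e : ℕ} (hWD : WD E ⊤ t e) :
    WD (resField B E) ⊤ (IsLocalRing.residue B ⟨t, ht⟩) e := by
  refine ⟨htr, ?_⟩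
  obtain ⟨-, b, hb⟩ := hWD
  have hb' : Submodule.span (cvgM E t) (Set.range b) = ⊤ := by
    apply SetLike.coe_injective
    rw [← hb]; rfl
  have hrank : Module.rank (cvgM E t) C ≤ e := by
    rw [← rank_top, ← hb']
    refine (rank_span_le _).trans ?_
    have h := Cardinal.mk_range_le_lift (f := b)
    simpa using h
  obtain ⟨I, β⟩ : Σ I : Type _, Module.Basis I (cvgM (resField B E) (IsLocalRing.residue B ⟨t, ht⟩))
    (IsLocalRing.ResidueField B) := ⟨_, Module.Basis.ofVectorSpace _ _⟩
  choose b' hb'' using fun i => IsLocalRing.residue_surjective (β i)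
  have hli := residue_linInd B E t ht htr b' (by
    have : (fun i => IsLocalRing.residue B (b' i)) = β := funext hb''
    rw [this]; exact β.linearIndependent)
  have hI : Cardinal.mk I ≤ e := hli.cardinal_le_rank.trans hrank
  have hfin : Finite I := Cardinal.lt_aleph0_iff_finite.1 (hI.trans_lt Cardinal.natCast_lt_aleph0)
  have hcard : Nat.card I ≤ e := by
    have := Cardinal.toNat_le_toNat hI Cardinal.natCast_lt_aleph0
    rw [Cardinal.toNat_natCast] at this
    exact this
  obtain ⟨f⟩ : Nonempty (I ↪ Fin e) := by
    have := Fintype.ofFinite I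
    refine Function.Embedding.nonempty_of_card_le ?_
    simpa [Nat.card_eq_fintype_card] using hcard
  refine ⟨Function.extend f β 0, ?_⟩
  have : Submodule.span (cvgM (resField B E) (IsLocalRing.residue B ⟨t, ht⟩))
      (Set.range (Function.extend f β 0)) = ⊤ := by
    rw [eq_top_iff, ← β.span_eq]
    refine Submodule.span_mono ?_
    rintro _ ⟨i, rfl⟩
    exact ⟨f i, f.injective.extend_apply _ _ _⟩
  rw [this]; rfl

end CvgAux


section CvgAux
set_option autoImplicit false
set_option linter.style.haveILetI false
open Polynomial

lemma isAlg_of_ring {R Ω : Type*} [CommRing R] [Field Ω] [Algebra R Ω] (F : Subfield Ω)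
    (hinj : Function.Injective (algebraMap R Ω)) (h : ∀ r, algebraMap R Ω r ∈ F) {y : Ω}
    (hy : IsAlgebraic R y) : IsAlgebraic F y := by
  obtain ⟨p, hp, hpy⟩ := hy
  let φ : R →+* F := (algebraMap R Ω).codRestrict F h
  have hφ : Function.Injective φ := fun a b hab => hinj (congrArg Subtype.val hab)
  refine ⟨p.map φ, ?_, ?_⟩
  · rwa [Ne, Polynomial.map_eq_zero_iff hφ]
  · rw [aeval_def, eval₂_map]
    exact hpy

lemma isAlg_of_mem {Ω : Type*} [Field Ω] (F : Subfield Ω) {y : Ω} (hy : y ∈ F) : IsAlgebraic F y :=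
  isAlgebraic_algebraMap (⟨y, hy⟩ : F)

lemma isAlg_mono {Ω : Type*} [Field Ω] {F F' : Subfield Ω} (h : F ≤ F') {y : Ω}
    (hy : IsAlgebraic F y) : IsAlgebraic F' y :=
  isAlg_of_ring F' Subtype.val_injective (fun r => h r.2) hy

lemma isAlg_trans {Ω : Type*} [Field Ω] {F F' : Subfield Ω} (h : ∀ x ∈ F', IsAlgebraic F x) {y : Ω}
    (hy : IsAlgebraic F' y) : IsAlgebraic F y := by
  have h1 : IsAlgebraic (algebraicClosure F Ω) y := by
    refine isAlg_of_ring (algebraicClosure F Ω).toSubfield Subtype.val_injective (R := F') ?_ hy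
    intro r
    exact mem_algebraicClosure_iff.2 (h r r.2)
  exact h1.restrictScalars F

lemma isAlg_closure {Ω : Type*} [Field Ω] {F : Subfield Ω} {S : Set Ω}
    (h : ∀ x ∈ S, IsAlgebraic F x) {y : Ω} (hy : y ∈ Subfield.closure S) : IsAlgebraic F y := by
  have h1 : Subfield.closure S ≤ (algebraicClosure F Ω).toSubfield :=
    Subfield.closure_le.2 fun x hx => mem_algebraicClosure_iff.2 (h x hx)
  exact mem_algebraicClosure_iff.1 (h1 hy)

/-- The subfield generated by the image of `k` and `S`. -/
def genF (k : Type*) {Ω : Type*} [Field k] [Field Ω] [Algebra k Ω] (S : Set Ω) : Subfield Ω :=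
  Subfield.closure (Set.range (algebraMap k Ω) ∪ S)

lemma genF_le {k Ω : Type*} [Field k] [Field Ω] [Algebra k Ω] {S : Set Ω} {F : Subfield Ω}
    (h : ∀ a : k, algebraMap k Ω a ∈ F) (hS : S ⊆ F) : genF k S ≤ F :=
  Subfield.closure_le.2 (Set.union_subset (Set.range_subset_iff.2 h) hS)

lemma map_mem_genF {k Ω : Type*} [Field k] [Field Ω] [Algebra k Ω] {S : Set Ω} (a : k) :
    algebraMap k Ω a ∈ genF k S := Subfield.subset_closure (Or.inl ⟨a, rfl⟩)

lemma subset_genF {k Ω : Type*} [Field k] [Field Ω] [Algebra k Ω] {S : Set Ω} :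
    S ⊆ genF k S := fun _ hx => Subfield.subset_closure (Or.inr hx)

lemma genF_eq {k Ω : Type*} [Field k] [Field Ω] [Algebra k Ω] {S : Set Ω} :
    genF k S = (IntermediateField.adjoin k S).toSubfield := rfl

open IntermediateField.algebraAdjoinAdjoin in
lemma isAlg_adjoin_iff {k Ω : Type*} [Field k] [Field Ω] [Algebra k Ω] {S : Set Ω} {y : Ω} :
    IsAlgebraic (Algebra.adjoin k S) y ↔ IsAlgebraic (genF k S) y := by
  constructor
  · intro h
    refine isAlg_of_ring _ Subtype.val_injective (fun r => ?_) h
    exact IntermediateField.algebra_adjoin_le_adjoin k S r.2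
  · intro h
    have h : IsAlgebraic (IntermediateField.adjoin k S) y := h
    exact (IsFractionRing.isAlgebraic_iff (Algebra.adjoin k S) (IntermediateField.adjoin k S) Ω).2 h

lemma isAlg_adjoin_iff' {k Ω : Type*} [Field k] [Field Ω] [Algebra k Ω] {S : Set Ω} :
    Algebra.IsAlgebraic (Algebra.adjoin k S) Ω ↔ ∀ y : Ω, IsAlgebraic (genF k S) y := by
  rw [Algebra.isAlgebraic_def]
  simp only [isAlg_adjoin_iff]

lemma ai_card_le {F A ι J : Type*} [Field F] [Field A] [Algebra F A] [Finite J] {x : ι → A}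
    (hx : AlgebraicIndependent F x) (y : J → A) (hy : ∀ a : A, IsAlgebraic (genF F (Set.range y)) a) :
    Finite ι ∧ Nat.card ι ≤ Nat.card J := by
  have := isAlg_adjoin_iff'.2 hy
  have h1 := hx.lift_cardinalMk_le_trdeg
  have h2 : Algebra.trdeg F A ≤ Cardinal.mk (Set.range y) := Algebra.IsAlgebraic.trdeg_le_cardinalMk F _
  have h3 := Cardinal.mk_range_le_lift (f := y)
  have h4 : Cardinal.mk (Set.range y) = (Nat.card (Set.range y) : ℕ) := (Nat.cast_card).symm
  have h5 : Nat.card (Set.range y) ≤ Nat.card J := Finite.card_range_le y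
  rw [h4] at h2
  have h6 := h1.trans (Cardinal.lift_le.2 h2)
  rw [Cardinal.lift_natCast, Cardinal.lift_le_nat_iff] at h6
  have hfin : Finite ι := Cardinal.lt_aleph0_iff_finite.1 (h6.trans_lt Cardinal.natCast_lt_aleph0)
  refine ⟨hfin, le_trans ?_ h5⟩
  rw [← Nat.cast_card] at h6
  exact_mod_cast h6

end CvgAux


section CvgAux
set_option autoImplicit false
set_option linter.style.haveILetI false
open Polynomial

lemma exists_fin_trbasis (k K : Type*) [Field k] [Field K] [Algebra k K]
    [Algebra.EssFiniteType k K] : ∃ (n : ℕ) (x : Fin n → K), AlgebraicIndependent k x ∧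
      ∀ y : K, IsAlgebraic (genF k (Set.range x)) y := by
  obtain ⟨S, hS⟩ := exists_isTranscendenceBasis k K
  have hfin := finite_of_isTranscendenceBasis hS
  obtain ⟨n, ⟨f⟩⟩ := Finite.exists_equiv_fin S
  have hx : IsTranscendenceBasis k (fun i => ((f.symm i : S) : K)) := hS.comp_equiv f.symm
  have := isTranscendenceBasis_iff_algebraicIndependent_isAlgebraic.1 hx
  exact ⟨n, _, this.1, isAlg_adjoin_iff'.1 this.2⟩

lemma transc_of_mem {R Ω : Type*} [CommRing R] [Field Ω] [Algebra R Ω] (F : Subfield Ω)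
    (hinj : Function.Injective (algebraMap R Ω)) (h : ∀ r, algebraMap R Ω r ∈ F) {y : Ω}
    (hy : Transcendental F y) : Transcendental R y := fun h' => hy (isAlg_of_ring F hinj h h')

lemma WD.finite {C : Type*} [Field C] {E : Subfield C} {t : C} {e : ℕ} (h : WD E ⊤ t e) :
    Module.Finite (cvgM E t) C := by
  obtain ⟨-, b, hb⟩ := h
  have hb' : Submodule.span (cvgM E t) (Set.range b) = ⊤ := by
    apply SetLike.coe_injective
    rw [← hb]; rfl
  exact ⟨⟨(Set.finite_range b).toFinset, by simpa using hb'⟩⟩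

/-- residue field is algebraic over `K` -/
lemma residue_alg {K C : Type*} [Field K] [Field C] [Algebra K C] (s : C)
    (hC : ∀ y : C, IsAlgebraic (genF K {s}) y) (B : ValuationSubring C) [Algebra K B]
    [IsScalarTower K B C] (σ : C) (h0 : σ ≠ 0) (hσ : σ ∈ B.nonunits) :
    Algebra.IsAlgebraic K (IsLocalRing.ResidueField B) := by
  refine ⟨fun z => ?_⟩
  by_contra hz
  obtain ⟨z, rfl⟩ := IsLocalRing.residue_surjective z
  have h1 : AlgebraicIndependent K (fun _ : Unit => IsLocalRing.residue B z) :=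
    algebraicIndependent_unique_type_iff.2 hz
  have h2 := abhyankar B σ h0 hσ (fun _ => z) h1
  have h3 := (ai_card_le h2 (fun _ : Unit => s) (by rw [Set.range_const]; exact hC)).2
  simp [Nat.card_eq_fintype_card] at h3

theorem specialize1.{x, u', v'} {k : Type u'} {K : Type v'} {C : Type x} [Field k] [Field K] [Field C]
    [Algebra k K] [Algebra K C] [Algebra k C] [IsScalarTower k K C] [Algebra.EssFiniteType k K]
    (s : C) (hs : Transcendental K s) (hC : ∀ y : C, IsAlgebraic (genF K {s}) y) (E : Subfield C)
    (hkE : ∀ a : k, algebraMap k C a ∈ E) (hsE : s ∈ E) (t : C) (e : ℕ) (hWD : WD E ⊤ t e) :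
    WDiag.{x} k K e := by
  classical
  obtain ⟨G, hG⟩ := IntermediateField.fg_top k K
  have hMfin := hWD.finite
  choose ZG hZG using fun x : K => alg_support E t (algebraMap K C x)
    (Algebra.IsAlgebraic.isAlgebraic _)
  obtain ⟨B, π, hπ, hKB, hsB, hZB, hσ⟩ := exists_place (k := k) s hs (isAlg_adjoin_iff'.2 hC)
    (insert t (G.biUnion ZG))
  have ht : t ∈ B := hZB (by simp)
  have hZB' : ∀ x ∈ G, (ZG x : Set C) ⊆ B := by
    intro x hx z hz
    refine hZB ?_
    simp only [Finset.coe_insert, Finset.coe_biUnion, Set.mem_insert_iff, Set.mem_iUnion]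
    exact Or.inr ⟨x, hx, hz⟩
  have hkK : Function.Injective (algebraMap k K) := (algebraMap k K).injective
  have h0 : aeval s π ≠ 0 := fun h =>
    (hs.restrictScalars hkK : Transcendental k s) ⟨π, hπ, h⟩
  letI algKB : Algebra K B := ((algebraMap K C).codRestrict B.toSubring hKB).toAlgebra
  haveI : IsScalarTower K B C := IsScalarTower.of_algebraMap_eq fun _ => rfl
  letI algkB : Algebra k B := ((algebraMap K B).comp (algebraMap k K)).toAlgebra
  haveI : IsScalarTower k K B := IsScalarTower.of_algebraMap_eq fun _ => rfl
  haveI : IsScalarTower k B C := IsScalarTower.of_algebraMap_eq fun a =>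
    IsScalarTower.algebraMap_apply k K C a
  have hκ : Algebra.IsAlgebraic K (IsLocalRing.ResidueField B) := residue_alg s hC B _ h0 hσ
  haveI : IsScalarTower k K (IsLocalRing.ResidueField B) := IsScalarTower.of_algebraMap_eq fun _ => rfl
  have hkE1 : ∀ a : k, algebraMap K (IsLocalRing.ResidueField B) (algebraMap k K a) ∈ resField B E := by
    intro a
    refine ⟨algebraMap k B a, ?_, rfl⟩
    have : ((algebraMap k B a : B) : C) = algebraMap k C a :=
      (IsScalarTower.algebraMap_apply k B C a).symm
    rw [this]
    exact hkE a
  refine ⟨IsLocalRing.ResidueField B, inferInstance, inferInstance, hκ, resField B E,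
    IsLocalRing.residue B ⟨t, ht⟩, hkE1, residue_span B E t ht ?_ hWD⟩
  -- transcendence
  intro htalg
  let F : Subfield (IsLocalRing.ResidueField B) :=
    (algebraicClosure (resField B E) (IsLocalRing.ResidueField B)).toSubfield
  have hF : ∀ x, x ∈ F ↔ IsAlgebraic (resField B E) x := fun x => mem_algebraicClosure_iff
  have hF1 : resField B E ≤ F := fun x hx => (hF x).2 (isAlg_of_mem _ hx)
  have hKF : ∀ x : K, algebraMap K (IsLocalRing.ResidueField B) x ∈ F := by
    let I : IntermediateField k K :=
      { F.comap (algebraMap K (IsLocalRing.ResidueField B)) with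
        algebraMap_mem' := fun a => hF1 (hkE1 a) }
    have hI : I = ⊤ := by
      rw [eq_top_iff, ← hG, IntermediateField.adjoin_le_iff]
      intro x hx
      obtain ⟨h1, h2⟩ := hZG x B (hZB' x hx) ht
      have h3 := h2 F hF1 ((hF _).2 htalg)
      have h4 := isAlg_trans (F := resField B E) (fun y hy => (hF y).1 hy) h3
      exact (hF _).2 h4
    intro x
    have : x ∈ I := by rw [hI]; trivial
    exact this
  have hall : ∀ y : IsLocalRing.ResidueField B, IsAlgebraic (resField B E) y := by
    intro y
    refine isAlg_trans (F' := F) (fun y hy => (hF y).1 hy) ?_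
    exact isAlg_of_ring F (algebraMap K _).injective hKF (hκ.isAlgebraic y)
  have hall' : Algebra.IsAlgebraic (Algebra.adjoin k (resField B E : Set (IsLocalRing.ResidueField B)))
      (IsLocalRing.ResidueField B) :=
    isAlg_adjoin_iff'.2 fun y => isAlg_mono subset_genF (hall y)
  obtain ⟨S, hSE, hS⟩ := exists_isTranscendenceBasis_subset (R := k)
    (resField B E : Set (IsLocalRing.ResidueField B))
  have hS' := isTranscendenceBasis_iff_algebraicIndependent_isAlgebraic.1 hS
  choose z hzE hz using fun i : S => hSE i.2
  have hz' : (fun i : S => IsLocalRing.residue B (z i)) = Subtype.val := funext hz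
  have hab := abhyankar (F := k) B _ h0 hσ z (by rw [hz']; exact hS'.1)
  have hmemE : ∀ o : Option S, o.elim (aeval s π) (fun i => (z i : C)) ∈ E := by
    rintro (_ | i)
    · simp only [Option.elim]
      rw [aeval_eq_sum_range]
      refine sum_mem fun n _ => ?_
      rw [Algebra.smul_def]
      exact mul_mem (hkE _) (pow_mem hsE _)
    · exact hzE i
  have hab2 : AlgebraicIndependent k (fun o : Option (Option S) => o.elim t
      (fun o => o.elim (aeval s π) (fun i => (z i : C)))) := by
    refine AlgebraicIndependent.option_iff.2 ⟨hab, ?_⟩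
    refine transc_of_mem E Subtype.val_injective (fun r => ?_) hWD.1
    have h5 := IntermediateField.algebra_adjoin_le_adjoin k _ r.2
    exact genF_le hkE (Set.range_subset_iff.2 hmemE) h5
  obtain ⟨n, x, hx, hxalg⟩ := exists_fin_trbasis k K
  -- upper bound
  have hup := ai_card_le hab2 (fun o : Option (Fin n) => o.elim s (fun i => algebraMap K C (x i))) ?_
  · obtain ⟨hfin, hup⟩ := hup
    haveI : Finite S := Finite.of_injective (fun i : S => some (some i)) (fun a b h => by simpa using h)
    have hxκ : AlgebraicIndependent k (fun i => algebraMap K (IsLocalRing.ResidueField B) (x i)) :=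
      hx.map' (f := IsScalarTower.toAlgHom k K (IsLocalRing.ResidueField B)) (algebraMap K _).injective
    have hlow := (ai_card_le hxκ (Subtype.val : S → _) (isAlg_adjoin_iff'.1 hS'.2)).2
    have hlow : n ≤ Nat.card S := by simpa using hlow
    simp only [Finite.card_option, Nat.card_fin] at hup
    have hup : Nat.card S + 1 + 1 ≤ n + 1 := hup
    omega
  · intro y
    refine isAlg_trans (F' := genF K {s}) ?_ (hC y)
    intro w hw
    refine isAlg_closure ?_ hw
    rintro _ (⟨a, rfl⟩ | rfl)
    · have h6 := (hxalg a).algebraMap (A := C)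
      refine isAlg_of_ring _ ?_ ?_ h6
      · exact (algebraMap (genF k (Set.range x)) C).injective
      · rintro ⟨r, hr⟩
        have h7 : genF k (Set.range x) ≤ (genF k (Set.range (fun o : Option (Fin n) =>
            o.elim s (fun i => algebraMap K C (x i))))).comap (algebraMap K C) := by
          refine genF_le ?_ ?_
          · intro a
            rw [Subfield.mem_comap]
            rw [← IsScalarTower.algebraMap_apply]
            exact map_mem_genF a
          · rintro _ ⟨i, rfl⟩
            exact subset_genF ⟨some i, rfl⟩
        exact h7 hr
    · exact isAlg_of_mem _ (subset_genF ⟨none, rfl⟩)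

end CvgAux


section CvgAux
set_option autoImplicit false
set_option linter.style.haveILetI false
open Polynomial

theorem specialize1'.{x, u', v'} {k : Type u'} {K : Type v'} {C : Type x} [Field k] [Field K] [Field C]
    [Algebra k K] [Algebra K C] [Algebra.EssFiniteType k K]
    (s : C) (hs : Transcendental K s) (hC : ∀ y : C, IsAlgebraic (genF K {s}) y) (E : Subfield C)
    (hkE : ∀ a : k, algebraMap K C (algebraMap k K a) ∈ E) (hsE : s ∈ E) (t : C) (e : ℕ)
    (hWD : WD E ⊤ t e) : WDiag.{x} k K e := by
  letI : Algebra k C := ((algebraMap K C).comp (algebraMap k K)).toAlgebra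
  haveI : IsScalarTower k K C := IsScalarTower.of_algebraMap_eq fun _ => rfl
  exact specialize1 s hs hC E hkE hsE t e hWD

lemma genF_map {k A Ω : Type*} [Field k] [Field A] [Field Ω] [Algebra k A] [Algebra k Ω]
    (φ : A →ₐ[k] Ω) (S : Set A) : (genF k S).map φ.toRingHom = genF k (φ '' S) := by
  unfold genF
  rw [RingHom.map_field_closure, Set.image_union, ← Set.range_comp]
  congr 3
  ext a
  simp

lemma isAlg_genF_empty {K C : Type*} [Field K] [Field C] [Algebra K C] {y : C}
    (h : IsAlgebraic (genF K (∅ : Set C)) y) : IsAlgebraic K y := by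
  rw [← isAlg_adjoin_iff, Algebra.adjoin_empty] at h
  have h1 : IsAlgebraic K y := by
    refine IsAlgebraic.of_ringHom_of_comp_eq (S := (⊥ : Subalgebra K C)) (B := C)
      (algebraMap K (⊥ : Subalgebra K C)) (RingHom.id C) h ?_ Function.injective_id rfl
    rintro ⟨r, hr⟩
    obtain ⟨a, rfl⟩ := Algebra.mem_bot.1 hr
    exact ⟨a, rfl⟩
  exact h1

theorem specialize_fin.{x, u', v'} {k : Type u'} {K : Type v'} [Field k] [Field K]
    [Algebra k K] [Algebra.EssFiniteType k K] (e m : ℕ) :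
    ∀ (C : Type x) [Field C] [Algebra K C] (S : Fin m → C), AlgebraicIndependent K S →
      (∀ y : C, IsAlgebraic (genF K (Set.range S)) y) → ∀ (E : Subfield C) (t : C),
      (∀ a : k, algebraMap K C (algebraMap k K a) ∈ E) → (∀ i, S i ∈ E) → WD E ⊤ t e →
      WDiag.{x} k K e := by
  induction m with
  | zero =>
    intro C _ _ S hS hC E t hkE hSE hWD
    refine ⟨C, inferInstance, inferInstance, ⟨fun y => ?_⟩, E, t, hkE, hWD⟩
    have := hC y
    rw [Set.range_eq_empty] at this
    exact isAlg_genF_empty this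
  | succ m ih =>
    intro C _ _ S hS hC E t hkE hSE hWD
    letI : Algebra k C := ((algebraMap K C).comp (algebraMap k K)).toAlgebra
    haveI : IsScalarTower k K C := IsScalarTower.of_algebraMap_eq fun _ => rfl
    let S' : Fin m → C := fun i => S i.castSucc
    let s : C := S (Fin.last m)
    have hopt : AlgebraicIndependent K (fun o : Option (Fin m) => o.elim s S') := by
      have h1 := hS.comp (finSuccEquivLast (n := m)).symm (Equiv.injective _)
      convert h1 using 1
      funext o
      cases o <;> simp [s, S']
    obtain ⟨hS', hs⟩ := AlgebraicIndependent.option_iff.1 hopt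
    let K1 : IntermediateField K C := IntermediateField.adjoin K (Set.range S')
    have hs1 : Transcendental K1 s := fun h => hs (isAlg_adjoin_iff.2 h)
    let S1' : Fin m → K1 := fun i => ⟨S' i, IntermediateField.subset_adjoin K _ ⟨i, rfl⟩⟩
    have hC1 : ∀ y : C, IsAlgebraic (genF K1 {s}) y := by
      intro y
      refine isAlg_mono (genF_le ?_ ?_) (hC y)
      · intro a
        exact map_mem_genF (algebraMap K K1 a)
      · rintro _ ⟨i, rfl⟩
        refine Fin.lastCases ?_ (fun i => ?_) i
        · exact subset_genF rfl
        · exact map_mem_genF (S1' i)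
    let k1 : IntermediateField k K1 := IntermediateField.adjoin k (Set.range S1')
    have hk1E : ∀ a : k1, algebraMap K1 C (algebraMap k1 K1 a) ∈ E := by
      have h2 : genF k (Set.range S1') ≤ E.comap (algebraMap K1 C) := by
        refine genF_le ?_ ?_
        · intro a
          exact hkE a
        · rintro _ ⟨i, rfl⟩
          exact hSE _
      intro a
      exact h2 a.2
    haveI hess1 : Algebra.EssFiniteType K K1 :=
      IntermediateField.essFiniteType_iff.2 (IntermediateField.fg_adjoin_of_finite (Set.finite_range S'))
    haveI hess2 : Algebra.EssFiniteType k K1 := Algebra.EssFiniteType.comp k K K1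
    haveI hess : Algebra.EssFiniteType k1 K1 := Algebra.EssFiniteType.of_comp k k1 K1
    obtain ⟨C1, _, _, hC1alg, E1, t1, hk1E1, hWD1⟩ :=
      specialize1'.{x} (k := k1) (K := K1) s hs1 hC1 E hk1E (hSE _) t e hWD
    letI : Algebra K C1 := ((algebraMap K1 C1).comp (algebraMap K K1)).toAlgebra
    haveI : IsScalarTower K K1 C1 := IsScalarTower.of_algebraMap_eq fun _ => rfl
    refine ih C1 (fun i => algebraMap K1 C1 (S1' i)) ?_ ?_ E1 t1 ?_ ?_ hWD1
    · have h3 : AlgebraicIndependent K S1' := AlgebraicIndependent.of_comp K1.val hS'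
      exact h3.map' (f := IsScalarTower.toAlgHom K K1 C1) (algebraMap K1 C1).injective
    · intro y
      refine isAlg_of_ring _ (algebraMap K1 C1).injective ?_ (hC1alg.isAlgebraic y)
      have h4 : genF K (Set.range S') ≤ ((genF K (Set.range fun i => algebraMap K1 C1 (S1' i))).comap
          (algebraMap K1 C1)).map (algebraMap K1 C) := by
        refine genF_le ?_ ?_
        · intro a
          exact ⟨algebraMap K K1 a, map_mem_genF (k := K) a, rfl⟩
        · rintro _ ⟨i, rfl⟩
          exact ⟨S1' i, subset_genF (k := K) ⟨i, rfl⟩, rfl⟩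
      rintro ⟨r, hr⟩
      obtain ⟨r', hr', hrr⟩ := h4 hr
      have : (⟨r, hr⟩ : K1) = r' := Subtype.ext hrr.symm
      rw [this]
      exact hr'
    · intro a
      exact hk1E1 ⟨algebraMap k K1 a, k1.algebraMap_mem a⟩
    · intro i
      exact hk1E1 ⟨S1' i, IntermediateField.subset_adjoin k _ ⟨i, rfl⟩⟩

end CvgAux


section CvgAux
set_option autoImplicit false
set_option linter.style.haveILetI false
open Polynomial
attribute [local instance] MvPolynomial.algebraMvPolynomial

lemma flat_of_injective {R B : Type*} [CommRing R] [IsDomain R] [Field B] [Algebra R B]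
    (h : Function.Injective (algebraMap R B)) : Module.Flat R B := by
  letI : Algebra (FractionRing R) B := (IsFractionRing.lift (K := FractionRing R) h).toAlgebra
  haveI : IsScalarTower R (FractionRing R) B := IsScalarTower.of_algebraMap_eq fun r =>
    (IsFractionRing.lift_algebraMap h r).symm
  haveI : Module.Flat R (FractionRing R) := IsLocalization.flat _ (nonZeroDivisors R)
  exact Module.Flat.trans R (FractionRing R) B

lemma tensor_regular {k A B ι : Type*} [Field k] [Field A] [Field B] [Algebra k A] [Algebra k B]
    (y : ι → B) (hy : AlgebraicIndependent k y) (f : MvPolynomial ι A) (hf : f ≠ 0) :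
    MvPolynomial.aeval (fun i => (1 : A) ⊗ₜ[k] y i) f ∈ nonZeroDivisors (A ⊗[k] B) := by
  letI : Algebra (MvPolynomial ι k) B := (MvPolynomial.aeval y).toAlgebra
  haveI : IsScalarTower k (MvPolynomial ι k) B := IsScalarTower.of_algebraMap_eq fun r =>
    ((MvPolynomial.aeval y).commutes r).symm
  have hinj : Function.Injective (algebraMap (MvPolynomial ι k) B) := hy
  haveI := flat_of_injective hinj
  let φ := Algebra.IsPushout.cancelBaseChangeAlg k A (MvPolynomial ι k) (MvPolynomial ι A) B
  have hX : ∀ b : B, φ (1 ⊗ₜ b) = 1 ⊗ₜ b := by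
    intro b
    exact Algebra.IsPushout.cancelBaseChange_tmul k A (MvPolynomial ι k) (MvPolynomial ι A) B b
  have hφ : ∀ g : MvPolynomial ι A,
      φ (g ⊗ₜ[MvPolynomial ι k] 1) = MvPolynomial.aeval (fun i => (1 : A) ⊗ₜ[k] y i) g := by
    intro g
    let ψ : MvPolynomial ι A →ₐ[A] A ⊗[k] B := φ.toAlgHom.comp
      ((Algebra.TensorProduct.includeLeft : MvPolynomial ι A →ₐ[MvPolynomial ι A]
        MvPolynomial ι A ⊗[MvPolynomial ι k] B).restrictScalars A)
    have : ψ = MvPolynomial.aeval (fun i => (1 : A) ⊗ₜ[k] y i) := by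
      ext i
      rw [MvPolynomial.aeval_X, ← hX]
      change φ (MvPolynomial.X i ⊗ₜ 1) = _
      congr 1
      have h1 : (MvPolynomial.X i : MvPolynomial ι A) = (MvPolynomial.X i : MvPolynomial ι k) • 1 := by
        rw [Algebra.smul_def, mul_one]; simp
      have h2 : y i = (MvPolynomial.X i : MvPolynomial ι k) • (1 : B) := by
        rw [Algebra.smul_def, mul_one]
        exact (MvPolynomial.aeval_X y i).symm
      rw [h1, TensorProduct.smul_tmul, ← h2]
    exact DFunLike.congr_fun this g
  rw [← hφ]
  haveI hfl : Module.Flat (MvPolynomial ι A) (MvPolynomial ι A ⊗[MvPolynomial ι k] B) :=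
    Module.Flat.baseChange ..
  have hreg := Module.Flat.isSMulRegular_of_nonZeroDivisors (R := MvPolynomial ι A)
    (M := MvPolynomial ι A ⊗[MvPolynomial ι k] B) (mem_nonZeroDivisors_of_ne_zero hf)
  rw [mem_nonZeroDivisors_iff_right]
  intro z hz
  obtain ⟨w, rfl⟩ := φ.surjective z
  rw [← map_mul, EmbeddingLike.map_eq_zero_iff, mul_comm] at hz
  have h3 : f • w = 0 := by
    rw [Algebra.smul_def]; exact hz
  rw [hreg (h3.trans (smul_zero f).symm), map_zero]

lemma tensor_ai {k A B ι : Type*} [Field k] [Field A] [Field B] [Algebra k A] [Algebra k B]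
    (y : ι → B) (hy : AlgebraicIndependent k y) (p : Ideal (A ⊗[k] B))
    (hp : p ∈ minimalPrimes (A ⊗[k] B)) (f : MvPolynomial ι A)
    (hf : MvPolynomial.aeval (fun i => (1 : A) ⊗ₜ[k] y i) f ∈ p) : f = 0 := by
  by_contra h
  exact (Ideal.disjoint_nonZeroDivisors_of_mem_minimalPrimes hp).le_bot ⟨hf, tensor_regular y hy f h⟩

end CvgAux


section CvgAux
set_option autoImplicit false
set_option linter.style.haveILetI false
open Polynomial

lemma isAlg_map {Ω Ω' : Type*} [Field Ω] [Field Ω'] (φ : Ω →+* Ω') {E : Subfield Ω} {t : Ω}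
    (h : IsAlgebraic E t) : IsAlgebraic (E.map φ) (φ t) := by
  by_contra h'
  exact (transc_map φ E t).1 h' h

theorem claim1.{x, u', v', w', z'} {k : Type u'} {K : Type v'} {L : Type w'} {K' : Type z'}
    [Field k] [Field K] [Field L] [Field K'] [Algebra k K] [Algebra k L] [Algebra k K']
    [Algebra K K'] [Algebra L K'] [IsScalarTower k K K'] [IsScalarTower k L K']
    [Algebra.EssFiniteType k K]
    (hgen : ∀ x : K', x ∈ Subfield.closure
      (Set.range (algebraMap K K') ∪ Set.range (algebraMap L K')))
    (hF : ∀ (n : ℕ) (x : Fin n → K), AlgebraicIndependent k x →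
      AlgebraicIndependent L (fun i => algebraMap K K' (x i)))
    (e : ℕ) (h : WDiag.{x} k K e) : WDiag.{z'} L K' e := by
  obtain ⟨C, _, _, hCalg, E, t, hkE, hWD⟩ := h
  letI : Algebra k C := ((algebraMap K C).comp (algebraMap k K)).toAlgebra
  haveI : IsScalarTower k K C := IsScalarTower.of_algebraMap_eq fun _ => rfl
  let Ω := AlgebraicClosure K'
  let j : C →ₐ[K] Ω := IsAlgClosed.lift
  let jr : C →+* Ω := j.toRingHom
  have hjK : ∀ a : K, jr (algebraMap K C a) = algebraMap K' Ω (algebraMap K K' a) := fun a =>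
    (j.commutes a).trans (IsScalarTower.algebraMap_apply K K' Ω a)
  have hk : ∀ a : k, jr (algebraMap K C (algebraMap k K a)) = algebraMap L Ω (algebraMap k L a) := by
    intro a
    rw [hjK, ← IsScalarTower.algebraMap_apply k K K', IsScalarTower.algebraMap_apply k L K',
      ← IsScalarTower.algebraMap_apply L K' Ω]
  let E' : Subfield Ω := genF L (jr '' (E : Set C))
  let t' : Ω := jr t
  have hEE' : E.map jr ≤ E' := by
    rintro _ ⟨a, ha, rfl⟩
    exact subset_genF ⟨a, ha, rfl⟩
  have hMM : (cvgM E t).map jr ≤ cvgM E' t' := by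
    rw [← cvgM_map]; exact cvgM_mono hEE'
  have hKΩ : ∀ F : Subfield Ω, (∀ c, jr c ∈ F) → (∀ a : L, algebraMap L Ω a ∈ F) →
      ∀ a, algebraMap K' Ω a ∈ F := by
    intro F h1 h2 a
    have : Subfield.closure (Set.range (algebraMap K K') ∪ Set.range (algebraMap L K')) ≤
        F.comap (algebraMap K' Ω) := by
      rw [Subfield.closure_le]
      rintro _ (⟨a, rfl⟩ | ⟨a, rfl⟩)
      · change algebraMap K' Ω _ ∈ F
        rw [← hjK]; exact h1 _
      · change algebraMap K' Ω _ ∈ F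
        rw [← IsScalarTower.algebraMap_apply L K' Ω]; exact h2 _
    exact this (hgen a)
  -- transcendence
  have htr : Transcendental E' t' := by
    intro halg
    obtain ⟨n, x, hx, hxK⟩ := exists_fin_trbasis k K
    let Ei : IntermediateField k C := E.toIntermediateField hkE
    obtain ⟨s, hs⟩ := exists_isTranscendenceBasis k Ei
    have hs' := isTranscendenceBasis_iff_algebraicIndependent_isAlgebraic.1 hs
    let y : s → C := fun i => ((i : Ei) : C)
    have hy : AlgebraicIndependent k y :=
      hs'.1.map' (f := Ei.val) Ei.val.toRingHom.injective
    have hyt : AlgebraicIndependent k (fun o : Option s => o.elim t y) := by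
      rw [AlgebraicIndependent.option_iff]
      refine ⟨hy, transc_of_mem E Subtype.val_injective ?_ hWD.1⟩
      rintro ⟨r, hr⟩
      have : Algebra.adjoin k (Set.range y) ≤ Ei.toSubalgebra := by
        rw [Algebra.adjoin_le_iff]
        rintro _ ⟨i, rfl⟩
        exact (i : Ei).2
      exact this hr
    have hCx : ∀ a : C, IsAlgebraic (genF k (Set.range (fun i => algebraMap K C (x i)))) a := by
      intro a
      have h1 : IsAlgebraic (algebraMap K C).fieldRange a :=
        isAlg_of_ring _ (algebraMap K C).injective (fun r => RingHom.mem_fieldRange.2 ⟨r, rfl⟩) (hCalg.isAlgebraic a)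
      refine isAlg_trans ?_ h1
      rintro _ ⟨b, rfl⟩
      have h2 := isAlg_map (algebraMap K C) (hxK b)
      refine isAlg_mono ?_ h2
      rw [show algebraMap K C = (IsScalarTower.toAlgHom k K C).toRingHom from rfl, genF_map]
      refine genF_le (fun a => map_mem_genF a) ?_
      rintro _ ⟨_, ⟨i, rfl⟩, rfl⟩
      exact subset_genF ⟨i, rfl⟩
    obtain ⟨hfin, hcard⟩ := ai_card_le hyt _ hCx
    haveI : Finite s := Finite.of_injective (some : s → Option s) (Option.some_injective _)
    let F : Subfield Ω := genF L (Set.range fun i => jr (y i))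
    have hjE : ∀ a ∈ E, IsAlgebraic F (jr a) := by
      intro a ha
      have h1 : IsAlgebraic (genF k (Set.range ((↑) : s → Ei))) (⟨a, ha⟩ : Ei) :=
        isAlg_adjoin_iff'.1 hs'.2 _
      have h2 := isAlg_map (jr.comp Ei.val.toRingHom) h1
      refine isAlg_mono ?_ h2
      rw [Subfield.map_le_iff_le_comap]
      refine genF_le ?_ ?_
      · intro c
        change jr (algebraMap K C (algebraMap k K c)) ∈ F
        rw [hk]; exact map_mem_genF _
      · rintro _ ⟨i, rfl⟩
        exact subset_genF ⟨i, rfl⟩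
    have hE'F : ∀ a ∈ E', IsAlgebraic F a := by
      intro a ha
      refine isAlg_closure ?_ ha
      rintro _ (⟨c, rfl⟩ | ⟨c, hc, rfl⟩)
      · exact isAlg_of_mem _ (map_mem_genF c)
      · exact hjE c hc
    have hM'F : ∀ a ∈ cvgM E' t', IsAlgebraic F a := by
      intro a ha
      have : cvgM E' t' ≤ (algebraicClosure F Ω).toSubfield :=
        cvgM_le (fun a ha => mem_algebraicClosure_iff.2 (hE'F a ha))
          (mem_algebraicClosure_iff.2 (isAlg_trans hE'F halg))
      exact mem_algebraicClosure_iff.1 (this ha)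
    have hCF : ∀ c, IsAlgebraic F (jr c) := by
      intro c
      haveI := hWD.finite
      have h1 : IsAlgebraic (cvgM E t) c := Algebra.IsAlgebraic.isAlgebraic c
      exact isAlg_trans hM'F (isAlg_mono hMM (isAlg_map jr h1))
    have hall : ∀ a : Ω, IsAlgebraic F a := by
      intro a
      have h1 : IsAlgebraic (algebraMap K' Ω).fieldRange a :=
        isAlg_of_ring _ (algebraMap K' Ω).injective (fun r => RingHom.mem_fieldRange.2 ⟨r, rfl⟩)
          (Algebra.IsAlgebraic.isAlgebraic a)
      refine isAlg_trans ?_ h1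
      rintro _ ⟨b, rfl⟩
      exact mem_algebraicClosure_iff.1 (hKΩ (algebraicClosure F Ω).toSubfield
        (fun c => mem_algebraicClosure_iff.2 (hCF c))
        (fun a => mem_algebraicClosure_iff.2 (isAlg_of_mem F (map_mem_genF a))) b)
    have hx' : AlgebraicIndependent L (fun i => algebraMap K' Ω (algebraMap K K' (x i))) :=
      (hF n x hx).map' (f := IsScalarTower.toAlgHom L K' Ω) (algebraMap K' Ω).injective
    have hc2 := (ai_card_le hx' _ hall).2
    simp only [Nat.card_eq_fintype_card, Fintype.card_fin] at hc2 hcard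
    haveI := Fintype.ofFinite s
    rw [Nat.card_eq_fintype_card, Fintype.card_option] at hcard
    rw [Nat.card_eq_fintype_card] at hc2
    omega
  obtain ⟨-, b, hb⟩ := hWD
  have hsp : ∀ c : C, jr c ∈ Submodule.span (cvgM E' t') (Set.range fun i => jr (b i)) := by
    intro c
    have : c ∈ Submodule.span (cvgM E t) (Set.range b) := by
      rw [← SetLike.mem_coe, ← hb]; trivial
    rw [mem_span_sub] at this ⊢
    obtain ⟨a, ha, rfl⟩ := this
    exact ⟨fun i => jr (a i), fun i => hMM ⟨_, ha i, rfl⟩, by simp⟩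
  obtain ⟨C', hC', hMC'⟩ := span_field (cvgM E' t') (fun i => jr (b i))
    (by simpa using hsp 1) (fun i j => by simpa using hsp (b i * b j))
  have hjC' : ∀ c, jr c ∈ C' := by
    intro c
    rw [← SetLike.mem_coe, hC']; exact hsp c
  have hWD' : WD E' C' t' e := ⟨htr, _, hC'⟩
  have hK'C' : ∀ a, algebraMap K' Ω a ∈ C' := hKΩ C' hjC' fun a =>
    hMC' (cvgM_le_left _ _ (map_mem_genF a))
  letI : Algebra K' C' := ((algebraMap K' Ω).codRestrict C' hK'C').toAlgebra
  haveI : IsScalarTower K' C' Ω := IsScalarTower.of_algebraMap_eq fun _ => rfl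
  refine ⟨C', inferInstance, inferInstance, ?_, _, _, ?_, hWD'.restrict⟩
  · exact Algebra.IsAlgebraic.tower_bot K' C' Ω
  · intro a
    change algebraMap K' Ω (algebraMap L K' a) ∈ E'
    rw [← IsScalarTower.algebraMap_apply L K' Ω]
    exact map_mem_genF a

end CvgAux


section CvgAux
set_option autoImplicit false
set_option linter.style.haveILetI false
open Polynomial

lemma isAlg_of_map {Ω Ω' : Type*} [Field Ω] [Field Ω'] (φ : Ω →+* Ω') {E : Subfield Ω} {t : Ω}
    (h : IsAlgebraic (E.map φ) (φ t)) : IsAlgebraic E t := by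
  by_contra h'
  exact (transc_map φ E t).2 h' h

/-- Algebraicity is witnessed by finitely many generators. -/
lemma alg_genF_support {K C ι : Type*} [Field K] [Field C] [Algebra K C] (σ : ι → C) (y : C)
    (h : IsAlgebraic (genF K (Set.range σ)) y) :
    ∃ T : Finset ι, IsAlgebraic (genF K (σ '' T)) y := by
  classical
  rw [← isAlg_adjoin_iff] at h
  obtain ⟨p, hp, hp0⟩ := h
  have hmem : ∀ a ∈ Algebra.adjoin K (Set.range σ), ∃ T : Finset ι, a ∈ Algebra.adjoin K (σ '' T) := by
    intro a ha
    have mono : ∀ {T T' : Finset ι}, T ⊆ T' →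
        Algebra.adjoin K (σ '' T) ≤ Algebra.adjoin K (σ '' T') := fun h =>
      Algebra.adjoin_mono (Set.image_mono (by exact_mod_cast h))
    induction ha using Algebra.adjoin_induction with
    | mem x hx =>
      obtain ⟨i, rfl⟩ := hx
      exact ⟨{i}, Algebra.subset_adjoin ⟨i, by simp, rfl⟩⟩
    | algebraMap r => exact ⟨∅, Subalgebra.algebraMap_mem _ r⟩
    | add x y _ _ hx hy =>
      obtain ⟨T, hT⟩ := hx
      obtain ⟨T', hT'⟩ := hy
      exact ⟨T ∪ T', add_mem (mono Finset.subset_union_left hT) (mono Finset.subset_union_right hT')⟩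
    | mul x y _ _ hx hy =>
      obtain ⟨T, hT⟩ := hx
      obtain ⟨T', hT'⟩ := hy
      exact ⟨T ∪ T', mul_mem (mono Finset.subset_union_left hT) (mono Finset.subset_union_right hT')⟩
  choose! T hT using hmem
  let T0 : Finset ι := p.support.biUnion fun i => T (p.coeff i)
  refine ⟨T0, ?_⟩
  rw [← isAlg_adjoin_iff]
  have hlift : p.map (Algebra.adjoin K (Set.range σ)).val.toRingHom ∈
      Polynomial.lifts (algebraMap (Algebra.adjoin K (σ '' T0)) C) := by
    rw [Polynomial.lifts_iff_coeff_lifts]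
    intro n
    rw [Polynomial.coeff_map]
    by_cases hn : n ∈ p.support
    · have h1 := hT _ (p.coeff n).2
      have h2 : Algebra.adjoin K (σ '' (T (p.coeff n) : Finset ι)) ≤ Algebra.adjoin K (σ '' T0) := by
        apply Algebra.adjoin_mono
        apply Set.image_mono
        exact_mod_cast Finset.subset_biUnion_of_mem (fun i => T (p.coeff i)) hn
      exact ⟨⟨_, h2 h1⟩, rfl⟩
    · rw [Polynomial.notMem_support_iff] at hn
      rw [hn, map_zero]
      exact ⟨0, map_zero _⟩
  obtain ⟨q, hq⟩ := hlift
  have hq' : q.map (algebraMap (Algebra.adjoin K (σ '' T0)) C) =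
     p.map (Algebra.adjoin K (Set.range σ)).val.toRingHom := hq
  refine ⟨q, ?_, ?_⟩
  · rintro rfl
    rw [Polynomial.map_zero] at hq'
    exact hp ((Polynomial.map_eq_zero_iff Subtype.val_injective).1 hq'.symm)
  · rw [Polynomial.aeval_def, ← Polynomial.eval_map, hq', ← hp0, Polynomial.aeval_def,
      ← Polynomial.eval_map]
    rfl

theorem claim2.{x, u', v', w', z'} {k : Type u'} {K : Type v'} {L : Type w'} {K' : Type z'}
    [Field k] [Field K] [Field L] [Field K'] [Algebra k K] [Algebra k L] [Algebra k K']
    [Algebra K K'] [Algebra L K'] [IsScalarTower k K K'] [IsScalarTower k L K']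
    (hK : IsAlgFunctionField k K)
    (hgen : ∀ x : K', x ∈ Subfield.closure
      (Set.range (algebraMap K K') ∪ Set.range (algebraMap L K')))
    (hF : ∀ s : Set L, AlgebraicIndependent k ((↑) : s → L) →
      AlgebraicIndependent K (fun i : s => algebraMap L K' i))
    (e : ℕ) (h : WDiag.{x} L K' e) : WDiag.{x} k K e := by
  classical
  haveI : Algebra.EssFiniteType k K := IntermediateField.fg_top_iff.1 hK
  obtain ⟨C, _, _, hCalg, E, t, hLE, hWD⟩ := h
  letI : Algebra k C := ((algebraMap K' C).comp (algebraMap k K')).toAlgebra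
  haveI : IsScalarTower k K' C := IsScalarTower.of_algebraMap_eq fun _ => rfl
  letI : Algebra K C := ((algebraMap K' C).comp (algebraMap K K')).toAlgebra
  haveI : IsScalarTower K K' C := IsScalarTower.of_algebraMap_eq fun _ => rfl
  letI : Algebra L C := ((algebraMap K' C).comp (algebraMap L K')).toAlgebra
  haveI : IsScalarTower L K' C := IsScalarTower.of_algebraMap_eq fun _ => rfl
  haveI : IsScalarTower k K C := IsScalarTower.of_algebraMap_eq fun a => by
    rw [IsScalarTower.algebraMap_apply k K' C, IsScalarTower.algebraMap_apply k K K',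
      ← IsScalarTower.algebraMap_apply K K' C]
  haveI : IsScalarTower k L C := IsScalarTower.of_algebraMap_eq fun a => by
    rw [IsScalarTower.algebraMap_apply k K' C, IsScalarTower.algebraMap_apply k L K',
      ← IsScalarTower.algebraMap_apply L K' C]
  obtain ⟨s, hs⟩ := exists_isTranscendenceBasis k L
  have hs' := isTranscendenceBasis_iff_algebraicIndependent_isAlgebraic.1 hs
  let σ : s → C := fun i => algebraMap L C i
  have hσ : AlgebraicIndependent K σ :=
    (hF s hs'.1).map' (f := IsScalarTower.toAlgHom K K' C) (algebraMap K' C).injective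
  have hLalg : ∀ a : L, IsAlgebraic (genF K (Set.range σ)) (algebraMap L C a) := by
    intro a
    have h1 := isAlg_map (algebraMap L C) (isAlg_adjoin_iff'.1 hs'.2 a)
    refine isAlg_mono ?_ h1
    rw [Subfield.map_le_iff_le_comap]
    refine genF_le ?_ ?_
    · intro c
      change algebraMap L C (algebraMap k L c) ∈ genF K (Set.range σ)
      rw [← IsScalarTower.algebraMap_apply k L C, IsScalarTower.algebraMap_apply k K C]
      exact map_mem_genF _
    · rintro _ ⟨i, rfl⟩
      exact subset_genF ⟨i, rfl⟩
  have hall : ∀ a : C, IsAlgebraic (genF K (Set.range σ)) a := by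
    intro a
    have h1 : IsAlgebraic (algebraMap K' C).fieldRange a :=
      isAlg_of_ring _ (algebraMap K' C).injective (fun r => RingHom.mem_fieldRange.2 ⟨r, rfl⟩)
        (hCalg.isAlgebraic a)
    refine isAlg_trans ?_ h1
    rintro _ ⟨b, rfl⟩
    have : Subfield.closure (Set.range (algebraMap K K') ∪ Set.range (algebraMap L K')) ≤
        (algebraicClosure (genF K (Set.range σ)) C).toSubfield.comap (algebraMap K' C) := by
      rw [Subfield.closure_le]
      rintro _ (⟨a, rfl⟩ | ⟨a, rfl⟩)
      · exact mem_algebraicClosure_iff.2 (isAlg_of_mem _ (map_mem_genF a))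
      · exact mem_algebraicClosure_iff.2 (hLalg a)
    exact mem_algebraicClosure_iff.1 (this (hgen b))
  obtain ⟨G0, hG0⟩ := hK
  obtain ⟨Z, b, hZE, hdesc⟩ := hWD.descent (G0.image (algebraMap K C)) (fun _ _ => trivial)
  choose T hT using fun a : C => alg_genF_support σ a (hall a)
  let W : Finset C := insert t (Z ∪ Finset.univ.image b)
  let T0 : Finset s := W.biUnion T
  have hW : ∀ a ∈ W, IsAlgebraic (genF K (σ '' T0)) a := by
    intro a ha
    refine isAlg_mono (genF_le (fun c => map_mem_genF c) ?_) (hT a)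
    refine Set.Subset.trans (Set.image_mono ?_) subset_genF
    exact_mod_cast Finset.subset_biUnion_of_mem T ha
  let E1 : Subfield C := genF k ((Z : Set C) ∪ σ '' T0)
  have hkE : ∀ a : k, algebraMap k C a ∈ E := by
    intro a
    rw [IsScalarTower.algebraMap_apply k L C]
    exact hLE _
  have hE1E : E1 ≤ E := by
    refine genF_le hkE (Set.union_subset hZE ?_)
    rintro _ ⟨i, -, rfl⟩
    exact hLE _
  obtain ⟨C1, -, hGC1, hWD1, hC1⟩ := hdesc E1 hE1E
    (Set.Subset.trans Set.subset_union_left subset_genF)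
  have hE1C1 : E1 ≤ C1 := (cvgM_le_left E1 t).trans hWD1.le
  have hKC1 : ∀ a : K, algebraMap K C a ∈ C1 := by
    intro a
    have h1 : genF k (G0 : Set K) ≤ C1.comap (algebraMap K C) := by
      refine genF_le ?_ ?_
      · intro c
        change algebraMap K C (algebraMap k K c) ∈ C1
        rw [← IsScalarTower.algebraMap_apply k K C]
        exact hE1C1 (map_mem_genF c)
      · intro g hg
        exact hGC1 (Finset.mem_coe.2 (Finset.mem_image_of_mem _ hg))
    apply h1
    rw [genF_eq, hG0]
    trivial
  have hC1alg : ∀ a ∈ C1, IsAlgebraic (genF K (σ '' T0)) a := by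
    intro a ha
    rw [hC1] at ha
    refine isAlg_closure ?_ ha
    rintro x (rfl | hx | ⟨i, rfl⟩)
    · exact hW _ (by simp [W])
    · refine isAlg_closure ?_ hx
      rintro x (⟨c, rfl⟩ | hx | ⟨i, hi, rfl⟩)
      · rw [IsScalarTower.algebraMap_apply k K C]
        exact isAlg_of_mem _ (map_mem_genF _)
      · refine hW _ ?_
        have : x ∈ Z := hx
        simp [W, this]
      · exact isAlg_of_mem _ (subset_genF ⟨i, hi, rfl⟩)
    · exact hW _ (by simp [W])
  letI : Algebra K C1 := ((algebraMap K C).codRestrict C1 hKC1).toAlgebra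
  let φ : C1 →ₐ[K] C := { C1.subtype with commutes' := fun _ => rfl }
  let S : Fin (Fintype.card T0) → C1 := fun i =>
    ⟨σ ((Fintype.equivFin T0).symm i), hE1C1 (subset_genF (Or.inr ⟨_, Subtype.prop _, rfl⟩))⟩
  have hSr : φ '' Set.range S = σ '' T0 := by
    ext x
    constructor
    · rintro ⟨_, ⟨i, rfl⟩, rfl⟩
      exact ⟨_, Subtype.prop _, rfl⟩
    · rintro ⟨i, hi, rfl⟩
      refine ⟨_, ⟨Fintype.equivFin T0 ⟨i, hi⟩, rfl⟩, ?_⟩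
      change σ ((Fintype.equivFin T0).symm (Fintype.equivFin T0 ⟨i, hi⟩) : T0) = σ i
      rw [Equiv.symm_apply_apply]
  refine specialize_fin e _ C1 S ?_ ?_ (E1.comap C1.subtype) _ ?_ ?_ hWD1.restrict
  · apply AlgebraicIndependent.of_comp φ
    exact hσ.comp (fun i => (((Fintype.equivFin T0).symm i : T0) : s))
      (Subtype.val_injective.comp (Equiv.injective _))
  · intro y
    apply isAlg_of_map φ.toRingHom
    rw [genF_map, hSr]
    exact hC1alg _ y.2
  · intro a
    change algebraMap K C (algebraMap k K a) ∈ E1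
    rw [← IsScalarTower.algebraMap_apply k K C]
    exact map_mem_genF a
  · intro i
    exact subset_genF (k := k) (Or.inr ⟨_, Subtype.prop _, rfl⟩)

end CvgAux

attribute [local instance] Algebra.TensorProduct.rightAlgebra
section CvgAux
set_option autoImplicit false
set_option linter.style.haveILetI false
open Polynomial

section TensorFacts
variable {k K L : Type*} [Field k] [Field K] [Field L] [Algebra k K] [Algebra k L]
  (p : Ideal (K ⊗[k] L)) [p.IsPrime]

lemma tensor_gen (x : FractionRing ((K ⊗[k] L) ⧸ p)) : x ∈ Subfield.closure
      (Set.range (algebraMap K (FractionRing ((K ⊗[k] L) ⧸ p))) ∪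
        Set.range (algebraMap L (FractionRing ((K ⊗[k] L) ⧸ p)))) := by
  have h1 : ∀ z : K ⊗[k] L, algebraMap ((K ⊗[k] L) ⧸ p) (FractionRing ((K ⊗[k] L) ⧸ p))
      (Ideal.Quotient.mk p z) ∈ Subfield.closure
      (Set.range (algebraMap K (FractionRing ((K ⊗[k] L) ⧸ p))) ∪
        Set.range (algebraMap L (FractionRing ((K ⊗[k] L) ⧸ p)))) := by
    intro z
    induction z using TensorProduct.induction_on with
    | zero => rw [map_zero, map_zero]; exact zero_mem _
    | add x y hx hy => rw [map_add, map_add]; exact add_mem hx hy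
    | tmul a b =>
      have : a ⊗ₜ[k] b = (a ⊗ₜ[k] (1 : L)) * ((1 : K) ⊗ₜ[k] b) := by simp
      rw [this, map_mul, map_mul]
      exact mul_mem (Subfield.subset_closure (Or.inl ⟨a, rfl⟩))
        (Subfield.subset_closure (Or.inr ⟨b, rfl⟩))
  obtain ⟨a, b, -, rfl⟩ := IsFractionRing.div_surjective (A := (K ⊗[k] L) ⧸ p) x
  obtain ⟨a, rfl⟩ := Ideal.Quotient.mk_surjective a
  obtain ⟨b, rfl⟩ := Ideal.Quotient.mk_surjective b
  exact div_mem (h1 a) (h1 b)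

lemma tensor_F2 (hp : p ∈ minimalPrimes (K ⊗[k] L)) {ι : Type*} (y : ι → L)
    (hy : AlgebraicIndependent k y) :
    AlgebraicIndependent K (fun i => algebraMap L (FractionRing ((K ⊗[k] L) ⧸ p)) (y i)) := by
  rw [algebraicIndependent_iff]
  intro f hf
  refine tensor_ai y hy p hp f ?_
  rw [← Ideal.Quotient.eq_zero_iff_mem]
  apply IsFractionRing.injective ((K ⊗[k] L) ⧸ p) (FractionRing ((K ⊗[k] L) ⧸ p))
  rw [map_zero, ← hf]
  let ψ : (K ⊗[k] L) →ₐ[K] FractionRing ((K ⊗[k] L) ⧸ p) :=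
    (IsScalarTower.toAlgHom K ((K ⊗[k] L) ⧸ p) _).comp (Ideal.Quotient.mkₐ K p)
  change ψ _ = _
  exact MvPolynomial.comp_aeval_apply _ ψ f

lemma tensor_F1 (hp : p ∈ minimalPrimes (K ⊗[k] L)) {ι : Type*} (y : ι → K)
    (hy : AlgebraicIndependent k y) :
    AlgebraicIndependent L (fun i => algebraMap K (FractionRing ((K ⊗[k] L) ⧸ p)) (y i)) := by
  rw [algebraicIndependent_iff]
  intro f hf
  by_contra hf0
  have hreg := tensor_regular (A := L) y hy f hf0
  let cm : L ⊗[k] K ≃ₐ[k] K ⊗[k] L := Algebra.TensorProduct.comm k L K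
  let z : L ⊗[k] K := MvPolynomial.aeval (fun i => (1 : L) ⊗ₜ[k] y i) f
  have hz : cm z ∈ nonZeroDivisors (K ⊗[k] L) := by
    rw [mem_nonZeroDivisors_iff_right] at hreg ⊢
    intro x hx
    obtain ⟨x, rfl⟩ := cm.surjective x
    rw [← map_mul, EmbeddingLike.map_eq_zero_iff] at hx
    rw [hreg x hx, map_zero]
  refine (Ideal.disjoint_nonZeroDivisors_of_mem_minimalPrimes hp).le_bot ⟨?_, hz⟩
  change cm z ∈ p
  rw [← Ideal.Quotient.eq_zero_iff_mem]
  apply IsFractionRing.injective ((K ⊗[k] L) ⧸ p) (FractionRing ((K ⊗[k] L) ⧸ p))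
  rw [map_zero, ← hf]
  let ψ : (L ⊗[k] K) →+* FractionRing ((K ⊗[k] L) ⧸ p) :=
    ((algebraMap ((K ⊗[k] L) ⧸ p) _).comp (Ideal.Quotient.mk p)).comp cm.toAlgHom.toRingHom
  let ψ' : (L ⊗[k] K) →ₐ[L] FractionRing ((K ⊗[k] L) ⧸ p) :=
    @AlgHom.mk L _ _ _ _ _ Algebra.TensorProduct.leftAlgebra _ ψ (fun a => by
      change ψ (a ⊗ₜ 1) = _
      simp only [ψ, cm]
      rfl)
  change ψ' _ = _
  exact MvPolynomial.comp_aeval_apply _ ψ' f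

end TensorFacts

theorem main_aux (k : Type u) (K : Type v) (L : Type*) [Field k] [Field K] [Field L]
    [Algebra k K] [Algebra k L] (hK : IsAlgFunctionField k K)
    (p : Ideal (K ⊗[k] L)) (hp : p ∈ minimalPrimes (K ⊗[k] L)) [p.IsPrime] :
    cvg L (FractionRing ((K ⊗[k] L) ⧸ p)) = cvg k K := by
  have hgen := tensor_gen p
  haveI : Algebra.EssFiniteType k K := IntermediateField.fg_top_iff.1 hK
  have hK' : IsAlgFunctionField L (FractionRing ((K ⊗[k] L) ⧸ p)) := by
    classical
    obtain ⟨G, hG⟩ := hK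
    refine ⟨G.image (algebraMap K _), ?_⟩
    rw [eq_top_iff]
    intro x _
    have h1 : genF k (G : Set K) ≤ (IntermediateField.adjoin L
        ((G.image (algebraMap K (FractionRing ((K ⊗[k] L) ⧸ p))) : Finset _) :
          Set (FractionRing ((K ⊗[k] L) ⧸ p)))).toSubfield.comap (algebraMap K _) := by
      refine genF_le ?_ ?_
      · intro a
        change algebraMap K _ (algebraMap k K a) ∈ IntermediateField.adjoin L _
        rw [← IsScalarTower.algebraMap_apply k K, IsScalarTower.algebraMap_apply k L]
        exact IntermediateField.algebraMap_mem _ _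
      · intro g hg
        exact IntermediateField.subset_adjoin L _ (Finset.mem_coe.2 (Finset.mem_image_of_mem _ hg))
    refine (Subfield.closure_le (t := (IntermediateField.adjoin L _).toSubfield)).2 ?_ (hgen x)
    rintro _ (⟨a, rfl⟩ | ⟨a, rfl⟩)
    · apply h1
      rw [genF_eq, hG]
      trivial
    · exact IntermediateField.algebraMap_mem _ _
  have hA : ∀ e, 0 < e ∧ HasCvgDiagram k K e →
      ∃ e' ≤ e, 0 < e' ∧ HasCvgDiagram L (FractionRing ((K ⊗[k] L) ⧸ p)) e' := by
    rintro e ⟨he, h⟩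
    exact (claim1 hgen (fun n x hx => tensor_F1 p hp x hx) e (h.wDiag he)).hasCvgDiagram hK'
  have hB : ∀ e, 0 < e ∧ HasCvgDiagram L (FractionRing ((K ⊗[k] L) ⧸ p)) e →
      ∃ e' ≤ e, 0 < e' ∧ HasCvgDiagram k K e' := by
    rintro e ⟨he, h⟩
    exact (claim2 hK hgen (fun s hs => tensor_F2 p hp _ hs) e (h.wDiag he)).hasCvgDiagram hK
  have key : ∀ A B : Set ℕ, (∀ e ∈ A, ∃ e' ≤ e, e' ∈ B) → (∀ e ∈ B, ∃ e' ≤ e, e' ∈ A) →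
      sInf A ≤ sInf B := by
    intro A B h1 h2
    rcases B.eq_empty_or_nonempty with rfl | hB
    · rcases A.eq_empty_or_nonempty with rfl | ⟨a, ha⟩
      · exact le_rfl
      · obtain ⟨_, _, h⟩ := h1 a ha
        exact h.elim
    · obtain ⟨e', he, he'⟩ := h2 _ (Nat.sInf_mem hB)
      exact (Nat.sInf_le he').trans he
  exact le_antisymm (key _ _ hB hA) (key _ _ hA hB)

end CvgAux


/-- If the field of constants of `K/k` is `k` itself and `L/k` is an arbitrary field extension,
then for any minimal prime `p` of `K ⊗_k L`, the fraction field `K'` of `(K ⊗_k L)/p`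
satisfies `cvg_L(K') = cvg_k(K)`. -/
theorem stmt5 (k : Type u) (K : Type v) (L : Type w) [Field k] [Field K] [Field L]
    [Algebra k K] [Algebra k L] (hK : IsAlgFunctionField k K)
    (hconst : algebraicClosure k K = ⊥)
    (p : Ideal (K ⊗[k] L)) (hp : p ∈ minimalPrimes (K ⊗[k] L)) [p.IsPrime] :
    cvg L (FractionRing ((K ⊗[k] L) ⧸ p)) = cvg k K := by
  exact main_aux k K L hK p hp
end

section
/- Let K be an algebraic function field over a field k whose field of constants equals k, and let L be a separable algebraic field extension of k. Let m be a maximal ideal of the tensor product K ⊗_k L and let K' = (K ⊗_k L)/m, which is a field; regard K' as an algebraic function field over L via the natural map L → K'. Then scvg_L(K') = scvg_k(K). -/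
universe u v

section InternalDiagrams

open IntermediateField

def InternalDiag (k K Ω : Type*) [Field k] [Field K] [Field Ω] [Algebra k Ω] [Algebra K Ω]
    (e : ℕ) : Prop :=
  ∃ (B C : IntermediateField k Ω) (t : Ω), B.FG ∧ C.FG ∧ Transcendental B t ∧ B ≤ C ∧ t ∈ C ∧
    (∀ x : K, algebraMap K Ω x ∈ C) ∧ (∀ x ∈ C, IsSeparable K x) ∧
    ∃ c : Fin e → Ω, (∀ i, c i ∈ C) ∧
      ∀ x ∈ C, x ∈ Submodule.span (adjoin k (insert t (B : Set Ω))) (Set.range c)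

/-- A finite-dimensional span which is closed under multiplication is a field. -/
lemma adjoin_le_span {A Ω : Type*} [Field A] [Field Ω] [Algebra A Ω] {e : ℕ} (c : Fin e → Ω)
    (M : Submonoid Ω) (h1 : ∀ x ∈ M, x ∈ Submodule.span A (Set.range c))
    (h2 : ∀ i, c i ∈ Submodule.span A (M : Set Ω)) :
    ∀ x ∈ adjoin A (M : Set Ω), x ∈ Submodule.span A (Set.range c) := by
  have hs : Submodule.span A (M : Set Ω) = Submodule.span A (Set.range c) := by
    apply le_antisymm
    · exact Submodule.span_le.2 h1
    · refine Submodule.span_le.2 ?_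
      rintro _ ⟨i, rfl⟩
      exact h2 i
  have hS : Subalgebra.toSubmodule (Algebra.adjoin A (M : Set Ω)) =
      Submodule.span A (Set.range c) := by
    rw [Algebra.adjoin_eq_span, Submonoid.closure_eq, hs]
  have hfin : Module.Finite A (Algebra.adjoin A (M : Set Ω)) := by
    have : (Subalgebra.toSubmodule (Algebra.adjoin A (M : Set Ω))).FG := by
      rw [hS]
      exact Submodule.fg_span (Set.finite_range c)
    exact Module.Finite.of_fg this
  have halg : ∀ x ∈ (M : Set Ω), IsAlgebraic A x := by
    intro x hx
    have h := Algebra.IsAlgebraic.isAlgebraic (R := A)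
      (⟨x, Algebra.subset_adjoin hx⟩ : Algebra.adjoin A (M : Set Ω))
    exact h.algebraMap (A := Ω)
  intro x hx
  rw [← mem_toSubalgebra, adjoin_toSubalgebra_of_isAlgebraic halg] at hx
  rw [← hS]
  exact hx

/-- Monotonicity of spans in the base field. -/
lemma span_mono_field {k L Ω : Type*} [Field k] [Field L] [Field Ω] [Algebra k Ω] [Algebra L Ω]
    (A : IntermediateField k Ω) (A' : IntermediateField L Ω)
    (h : ∀ x ∈ A, x ∈ A') (s : Set Ω) :
    ∀ x ∈ Submodule.span A s, x ∈ Submodule.span A' s := by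
  intro x hx
  induction hx using Submodule.span_induction with
  | mem x hx => exact Submodule.subset_span hx
  | zero => exact Submodule.zero_mem _
  | add x y _ _ hx hy => exact Submodule.add_mem _ hx hy
  | smul a x _ hx => exact Submodule.smul_mem _ (⟨a.1, h _ a.2⟩ : A') hx

lemma isAlgebraic_mono_field {k L Ω : Type*} [Field k] [Field L] [Field Ω] [Algebra k Ω]
    [Algebra L Ω] (A : IntermediateField k Ω) (A' : IntermediateField L Ω)
    (h : ∀ x ∈ A, x ∈ A') (t : Ω) (ht : IsAlgebraic A t) : IsAlgebraic A' t := by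
  let i : A →+* A' :=
    { toFun := fun x => ⟨x.1, h _ x.2⟩
      map_one' := rfl
      map_zero' := rfl
      map_add' := fun _ _ => rfl
      map_mul' := fun _ _ => rfl }
  let _ := i.toAlgebra
  have : IsScalarTower A A' Ω := IsScalarTower.of_algebraMap_eq (fun _ => rfl)
  exact ht.extendScalars i.injective

/-- Base change. -/
lemma InternalDiag.base_change {k K L K' Ω : Type*} [Field k] [Field K] [Field L] [Field K']
    [Field Ω] [Algebra k L] [Algebra K K'] [Algebra L K'] [Algebra k Ω] [Algebra L Ω]
    [Algebra K Ω] [Algebra K' Ω] [IsScalarTower k L Ω] [IsScalarTower L K' Ω]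
    [IsScalarTower K K' Ω] [Algebra.IsAlgebraic k L]
    (hgen : ∀ E : Subfield K', (∀ x : K, algebraMap K K' x ∈ E) →
      (∀ x : L, algebraMap L K' x ∈ E) → ∀ x, x ∈ E) {e : ℕ}
    (H : InternalDiag k K Ω e) : InternalDiag L K' Ω e := by
  obtain ⟨B, C, t, hB, hC, ht, hBC, htC, hKC, hsep, c, hc, hspan⟩ := H
  have hadj : ∀ (S : Set Ω), ∀ x ∈ adjoin k S, x ∈ adjoin L S := by
    intro S x hx
    have : adjoin k S ≤ (adjoin L S).restrictScalars k :=
      adjoin_le_iff.2 (subset_adjoin L S)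
    exact this hx
  have hfg : ∀ D : IntermediateField k Ω, D.FG → (adjoin L (D : Set Ω)).FG := by
    rintro _ ⟨S, rfl⟩
    refine ⟨S, le_antisymm (adjoin.mono _ _ _ (subset_adjoin k _)) ?_⟩
    exact adjoin_le_iff.2 (hadj _)
  have hsub : ∀ (S : Set Ω), S ⊆ adjoin L S := fun S => subset_adjoin L S
  have hLC : ∀ x : L, algebraMap L Ω x ∈ adjoin L (C : Set Ω) := fun x => IntermediateField.algebraMap_mem _ x
  refine ⟨adjoin L B, adjoin L C, t, hfg B hB, hfg C hC, ?_, adjoin.mono _ _ _ hBC,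
    hsub _ htC, ?_, ?_, c, fun i => hsub _ (hc i), ?_⟩
  · intro halg
    apply ht
    have h1 : adjoin L (B : Set Ω) ≤ 
        { (algebraicClosure B Ω).toSubfield with
          algebraMap_mem' := fun x => by
            change algebraMap L Ω x ∈ algebraicClosure B Ω
            rw [mem_algebraicClosure_iff]
            have := (Algebra.IsAlgebraic.isAlgebraic (R := k) x).algebraMap (A := Ω)
            exact this.tower_top B } := by
      rw [adjoin_le_iff]
      intro x hx
      change x ∈ algebraicClosure B Ω
      exact IntermediateField.algebraMap_mem _ (⟨x, hx⟩ : B)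
    have h2 : IsAlgebraic (algebraicClosure B Ω) t :=
      isAlgebraic_mono_field (adjoin L (B : Set Ω)) (algebraicClosure B Ω) (fun x hx => h1 hx) t halg
    exact h2.restrictScalars B
  · intro x
    have := hgen ((adjoin L (C : Set Ω)).toSubfield.comap (algebraMap K' Ω)) ?_ ?_ x
    · exact this
    · intro y
      change algebraMap K' Ω (algebraMap K K' y) ∈ adjoin L (C : Set Ω)
      rw [← IsScalarTower.algebraMap_apply]
      exact hsub _ (hKC y)
    · intro y
      change algebraMap K' Ω (algebraMap L K' y) ∈ adjoin L (C : Set Ω)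
      rw [← IsScalarTower.algebraMap_apply]
      exact hLC y
  · have h1 : adjoin L (C : Set Ω) ≤ (separableClosure K' Ω).restrictScalars L := by
      rw [adjoin_le_iff]
      intro x hx
      change x ∈ separableClosure K' Ω
      rw [mem_separableClosure_iff]
      exact IsSeparable.tower_top K' (hsep x hx)
    intro x hx
    exact mem_separableClosure_iff.1 (h1 hx)
  · set A' := adjoin L (insert t (adjoin L (B : Set Ω) : Set Ω)) with hA'
    have hAA' : ∀ x ∈ adjoin k (insert t (B : Set Ω)), x ∈ A' := by
      intro x hx
      have h1 := hadj _ x hx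
      exact adjoin.mono _ _ _ (Set.insert_subset_insert (hsub _)) h1
    intro x hx
    refine adjoin_le_span (A := A') c C.toSubalgebra.toSubmonoid ?_ ?_ x ?_
    · intro y hy
      exact span_mono_field _ A' hAA' _ y (hspan y hy)
    · intro i
      exact Submodule.subset_span (hc i)
    · have : adjoin L (C : Set Ω) ≤ (adjoin A' (C : Set Ω)).restrictScalars L :=
        adjoin_le_iff.2 (subset_adjoin A' _)
      exact this hx

/-- Descent. -/
lemma InternalDiag.descent {k K L K' Ω : Type*} [Field k] [Field K] [Field L] [Field K']
    [Field Ω] [Algebra k K] [Algebra k L] [Algebra K K'] [Algebra k Ω] [Algebra L Ω]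
    [Algebra K Ω] [Algebra K' Ω] [IsScalarTower k L Ω] [IsScalarTower k K Ω]
    [IsScalarTower K K' Ω] [Algebra.IsSeparable K K']
    (hK : IsAlgFunctionField k K) {e : ℕ}
    (H : InternalDiag L K' Ω e) : InternalDiag k K Ω e := by
  classical
  obtain ⟨B, C, t, hB, hC, ht, hBC, htC, hKC, hsep, c, hc, hspan⟩ := H
  obtain ⟨X, hX⟩ := hK
  have hXC : ∀ x : K, algebraMap K Ω x ∈ C := fun x => by
    rw [IsScalarTower.algebraMap_apply K K' Ω]; exact hKC _
  -- finite descent of coefficients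
  have hfin : ∀ a ∈ adjoin L (insert t (B : Set Ω)), ∃ S : Finset Ω, (S : Set Ω) ⊆ B ∧
      a ∈ adjoin k (insert t (S : Set Ω)) := by
    intro a ha
    have h1 : adjoin L (insert t (B : Set Ω)) ≤
        { (adjoin k (insert t (B : Set Ω))).toSubfield with
          algebraMap_mem' := fun x => by
            change algebraMap L Ω x ∈ adjoin k (insert t (B : Set Ω))
            exact subset_adjoin _ _ (Or.inr (IntermediateField.algebraMap_mem B x)) } := by
      rw [adjoin_le_iff]
      exact subset_adjoin k (insert t (B : Set Ω))
    have h2 : a ∈ adjoin k (insert t (B : Set Ω)) := h1 ha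
    obtain ⟨T, hT, haT⟩ := exists_finset_of_mem_adjoin h2
    refine ⟨T.filter (· ∈ B), ?_, ?_⟩
    · intro x hx
      simp only [Finset.coe_filter, Set.mem_ofPred_eq] at hx
      exact hx.2
    · refine adjoin.mono _ _ _ ?_ haT
      intro x hx
      rcases hT hx with h | h
      · exact Or.inl h
      · right
        simp only [Finset.coe_filter, Set.mem_ofPred_eq]
        exact ⟨hx, h⟩
  have hfin2 : ∀ x ∈ C, ∃ S : Finset Ω, (S : Set Ω) ⊆ B ∧
      x ∈ Submodule.span (adjoin k (insert t (S : Set Ω))) (Set.range c) := by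
    intro x hx
    obtain ⟨a, ha⟩ := (Submodule.mem_span_range_iff_exists_fun _).1 (hspan x hx)
    choose S hS hS' using fun i => hfin (a i).1 (a i).2
    refine ⟨Finset.univ.biUnion S, ?_, ?_⟩
    · intro y hy
      simp only [Finset.coe_biUnion, Set.mem_iUnion] at hy
      obtain ⟨i, _, hi⟩ := hy
      exact hS i hi
    · rw [← ha]
      refine Submodule.sum_mem _ fun i _ => ?_
      refine Submodule.smul_mem _ (⟨(a i).1, ?_⟩ : adjoin k _)
        (Submodule.subset_span (Set.mem_range_self i))
      refine adjoin.mono _ _ _ (Set.insert_subset_insert ?_) (hS' i)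
      intro y hy
      simp only [Finset.coe_biUnion, Set.mem_iUnion]
      exact ⟨i, by simp, hy⟩
  -- the finitely many elements to be controlled
  let Y : Finset Ω := insert 1 (X.image (algebraMap K Ω) ∪
    Finset.univ.image (fun p : Fin e × Fin e => c p.1 * c p.2))
  have hYC : ∀ y ∈ Y, y ∈ C := by
    intro y hy
    simp only [Y, Finset.mem_insert, Finset.mem_union, Finset.mem_image] at hy
    rcases hy with rfl | ⟨x, _, rfl⟩ | ⟨p, _, rfl⟩
    · exact one_mem _
    · exact hXC x
    · exact mul_mem (hc _) (hc _)
  choose! S hS hS' using hfin2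
  let T : Finset Ω := Y.biUnion S
  have hT : (T : Set Ω) ⊆ B := by
    intro y hy
    simp only [T, Finset.coe_biUnion, Set.mem_iUnion] at hy
    obtain ⟨i, hi, hi'⟩ := hy
    exact hS i (hYC i hi) hi'
  set A0 := adjoin k (insert t (adjoin k (T : Set Ω) : Set Ω)) with hA0
  have hY : ∀ y ∈ Y, y ∈ Submodule.span A0 (Set.range c) := by
    intro y hy
    refine span_mono_field _ A0 ?_ _ y (hS' y (hYC y hy))
    intro z hz
    refine adjoin.mono _ _ _ (Set.insert_subset_insert ?_) hz
    refine subset_trans ?_ (subset_adjoin k _)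
    intro w hw
    simp only [T, Finset.coe_biUnion, Set.mem_iUnion]
    exact ⟨y, hy, hw⟩
  have h1mem : (1 : Ω) ∈ Submodule.span A0 (Set.range c) := hY 1 (by simp [Y])
  have hXmem : ∀ x ∈ X, algebraMap K Ω x ∈ Submodule.span A0 (Set.range c) := fun x hx =>
    hY _ (by
      simp only [Y, Finset.mem_insert, Finset.mem_union, Finset.mem_image]
      exact Or.inr (Or.inl ⟨x, hx, rfl⟩))
  have hcc : ∀ i j, c i * c j ∈ Submodule.span A0 (Set.range c) := fun i j =>
    hY _ (by
      simp only [Y, Finset.mem_insert, Finset.mem_union, Finset.mem_image]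
      exact Or.inr (Or.inr ⟨(i, j), by simp, rfl⟩))
  have hmul : Submodule.span A0 (Set.range c) * Submodule.span A0 (Set.range c) ≤
      Submodule.span A0 (Set.range c) := by
    rw [Submodule.span_mul_span, Submodule.span_le]
    rintro _ ⟨_, ⟨i, rfl⟩, _, ⟨j, rfl⟩, rfl⟩
    exact hcc i j
  let M : Submonoid Ω :=
    { carrier := Submodule.span A0 (Set.range c)
      one_mem' := h1mem
      mul_mem' := fun ha hb => hmul (Submodule.mul_mem_mul ha hb) }
  have hM := adjoin_le_span (A := A0) c M (fun x hx => hx) (fun i =>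
    Submodule.subset_span (Submodule.subset_span (Set.mem_range_self i) :
      c i ∈ Submodule.span A0 (Set.range c)))
  let G : Set Ω := insert t (T : Set Ω) ∪ Set.range c
  have hGfin : G.Finite := ((T.finite_toSet).insert t).union (Set.finite_range c)
  have hGC : adjoin k G ≤ C.restrictScalars k := by
    rw [adjoin_le_iff]
    rintro x ((rfl | hx) | ⟨i, rfl⟩)
    · exact htC
    · exact hBC (hT hx)
    · exact hc i
  have hBG : adjoin k (T : Set Ω) ≤ adjoin k G :=
    adjoin.mono _ _ _ (fun x hx => Or.inl (Or.inr hx))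
  have htG : t ∈ adjoin k G := subset_adjoin _ _ (Or.inl (Or.inl rfl))
  have hcG : ∀ i, c i ∈ adjoin k G := fun i => subset_adjoin _ _ (Or.inr ⟨i, rfl⟩)
  have hAG : A0 ≤ adjoin k G := by
    rw [hA0, adjoin_le_iff]
    rintro x (rfl | hx)
    · exact htG
    · exact hBG hx
  have hspanG : ∀ x ∈ Submodule.span A0 (Set.range c), x ∈ adjoin k G := by
    intro x hx
    induction hx using Submodule.span_induction with
    | mem x hx => obtain ⟨i, rfl⟩ := hx; exact hcG i
    | zero => exact zero_mem _
    | add x y _ _ hx hy => exact add_mem hx hy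
    | smul a x _ hx => exact mul_mem (hAG a.2) hx
  refine ⟨adjoin k T, adjoin k G, t, fg_adjoin_finset _, fg_adjoin_of_finite hGfin, ?_, hBG, htG,
    ?_, ?_, c, hcG, ?_⟩
  · intro h
    refine ht (isAlgebraic_mono_field _ B ?_ t h)
    intro x hx
    have : adjoin k (T : Set Ω) ≤ B.restrictScalars k := adjoin_le_iff.2 hT
    exact this hx
  · have : (⊤ : IntermediateField k K) ≤ (adjoin k G).comap (IsScalarTower.toAlgHom k K Ω) := by
      rw [← hX, adjoin_le_iff]
      intro x hx
      exact hspanG _ (hXmem x hx)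
    intro x
    exact this (mem_top : x ∈ (⊤ : IntermediateField k K))
  · intro x hx
    have := hsep x (hGC hx)
    exact IsSeparable.of_algebra_isSeparable_of_isSeparable K this
  · intro x hx
    apply hM
    have : adjoin k G ≤ (adjoin A0 (M : Set Ω)).restrictScalars k := by
      rw [adjoin_le_iff]
      rintro x ((rfl | hx) | hx)
      · exact IntermediateField.algebraMap_mem (adjoin A0 (M : Set Ω))
          (⟨x, subset_adjoin _ _ (Or.inl rfl)⟩ : A0)
      · exact IntermediateField.algebraMap_mem (adjoin A0 (M : Set Ω))
          (⟨x, subset_adjoin _ _ (Or.inr (subset_adjoin _ _ hx))⟩ : A0)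
      · exact subset_adjoin A0 (M : Set Ω) (Submodule.subset_span hx :
          x ∈ Submodule.span A0 (Set.range c))
    exact this hx

lemma fg_fieldRange {k E Ω : Type*} [Field k] [Field E] [Field Ω] [Algebra k E] [Algebra k Ω]
    (h : IsAlgFunctionField k E) (g : E →ₐ[k] Ω) : g.fieldRange.FG := by
  have : Algebra.EssFiniteType k E := fg_top_iff.1 h
  rw [← essFiniteType_iff]
  exact Algebra.EssFiniteType.of_surjective g.rangeRestrict g.rangeRestrict_surjective

lemma HasSepCvgDiagram.toInternal {k : Type*} {K : Type*} {Ω : Type*} [Field k] [Field K] [Field Ω]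
    [Algebra k K] [Algebra k Ω] [Algebra K Ω] [IsScalarTower k K Ω] [IsAlgClosed Ω] {e : ℕ}
    (he : 0 < e) (H : HasSepCvgDiagram k K e) : InternalDiag k K Ω e := by
  obtain ⟨K_B, K_C, _, _, _, _, hB, hC, f, π, hfin, hsep, hdeg⟩ := H
  let _ : Algebra K K_C := f.toRingHom.toAlgebra
  have : IsScalarTower k K K_C := IsScalarTower.of_algebraMap_eq (fun x => (f.commutes x).symm)
  have : Module.Finite K K_C := hfin
  have : Algebra.IsSeparable K K_C := hsep
  let g : K_C →ₐ[K] Ω := IsAlgClosed.lift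
  let gk : K_C →ₐ[k] Ω := g.restrictScalars k
  let ψ : RatFunc K_B →ₐ[k] Ω := gk.comp π
  let ι : K_B →ₐ[k] Ω := ψ.comp (IsScalarTower.toAlgHom k K_B (RatFunc K_B))
  let _ : Algebra (RatFunc K_B) K_C := π.toRingHom.toAlgebra
  have hdeg' : Module.finrank (RatFunc K_B) K_C = e := hdeg
  have : Module.Finite (RatFunc K_B) K_C := Module.finite_of_finrank_pos (by omega)
  let b := Module.finBasisOfFinrankEq (RatFunc K_B) K_C hdeg'
  have hψ : ∀ q : RatFunc K_B,
      ψ q ∈ adjoin k (insert (ψ RatFunc.X) (ι.fieldRange : Set Ω)) := by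
    intro q
    have hp : ∀ p : Polynomial K_B, ψ (algebraMap _ _ p) ∈
        adjoin k (insert (ψ RatFunc.X) (ι.fieldRange : Set Ω)) := by
      intro p
      induction p using Polynomial.induction_on' with
      | add p q hp hq => rw [map_add, map_add]; exact add_mem hp hq
      | monomial n a =>
        rw [← Polynomial.C_mul_X_pow_eq_monomial, map_mul, map_mul, map_pow, map_pow,
          RatFunc.algebraMap_X, RatFunc.algebraMap_C]
        have h1 : ψ (RatFunc.C a) ∈
            adjoin k (insert (ψ RatFunc.X) (ι.fieldRange : Set Ω)) :=
          subset_adjoin _ _ (Or.inr ⟨a, rfl⟩)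
        have h2 : ψ RatFunc.X ∈
            adjoin k (insert (ψ RatFunc.X) (ι.fieldRange : Set Ω)) :=
          subset_adjoin _ _ (Or.inl rfl)
        exact mul_mem h1 (pow_mem h2 n)
    rw [← RatFunc.num_div_denom q, map_div₀]
    exact div_mem (hp _) (hp _)
  refine ⟨ι.fieldRange, gk.fieldRange, ψ RatFunc.X, fg_fieldRange hB ι, fg_fieldRange hC gk,
    ?_, ?_, ⟨_, rfl⟩, ?_, ?_, fun i => g (b i), fun i => ⟨b i, rfl⟩, ?_⟩
  · exact Transcendental.ringHom_of_comp_eq (R := K_B) (S := ι.fieldRange) (A := RatFunc K_B)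
      (B := Ω) ι.rangeRestrict ψ RatFunc.transcendental_X ι.rangeRestrict_surjective
      ψ.toRingHom.injective rfl
  · rintro _ ⟨x, rfl⟩
    exact ⟨_, rfl⟩
  · intro x
    exact ⟨algebraMap K K_C x, g.commutes x⟩
  · rintro _ ⟨x, rfl⟩
    exact IsSeparable.map g g.toRingHom.injective (Algebra.IsSeparable.isSeparable K x)
  · rintro _ ⟨x, rfl⟩
    change g x ∈ _
    rw [← b.sum_repr x, map_sum]
    refine Submodule.sum_mem _ fun i _ => ?_
    have h1 : g (b.repr x i • b i) = ψ (b.repr x i) * g (b i) := by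
      rw [Algebra.smul_def, map_mul]
      rfl
    rw [h1]
    exact Submodule.smul_mem _ (⟨_, hψ (b.repr x i)⟩ :
      adjoin k (insert (ψ RatFunc.X) (ι.fieldRange : Set Ω)))
      (Submodule.subset_span (Set.mem_range_self i))

lemma InternalDiag.toDiagram {k : Type u} {K : Type v} {Ω : Type (max u v)} [Field k] [Field K]
    [Field Ω] [Algebra k K] [Algebra k Ω] [Algebra K Ω] [IsScalarTower k K Ω] {e : ℕ}
    (H : InternalDiag k K Ω e) : ∃ e', 0 < e' ∧ e' ≤ e ∧ HasSepCvgDiagram k K e' := by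
  obtain ⟨B, C, t, hB, hC, ht, hBC, htC, hKC, hsep, c, hc, hspan⟩ := H
  let f : K →ₐ[k] C := (IsScalarTower.toAlgHom k K Ω).codRestrict C.toSubalgebra hKC
  let _ : Algebra B C := (inclusion hBC).toRingHom.toAlgebra
  have : IsScalarTower k B C := IsScalarTower.of_algebraMap_eq (fun x => rfl)
  have : IsScalarTower B C Ω := IsScalarTower.of_algebraMap_eq (fun x => rfl)
  have ht' : Transcendental B (⟨t, htC⟩ : C) := fun h => ht (h.algebraMap (A := Ω))
  let π₀ : RatFunc B →ₐ[B] C :=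
    (IntermediateField.val _).comp (RatFunc.algEquivOfTranscendental _ ht').toAlgHom
  let π : RatFunc B →ₐ[k] C := π₀.restrictScalars k
  have hπt : π RatFunc.X = ⟨t, htC⟩ := RatFunc.algEquivOfTranscendental_X _ ht'
  have hπ : adjoin k (insert t (B : Set Ω)) ≤ (C.val.comp π).fieldRange := by
    rw [adjoin_le_iff]
    rintro x (rfl | hx)
    · exact ⟨RatFunc.X, congrArg Subtype.val hπt⟩
    · exact ⟨algebraMap B (RatFunc B) ⟨x, hx⟩, congrArg Subtype.val (π₀.commutes ⟨x, hx⟩)⟩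
  let _ : Algebra (RatFunc B) C := π.toRingHom.toAlgebra
  let c' : Fin e → C := fun i => ⟨c i, hc i⟩
  have hspan' : Submodule.span (RatFunc B) (Set.range c') = ⊤ := by
    rw [eq_top_iff]
    rintro ⟨x, hx⟩ -
    obtain ⟨a, ha⟩ := (Submodule.mem_span_range_iff_exists_fun _).1 (hspan x hx)
    choose q hq using fun i => hπ (a i).2
    rw [Submodule.mem_span_range_iff_exists_fun]
    refine ⟨q, Subtype.ext ?_⟩
    change C.val (∑ i, q i • c' i) = x
    rw [← ha]
    rw [map_sum]
    refine Finset.sum_congr rfl fun i _ => ?_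
    rw [Algebra.smul_def, map_mul]
    change (C.val.comp π) (q i) * c i = (a i).1 * c i
    rw [← hq i]
    rfl
  have : Module.Finite (RatFunc B) C :=
    Module.Finite.of_fg_top (hspan' ▸ Submodule.fg_span (Set.finite_range c'))
  refine ⟨Module.finrank (RatFunc B) C, Module.finrank_pos, ?_, B, C, inferInstance,
    inferInstance, inferInstance, inferInstance, ?_, ?_, f, π, ?_, ?_, rfl⟩
  · simpa using finrank_le_of_span_eq_top hspan'
  · exact fg_top_iff.2 (essFiniteType_iff.2 hB)
  · exact fg_top_iff.2 (essFiniteType_iff.2 hC)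
  all_goals
    let _ : Algebra K C := f.toRingHom.toAlgebra
    have : IsScalarTower K C Ω := IsScalarTower.of_algebraMap_eq (fun x => rfl)
    have : IsScalarTower k K C := IsScalarTower.of_algebraMap_eq (fun x => (f.commutes x).symm)
    have hs : Algebra.IsSeparable K C := ⟨fun x => IsSeparable.tower_bot (hsep x.1 x.2)⟩
  · have : Algebra.EssFiniteType k C := essFiniteType_iff.2 hC
    have : Algebra.EssFiniteType K C := Algebra.EssFiniteType.of_comp k K C
    exact Algebra.finite_of_essFiniteType_of_isAlgebraic (F := K) (E := C)
  · exact hs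

lemma scvg_aux (k : Type u) (K : Type v) (L : Type w) (K' : Type (max v w)) [Field k] [Field K]
    [Field L] [Field K'] [Algebra k K] [Algebra k L] [Algebra k K'] [Algebra K K'] [Algebra L K']
    [IsScalarTower k K K'] [IsScalarTower k L K'] (hK : IsAlgFunctionField k K)
    [Algebra.IsSeparable k L]
    (hgen : ∀ E : Subfield K', (∀ x : K, algebraMap K K' x ∈ E) →
      (∀ x : L, algebraMap L K' x ∈ E) → ∀ x, x ∈ E) :
    scvg L K' = scvg k K := by
  have hsepK : Algebra.IsSeparable K K' := by
    refine ⟨fun x => mem_separableClosure_iff.1 (hgen (separableClosure K K').toSubfield ?_ ?_ x)⟩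
    · exact fun y => IntermediateField.algebraMap_mem _ y
    · intro y
      change _ ∈ separableClosure K K'
      rw [mem_separableClosure_iff]
      exact (IsSeparable.map (IsScalarTower.toAlgHom k L K') (algebraMap L K').injective
        (Algebra.IsSeparable.isSeparable k y)).tower_top K
  have h1 : ∀ e, 0 < e → HasSepCvgDiagram k K e →
      ∃ e', 0 < e' ∧ e' ≤ e ∧ HasSepCvgDiagram L K' e' := by
    intro e he H
    have H1 := H.toInternal (Ω := AlgebraicClosure K') he
    have H2 : InternalDiag L K' (AlgebraicClosure K') e := H1.base_change hgen
    exact H2.toDiagram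
  have h2 : ∀ e, 0 < e → HasSepCvgDiagram L K' e →
      ∃ e', 0 < e' ∧ e' ≤ e ∧ HasSepCvgDiagram k K e' := by
    intro e he H
    let Ω := AlgebraicClosure (ULift.{u} K)
    let g : K' →ₐ[K] Ω := IsAlgClosed.lift
    let _ : Algebra K' Ω := g.toRingHom.toAlgebra
    let _ : Algebra L Ω := (g.toRingHom.comp (algebraMap L K')).toAlgebra
    have : IsScalarTower K K' Ω := IsScalarTower.of_algebraMap_eq (fun x => (g.commutes x).symm)
    have : IsScalarTower L K' Ω := IsScalarTower.of_algebraMap_eq (fun x => rfl)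
    have : IsScalarTower k K Ω := IsScalarTower.of_algebraMap_eq (fun x => rfl)
    have : IsScalarTower k L Ω := IsScalarTower.of_algebraMap_eq (fun x => by
      rw [IsScalarTower.algebraMap_apply L K' Ω, ← IsScalarTower.algebraMap_apply k L K',
        IsScalarTower.algebraMap_apply k K K', ← IsScalarTower.algebraMap_apply K K' Ω]
      rfl)
    have H1 : InternalDiag L K' Ω e := H.toInternal he
    have H2 : InternalDiag k K Ω e := H1.descent hK
    exact H2.toDiagram
  unfold scvg
  rcases Set.eq_empty_or_nonempty {e : ℕ | 0 < e ∧ HasSepCvgDiagram k K e} with h | h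
  · have h' : {e : ℕ | 0 < e ∧ HasSepCvgDiagram L K' e} = ∅ := by
      rw [Set.eq_empty_iff_forall_notMem] at h ⊢
      rintro e ⟨he, H⟩
      obtain ⟨e', he', _, H'⟩ := h2 e he H
      exact h e' ⟨he', H'⟩
    rw [h, h']
  · have hn : {e : ℕ | 0 < e ∧ HasSepCvgDiagram L K' e}.Nonempty := by
      obtain ⟨e, he, H⟩ := h
      obtain ⟨e', he', _, H'⟩ := h1 e he H
      exact ⟨e', he', H'⟩
    apply le_antisymm
    · obtain ⟨he, H⟩ := Nat.sInf_mem h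
      obtain ⟨e', he', hle, H'⟩ := h1 _ he H
      have hmem : e' ∈ {e : ℕ | 0 < e ∧ HasSepCvgDiagram L K' e} := ⟨he', H'⟩
      exact (Nat.sInf_le hmem).trans hle
    · obtain ⟨he, H⟩ := Nat.sInf_mem hn
      obtain ⟨e', he', hle, H'⟩ := h2 _ he H
      have hmem : e' ∈ {e : ℕ | 0 < e ∧ HasSepCvgDiagram k K e} := ⟨he', H'⟩
      exact (Nat.sInf_le hmem).trans hle

end InternalDiagrams

open scoped TensorProduct
attribute [local instance] Algebra.TensorProduct.rightAlgebra Ideal.Quotient.field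

/-- If the field of constants of `K/k` is `k` itself and `L/k` is a separable algebraic field
extension, then for any maximal ideal `m` of `K ⊗_k L`, the field `K' = (K ⊗_k L)/m` satisfies
`scvg_L(K') = scvg_k(K)`. -/
theorem stmt6 (k : Type u) (K : Type v) (L : Type w) [Field k] [Field K] [Field L]
    [Algebra k K] [Algebra k L] (hK : IsAlgFunctionField k K)
    (hconst : algebraicClosure k K = ⊥)
    [Algebra.IsAlgebraic k L] [Algebra.IsSeparable k L]
    (m : Ideal (K ⊗[k] L)) [m.IsMaximal] :
    scvg L ((K ⊗[k] L) ⧸ m) = scvg k K := by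
  have : IsScalarTower k L ((K ⊗[k] L) ⧸ m) := by
    refine IsScalarTower.of_algebraMap_eq (R := k) (S := L) (A := (K ⊗[k] L) ⧸ m) (fun x => ?_)
    change Ideal.Quotient.mk m (algebraMap k (K ⊗[k] L) x) =
      Ideal.Quotient.mk m ((1 : K) ⊗ₜ[k] algebraMap k L x)
    rw [Algebra.TensorProduct.algebraMap_apply, Algebra.algebraMap_eq_smul_one,
      Algebra.algebraMap_eq_smul_one, TensorProduct.smul_tmul]
  refine scvg_aux k K L ((K ⊗[k] L) ⧸ m) hK ?_
  intro E hE1 hE2 x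
  obtain ⟨y, rfl⟩ := Ideal.Quotient.mk_surjective x
  induction y using TensorProduct.induction_on with
  | zero => rw [map_zero]; exact zero_mem E
  | add a b ha hb => rw [map_add]; exact add_mem ha hb
  | tmul a b =>
    have h : (a ⊗ₜ[k] b : K ⊗[k] L) = (a ⊗ₜ[k] (1 : L)) * ((1 : K) ⊗ₜ[k] b) := by
      rw [Algebra.TensorProduct.tmul_mul_tmul, mul_one, one_mul]
    rw [h, map_mul]
    exact mul_mem (hE1 a) (hE2 b)
end

section
/- Let K be an algebraic function field over a field k whose field of constants equals k, and let L be an algebraic field extension of k. Let m be a maximal ideal of the tensor product K ⊗_k L and let K' = (K ⊗_k L)/m, which is a field; regard K' as an algebraic function field over L via the natural map L → K'. Then cvg_L(K') = cvg_k(K). -/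
universe u v

open scoped TensorProduct
attribute [local instance] Algebra.TensorProduct.rightAlgebra Ideal.Quotient.field


namespace CvgAux
open IntermediateField Polynomial

/-- Function fields over `k` are small with respect to the universe of `k`. -/
theorem small_of_fg {k : Type u} {C : Type*} [Field k] [Field C] [Algebra k C]
    (h : IsAlgFunctionField k C) : Small.{u} C := by
  obtain ⟨s, hs⟩ := h
  have : Small.{u} s := inferInstance
  let ι := Shrink.{u} s
  let i : ι → C := fun x => ((equivShrink s).symm x : C)
  have hr : Set.range i = (s : Set C) := by
    ext x
    constructor
    · rintro ⟨y, rfl⟩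
      exact ((equivShrink s).symm y).2
    · intro hx
      exact ⟨equivShrink s ⟨x, hx⟩, by simp [i]⟩
  refine small_of_surjective (α := MvPolynomial ι k × MvPolynomial ι k)
    (f := fun p => MvPolynomial.aeval i p.1 / MvPolynomial.aeval i p.2) ?_
  intro x
  have hx : x ∈ adjoin k (Set.range i) := by rw [hr, hs]; trivial
  obtain ⟨r, q, h⟩ := (mem_adjoin_range_iff k i x).1 hx
  exact ⟨(r, q), h.symm⟩

theorem diagram_of {k : Type u} {K : Type v} {B : Type*} {C : Type*} [Field k] [Field K]
    [Field B] [Field C] [Algebra k K] [Algebra k B] [Algebra k C]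
    (hB : IsAlgFunctionField k B) (hC : IsAlgFunctionField k C)
    (f : K →ₐ[k] C) (π : RatFunc B →ₐ[k] C) (hf : f.toRingHom.Finite) {e : ℕ}
    (he : let := π.toRingHom.toAlgebra
       Module.finrank (RatFunc B) C = e) : HasCvgDiagram k K e := by
  have := small_of_fg hB
  have := small_of_fg hC
  have : Small.{max u v} B := small_lift B
  have : Small.{max u v} C := small_lift C
  let eB : Shrink.{max u v} B ≃ₐ[k] B := Shrink.algEquiv k B
  let eC : Shrink.{max u v} C ≃ₐ[k] C := Shrink.algEquiv k C
  let eR : RatFunc (Shrink.{max u v} B) ≃ₐ[k] RatFunc B :=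
    IsFractionRing.algEquivOfAlgEquiv (Polynomial.mapAlgEquiv eB)
  refine ⟨Shrink.{max u v} B, Shrink.{max u v} C, inferInstance, inferInstance, inferInstance,
    inferInstance, ?_, ?_, eC.symm.toAlgHom.comp f,
    (eC.symm.toAlgHom.comp π).comp eR.toAlgHom, ?_, ?_⟩
  · unfold IsAlgFunctionField at *
    rw [fg_top_iff] at *
    exact (Algebra.EssFiniteType.iff_of_algEquiv eB).2 hB
  · unfold IsAlgFunctionField at *
    rw [fg_top_iff] at *
    exact (Algebra.EssFiniteType.iff_of_algEquiv eC).2 hC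
  · have : (eC.symm.toAlgHom.comp f).toRingHom = eC.symm.toAlgHom.toRingHom.comp f.toRingHom := rfl
    rw [this]
    exact RingHom.Finite.comp (RingHom.Finite.of_surjective _ eC.symm.surjective) hf
  · let := π.toRingHom.toAlgebra
    let := ((eC.symm.toAlgHom.comp π).comp eR.toAlgHom).toRingHom.toAlgebra
    rw [← he]
    refine Algebra.finrank_eq_of_equiv_equiv eR.toRingEquiv eC.toRingEquiv ?_
    ext x
    change π (eR x) = eC (eC.symm (π (eR x)))
    simp

theorem builder {k : Type u} {K : Type v} {Ω : Type*} [Field k] [Field K] [Field Ω]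
    [Algebra k K] [Algebra k Ω] [Algebra K Ω] [IsScalarTower k K Ω] [Algebra.IsAlgebraic K Ω]
    (B : IntermediateField k Ω) (hB : B.FG) (t : Ω) (ht : Transcendental B t)
    (D : IntermediateField B⟮t⟯ Ω) [FiniteDimensional B⟮t⟯ D]
    (hD : ∀ x : K, algebraMap K Ω x ∈ D) : HasCvgDiagram k K (Module.finrank B⟮t⟯ D) := by
  have h1 : Algebra.EssFiniteType k B := essFiniteType_iff.2 hB
  have h2 : Algebra.EssFiniteType B B⟮t⟯ := essFiniteType_iff.2 ⟨{t}, by simp⟩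
  have h3 : Algebra.EssFiniteType B D := Algebra.EssFiniteType.comp B B⟮t⟯ D
  let : Algebra k D := ((algebraMap B D).comp (algebraMap k B)).toAlgebra
  have : IsScalarTower k B D := IsScalarTower.of_algebraMap_eq' rfl
  have h4 : Algebra.EssFiniteType k D := Algebra.EssFiniteType.comp k B D
  let f : K →ₐ[k] D :=
    { (algebraMap K Ω).codRestrict D.toSubalgebra.toSubring hD with
      commutes' := fun r => Subtype.ext (IsScalarTower.algebraMap_apply k K Ω r).symm }
  let π : RatFunc B →ₐ[k] D :=
    ((IsScalarTower.toAlgHom B B⟮t⟯ D).comp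
      (RatFunc.algEquivOfTranscendental t ht).toAlgHom).restrictScalars k
  refine diagram_of (B := B) (C := D) (fg_top_iff.2 h1) (fg_top_iff.2 h4) f π ?_ ?_
  · let := f.toRingHom.toAlgebra
    have : IsScalarTower k K D := IsScalarTower.of_algebraMap_eq' f.comp_algebraMap.symm
    have : IsScalarTower K D Ω := IsScalarTower.of_algebraMap_eq' rfl
    have : Algebra.IsAlgebraic K D := Algebra.IsAlgebraic.tower_bot K D Ω
    have : Algebra.EssFiniteType K D := Algebra.EssFiniteType.of_comp k K D
    have : Module.Finite K D := Algebra.finite_of_essFiniteType_of_isAlgebraic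
    exact this
  · let := π.toRingHom.toAlgebra
    refine Algebra.finrank_eq_of_equiv_equiv
      (RatFunc.algEquivOfTranscendental t ht).toRingEquiv (RingEquiv.refl D) ?_
    ext x
    rfl

theorem transc {k B Ω : Type*} [Field k] [Field B] [Field Ω] [Algebra k Ω] [Algebra B Ω]
    (t : Ω) (ht : Transcendental B t) (A : IntermediateField k Ω)
    (hA : ∀ a ∈ A, IsAlgebraic B a) : Transcendental A t := by
  intro h
  apply ht
  let j : A →+* algebraicClosure B Ω :=
    A.val.toRingHom.codRestrict (algebraicClosure B Ω).toSubalgebra.toSubring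
      fun a => mem_algebraicClosure_iff.2 (hA a a.2)
  let := j.toAlgebra
  have : IsScalarTower A (algebraicClosure B Ω) Ω := IsScalarTower.of_algebraMap_eq' rfl
  have h2 : IsAlgebraic (algebraicClosure B Ω) t := h.tower_top _
  exact h2.restrictScalars B

theorem poly_mem {B Ω : Type*} [Field B] [Field Ω] (φ : RatFunc B →+* Ω) (F : Subfield Ω)
    (hX : φ RatFunc.X ∈ F) (p : B[X]) (hp : ∀ n, φ (RatFunc.C (p.coeff n)) ∈ F) :
    φ (algebraMap B[X] (RatFunc B) p) ∈ F := by
  rw [p.as_sum_range_C_mul_X_pow]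
  simp only [map_sum, map_mul, map_pow, RatFunc.algebraMap_C, RatFunc.algebraMap_X]
  exact F.sum_mem fun i _ => F.mul_mem (hp i) (F.pow_mem hX i)

theorem ratfunc_mem {B Ω : Type*} [Field B] [Field Ω] (φ : RatFunc B →+* Ω) (F : Subfield Ω)
    (hX : φ RatFunc.X ∈ F) (r : RatFunc B) (hn : ∀ n, φ (RatFunc.C (r.num.coeff n)) ∈ F)
    (hd : ∀ n, φ (RatFunc.C (r.denom.coeff n)) ∈ F) :
    φ r ∈ F := by
  rw [← RatFunc.num_div_denom r, map_div₀]
  exact F.div_mem (poly_mem φ F hX _ hn) (poly_mem φ F hX _ hd)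

theorem map_mem_of_gen {k B Ω : Type*} [Field k] [Field B] [Field Ω] [Algebra k B] (S : Set B)
    (hS : adjoin k S = ⊤) (g : B →+* Ω) (F : Subfield Ω) (hk : ∀ c : k, g (algebraMap k B c) ∈ F)
    (hg : ∀ s ∈ S, g s ∈ F) (b : B) : g b ∈ F := by
  have hb : b ∈ adjoin k S := by rw [hS]; trivial
  induction hb using adjoin_induction with
  | mem x hx => exact hg x hx
  | algebraMap x => exact hk x
  | add x y _ _ hx hy => rw [map_add]; exact F.add_mem hx hy
  | inv x _ hx => rw [map_inv₀]; exact F.inv_mem hx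
  | mul x y _ _ hx hy => rw [map_mul]; exact F.mul_mem hx hy

theorem ascent_core {k B C Ω L : Type*} [Field k] [Field B] [Field C] [Field Ω] [Field L]
    [Algebra k B] [Algebra k C] [Algebra k L] [Algebra k Ω] [Algebra L Ω] [IsScalarTower k L Ω]
    [Algebra.IsAlgebraic k L] (hB : IsAlgFunctionField k B) (π : RatFunc B →ₐ[k] C)
    (i : C →ₐ[k] Ω) {e : ℕ} (he : 0 < e)
    (hfin : letI := π.toRingHom.toAlgebra
       Module.finrank (RatFunc B) C = e) :
    ∃ (B' : IntermediateField L Ω) (_ : B'.FG) (t : Ω) (_ : Transcendental B' t)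
      (D : IntermediateField B'⟮t⟯ Ω), FiniteDimensional B'⟮t⟯ D ∧ Module.finrank B'⟮t⟯ D ≤ e ∧
        ∀ c, i c ∈ D := by
  obtain ⟨S, hS⟩ := hB
  let := π.toRingHom.toAlgebra
  let : Algebra (RatFunc B) Ω := (i.comp π).toRingHom.toAlgebra
  let : Algebra B Ω := ((i.comp π).toRingHom.comp (RatFunc.C (K := B))).toAlgebra
  have tB : IsScalarTower B (RatFunc B) Ω := IsScalarTower.of_algebraMap_eq' (by
    ext x; rfl)
  have tk : IsScalarTower k B Ω := IsScalarTower.of_algebraMap_eq' (by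
    ext x
    change algebraMap k Ω x = (i.comp π) (RatFunc.C (algebraMap k B x))
    rw [← (i.comp π).commutes x]
    rfl)
  let i' : C →ₐ[RatFunc B] Ω := { i with commutes' := fun r => rfl }
  let T : Set Ω := algebraMap B Ω '' S
  let t : Ω := algebraMap (RatFunc B) Ω RatFunc.X
  let B' : IntermediateField L Ω := adjoin L T
  have htB : Transcendental B t := by
    have := (RatFunc.transcendental_X (K := B))
    exact (transcendental_algebraMap_iff (algebraMap (RatFunc B) Ω).injective).2 this
  have hBB' : ∀ b : B, algebraMap B Ω b ∈ B' := by
    refine map_mem_of_gen (S : Set B) hS (algebraMap B Ω) B'.toSubfield ?_ ?_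
    · intro c
      rw [← IsScalarTower.algebraMap_apply k B Ω, IsScalarTower.algebraMap_apply k L Ω]
      exact B'.algebraMap_mem _
    · intro s hs
      exact subset_adjoin L T ⟨s, hs, rfl⟩
  have hB'alg : ∀ a ∈ B', IsAlgebraic B a := by
    intro a ha
    induction ha using adjoin_induction with
    | mem x hx => obtain ⟨s, -, rfl⟩ := hx; exact isAlgebraic_algebraMap s
    | algebraMap x =>
      have : IsAlgebraic k (algebraMap L Ω x) :=
        (Algebra.IsAlgebraic.isAlgebraic (R := k) x).algebraMap
      exact this.tower_top B
    | add x y _ _ hx hy => exact hx.add hy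
    | inv x _ hx => exact hx.inv
    | mul x y _ _ hx hy => exact hx.mul hy
  have ht : Transcendental B' t := transc t htB B' hB'alg
  have hRF : ∀ r : RatFunc B, algebraMap (RatFunc B) Ω r ∈ B'⟮t⟯ := by
    have hh : ∀ b : B, algebraMap (RatFunc B) Ω (RatFunc.C b) ∈ B'⟮t⟯.toSubfield := fun b =>
      B'⟮t⟯.algebraMap_mem ⟨_, hBB' b⟩
    intro r
    exact ratfunc_mem (algebraMap (RatFunc B) Ω) B'⟮t⟯.toSubfield
      (mem_adjoin_simple_self B' t) r (fun n => hh _) (fun n => hh _)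
  let j : RatFunc B →+* B'⟮t⟯ :=
    (algebraMap (RatFunc B) Ω).codRestrict B'⟮t⟯.toSubalgebra.toSubring hRF
  let := j.toAlgebra
  have tj : IsScalarTower (RatFunc B) B'⟮t⟯ Ω := IsScalarTower.of_algebraMap_eq' rfl
  have fC : FiniteDimensional (RatFunc B) C := FiniteDimensional.of_finrank_pos (by
    rw [hfin]; exact he)
  let M : IntermediateField (RatFunc B) Ω := i'.fieldRange
  let eM : C ≃ₐ[RatFunc B] M := AlgEquiv.ofInjectiveField i'
  have fM : FiniteDimensional (RatFunc B) M := eM.toLinearEquiv.finiteDimensional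
  have hM : Module.finrank (RatFunc B) M = e := by
    rw [← hfin]; exact eM.toLinearEquiv.finrank_eq.symm
  have hrank := adjoin_rank_le_of_isAlgebraic_right (F := RatFunc B) B'⟮t⟯ M
  have hlt : Module.rank (RatFunc B) M < Cardinal.aleph0 := Module.rank_lt_aleph0 _ _
  refine ⟨B', ⟨S.map ⟨algebraMap B Ω, (algebraMap B Ω).injective⟩, ?_⟩, t, ht,
    adjoin B'⟮t⟯ (M : Set Ω), ?_, ?_, ?_⟩
  · simp [B', T]
  · exact Module.rank_lt_aleph0_iff.1 (hrank.trans_lt hlt)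
  · rw [← hM]
    exact Cardinal.toNat_le_toNat hrank hlt
  · intro c
    exact subset_adjoin _ _ ⟨c, rfl⟩

theorem ascent {k K L K' : Type*} [Field k] [Field K] [Field L] [Field K']
    [Algebra k K] [Algebra k L] [Algebra K K'] [Algebra L K'] [Algebra k K']
    [IsScalarTower k K K'] [IsScalarTower k L K'] [Algebra.IsAlgebraic k L]
    [Algebra.IsAlgebraic K K']
    (hgen : adjoin L (Set.range (algebraMap K K')) = ⊤) {e : ℕ} (he : 0 < e)
    (h : HasCvgDiagram k K e) : ∃ e' ≤ e, 0 < e' ∧ HasCvgDiagram L K' e' := by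
  obtain ⟨B, C, _, _, _, _, hB, -, f, π, hf, hfin⟩ := h
  let := f.toRingHom.toAlgebra
  have : IsScalarTower k K C := IsScalarTower.of_algebraMap_eq' f.comp_algebraMap.symm
  have : Module.Finite K C := hf
  let Ω := AlgebraicClosure C
  have aΩ : Algebra.IsAlgebraic K Ω := Algebra.IsAlgebraic.trans K C Ω
  let g : K' →ₐ[K] Ω := IsAlgClosed.lift
  let : Algebra K' Ω := g.toRingHom.toAlgebra
  have : IsScalarTower K K' Ω := IsScalarTower.of_algebraMap_eq' g.comp_algebraMap.symm
  let : Algebra L Ω := (g.toRingHom.comp (algebraMap L K')).toAlgebra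
  have : IsScalarTower L K' Ω := IsScalarTower.of_algebraMap_eq' rfl
  have : IsScalarTower k L Ω := IsScalarTower.of_algebraMap_eq (fun x => by
    change _ = g (algebraMap L K' (algebraMap k L x))
    rw [← IsScalarTower.algebraMap_apply k L K', IsScalarTower.algebraMap_apply k K K',
      AlgHom.commutes, ← IsScalarTower.algebraMap_apply k K Ω])
  have : Algebra.IsAlgebraic K' Ω := Algebra.IsAlgebraic.tower_top (K := K) K'
  obtain ⟨B', hB', t, ht, D, hD1, hD2, hD3⟩ :=
    ascent_core (L := L) hB π (IsScalarTower.toAlgHom k C Ω) he hfin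
  refine ⟨_, hD2, Module.finrank_pos, builder B' hB' t ht D ?_⟩
  refine map_mem_of_gen _ hgen (algebraMap K' Ω) D.toSubfield ?_ ?_
  · intro c
    exact D.algebraMap_mem ⟨_, B'⟮t⟯.algebraMap_mem ⟨_, B'.algebraMap_mem c⟩⟩
  · rintro _ ⟨x, rfl⟩
    rw [← IsScalarTower.algebraMap_apply K K' Ω, IsScalarTower.algebraMap_apply K C Ω]
    exact hD3 _

open scoped Pointwise in
theorem descent_core {k B C L : Type*} [Field k] [Field B] [Field C] [Field L]
    [Algebra k L] [Algebra L B] [Algebra L C] [Algebra k C] [IsScalarTower k L C]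
    (π : RatFunc B →ₐ[L] C) {e : ℕ} (he : 0 < e)
    (hfin : letI := π.toRingHom.toAlgebra
       Module.finrank (RatFunc B) C = e) (S : Set C) (hS : S.Finite) :
    ∃ (B' : IntermediateField k C) (_ : B'.FG) (t : C) (_ : Transcendental B' t)
      (D : IntermediateField B'⟮t⟯ C), FiniteDimensional B'⟮t⟯ D ∧ Module.finrank B'⟮t⟯ D ≤ e ∧
        ∀ c ∈ S, c ∈ D := by
  classical
  let := π.toRingHom.toAlgebra
  let : Algebra B C := (π.toRingHom.comp (RatFunc.C (K := B))).toAlgebra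
  have tB : IsScalarTower B (RatFunc B) C := IsScalarTower.of_algebraMap_eq' (by
    ext x; rfl)
  have tk : ∀ c : k, algebraMap k C c = algebraMap B C (algebraMap L B (algebraMap k L c)) := by
    intro c
    rw [IsScalarTower.algebraMap_apply k L C, ← π.commutes]
    rfl
  have fC : FiniteDimensional (RatFunc B) C := FiniteDimensional.of_finrank_pos (by
    rw [hfin]; exact he)
  let b := Module.finBasis (RatFunc B) C
  let W : Set C := insert 1 (S ∪ (Set.range b * Set.range b))
  have hW : W.Finite := by
    refine Set.Finite.insert _ (hS.union ?_)
    exact (Set.finite_range b).mul (Set.finite_range b)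
  let R : Set (RatFunc B) := ⋃ w ∈ W, Set.range (fun i => b.repr w i)
  have hR : R.Finite := hW.biUnion fun w _ => Set.finite_range _
  let T : Set C := ⋃ r ∈ R, algebraMap B C '' (r.num.coeffs ∪ r.denom.coeffs : Finset B)
  have hT : T.Finite := hR.biUnion fun r _ => (Finset.finite_toSet _).image _
  let t : C := algebraMap (RatFunc B) C RatFunc.X
  let B' : IntermediateField k C := adjoin k T
  have htB : Transcendental B t := by
    have := (RatFunc.transcendental_X (K := B))
    exact (transcendental_algebraMap_iff (algebraMap (RatFunc B) C).injective).2 this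
  have hB'alg : ∀ a ∈ B', IsAlgebraic B a := by
    intro a ha
    induction ha using adjoin_induction with
    | mem x hx =>
      simp only [T, Set.mem_iUnion] at hx
      obtain ⟨r, -, s, -, rfl⟩ := hx
      exact isAlgebraic_algebraMap s
    | algebraMap x => rw [tk]; exact isAlgebraic_algebraMap _
    | add x y _ _ hx hy => exact hx.add hy
    | inv x _ hx => exact hx.inv
    | mul x y _ _ hx hy => exact hx.mul hy
  have ht : Transcendental B' t := transc t htB B' hB'alg
  have hRF : ∀ r ∈ R, algebraMap (RatFunc B) C r ∈ B'⟮t⟯ := by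
    intro r hr
    have hh : ∀ x ∈ (r.num.coeffs ∪ r.denom.coeffs : Finset B),
        algebraMap (RatFunc B) C (RatFunc.C x) ∈ B'⟮t⟯.toSubfield := fun x hx =>
      B'⟮t⟯.algebraMap_mem ⟨_, subset_adjoin k T (Set.mem_biUnion hr ⟨x, hx, rfl⟩)⟩
    have h0 : ∀ p : B[X], p.coeffs ⊆ r.num.coeffs ∪ r.denom.coeffs → ∀ n,
        algebraMap (RatFunc B) C (RatFunc.C (p.coeff n)) ∈ B'⟮t⟯.toSubfield := by
      intro p hp n
      by_cases h : p.coeff n = 0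
      · rw [h, map_zero, map_zero]; exact zero_mem _
      · exact hh _ (hp (coeff_mem_coeffs h))
    exact ratfunc_mem (algebraMap (RatFunc B) C) B'⟮t⟯.toSubfield
      (mem_adjoin_simple_self B' t) r (h0 _ Finset.subset_union_left)
      (h0 _ Finset.subset_union_right)
  let P : Submodule B'⟮t⟯ C := Submodule.span B'⟮t⟯ (Set.range b)
  have hWP : ∀ w ∈ W, w ∈ P := by
    intro w hw
    rw [← b.sum_repr w]
    refine P.sum_mem fun i _ => ?_
    rw [Algebra.smul_def]
    have hr : algebraMap (RatFunc B) C (b.repr w i) ∈ B'⟮t⟯ :=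
      hRF _ (Set.mem_biUnion hw ⟨i, rfl⟩)
    exact P.smul_mem (⟨_, hr⟩ : B'⟮t⟯) (Submodule.subset_span ⟨i, rfl⟩)
  have hPP : P * P ≤ P := by
    rw [Submodule.span_mul_span, Submodule.span_le]
    intro x hx
    exact hWP x (Or.inr (Or.inr hx))
  let A : Subalgebra B'⟮t⟯ C := P.toSubalgebra (hWP 1 (Or.inl rfl))
    fun x y hx hy => hPP (Submodule.mul_mem_mul hx hy)
  have fP : FiniteDimensional B'⟮t⟯ P := FiniteDimensional.span_of_finite _ (Set.finite_range b)
  have fA : FiniteDimensional B'⟮t⟯ A := fP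
  have iA : Algebra.IsAlgebraic B'⟮t⟯ A := Algebra.IsAlgebraic.of_finite _ _
  let D : IntermediateField B'⟮t⟯ C := A.toIntermediateField'
    (isField_of_isIntegral_of_isField' (R := B'⟮t⟯) (Field.toIsField _))
  refine ⟨B', ?_, t, ht, D, fP, ?_, ?_⟩
  · exact ⟨hT.toFinset, by simp [B']⟩
  · have h1 : Module.finrank B'⟮t⟯ P ≤ _ := finrank_range_le_card (R := B'⟮t⟯) (b := b)
    rw [Fintype.card_fin, hfin] at h1
    exact h1
  · intro c hc
    exact hWP c (Or.inr (Or.inl hc))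

theorem descent {k K L K' : Type*} [Field k] [Field K] [Field L] [Field K']
    [Algebra k K] [Algebra k L] [Algebra K K'] [Algebra L K'] [Algebra k K']
    [IsScalarTower k K K'] [IsScalarTower k L K']
    [Algebra.IsAlgebraic K K'] (hK : IsAlgFunctionField k K) {e : ℕ} (he : 0 < e)
    (h : HasCvgDiagram L K' e) : ∃ e' ≤ e, 0 < e' ∧ HasCvgDiagram k K e' := by
  obtain ⟨B, C, _, _, _, _, -, -, f, π, hf, hfin⟩ := h
  obtain ⟨S, hS⟩ := hK
  let := f.toRingHom.toAlgebra
  have : IsScalarTower L K' C := IsScalarTower.of_algebraMap_eq' f.comp_algebraMap.symm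
  have : Module.Finite K' C := hf
  let : Algebra k C := ((algebraMap L C).comp (algebraMap k L)).toAlgebra
  have : IsScalarTower k L C := IsScalarTower.of_algebraMap_eq' rfl
  let : Algebra K C := ((algebraMap K' C).comp (algebraMap K K')).toAlgebra
  have : IsScalarTower K K' C := IsScalarTower.of_algebraMap_eq' rfl
  have : IsScalarTower k K C := IsScalarTower.of_algebraMap_eq (fun x => by
    rw [IsScalarTower.algebraMap_apply K K' C, ← IsScalarTower.algebraMap_apply k K K',
      IsScalarTower.algebraMap_apply k L K', ← IsScalarTower.algebraMap_apply L K' C,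
      ← IsScalarTower.algebraMap_apply k L C])
  have aC : Algebra.IsAlgebraic K C := Algebra.IsAlgebraic.trans K K' C
  obtain ⟨B', hB', t, ht, D, hD1, hD2, hD3⟩ :=
    descent_core (k := k) π he hfin (algebraMap K C '' S) (S.finite_toSet.image _)
  refine ⟨_, hD2, Module.finrank_pos, builder B' hB' t ht D ?_⟩
  refine map_mem_of_gen _ hS (algebraMap K C) D.toSubfield ?_ ?_
  · intro c
    rw [← IsScalarTower.algebraMap_apply k K C]
    exact D.algebraMap_mem ⟨_, B'⟮t⟯.algebraMap_mem ⟨_, B'.algebraMap_mem c⟩⟩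
  · intro s hs
    exact hD3 _ ⟨s, hs, rfl⟩

theorem sInf_eq {P Q : ℕ → Prop} (h1 : ∀ e, 0 < e → P e → ∃ e' ≤ e, 0 < e' ∧ Q e')
    (h2 : ∀ e, 0 < e → Q e → ∃ e' ≤ e, 0 < e' ∧ P e') :
    sInf {e : ℕ | 0 < e ∧ P e} = sInf {e : ℕ | 0 < e ∧ Q e} := by
  have key : ∀ {P Q : ℕ → Prop}, (∀ e, 0 < e → P e → ∃ e' ≤ e, 0 < e' ∧ Q e') →
      {e : ℕ | 0 < e ∧ P e}.Nonempty →
      sInf {e : ℕ | 0 < e ∧ Q e} ≤ sInf {e : ℕ | 0 < e ∧ P e} := by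
    intro P Q h hne
    obtain ⟨h3, h4⟩ := Nat.sInf_mem hne
    obtain ⟨e', h5, h6, h7⟩ := h _ h3 h4
    have h8 : e' ∈ {e : ℕ | 0 < e ∧ Q e} := ⟨h6, h7⟩
    exact (Nat.sInf_le h8).trans h5
  by_cases hP : {e : ℕ | 0 < e ∧ P e}.Nonempty
  · have hQ : {e : ℕ | 0 < e ∧ Q e}.Nonempty := by
      obtain ⟨e, he, hp⟩ := hP
      obtain ⟨e', -, h⟩ := h1 e he hp
      exact ⟨e', h⟩
    exact le_antisymm (key h2 hQ) (key h1 hP)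
  · have hQ : ¬ {e : ℕ | 0 < e ∧ Q e}.Nonempty := by
      rintro ⟨e, he, hp⟩
      obtain ⟨e', -, h⟩ := h2 e he hp
      exact hP ⟨e', h⟩
    rw [Set.not_nonempty_iff_eq_empty.1 hP, Set.not_nonempty_iff_eq_empty.1 hQ]

theorem main {k K L K' : Type*} [Field k] [Field K] [Field L] [Field K']
    [Algebra k K] [Algebra k L] [Algebra K K'] [Algebra L K'] [Algebra k K']
    [IsScalarTower k K K'] [IsScalarTower k L K'] [Algebra.IsAlgebraic k L]
    [Algebra.IsAlgebraic K K'] (hK : IsAlgFunctionField k K)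
    (hgen : adjoin L (Set.range (algebraMap K K')) = ⊤) : cvg L K' = cvg k K :=
  sInf_eq (fun _ he h => descent hK he h) (fun _ he h => ascent hgen he h)

end CvgAux

/-- If the field of constants of `K/k` is `k` itself and `L/k` is an algebraic field extension,
then for any maximal ideal `m` of `K ⊗_k L`, the field `K' = (K ⊗_k L)/m` satisfies
`cvg_L(K') = cvg_k(K)`. -/
theorem stmt7 (k : Type u) (K : Type v) (L : Type w) [Field k] [Field K] [Field L]
    [Algebra k K] [Algebra k L] (hK : IsAlgFunctionField k K)
    (hconst : algebraicClosure k K = ⊥)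
    [Algebra.IsAlgebraic k L]
    (m : Ideal (K ⊗[k] L)) [m.IsMaximal] :
    cvg L ((K ⊗[k] L) ⧸ m) = cvg k K := by
  have h1 : Algebra.IsIntegral K (K ⊗[k] L) := inferInstance
  have h2 : Algebra.IsIntegral K ((K ⊗[k] L) ⧸ m) :=
    Algebra.IsIntegral.of_surjective (Ideal.Quotient.mkₐ K m) Ideal.Quotient.mk_surjective
  have h3 : Algebra.IsAlgebraic K ((K ⊗[k] L) ⧸ m) := Algebra.IsIntegral.isAlgebraic
  have h4 : IsScalarTower k L ((K ⊗[k] L) ⧸ m) := inferInstance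
  refine CvgAux.main hK ?_
  rw [eq_top_iff]
  rintro x -
  obtain ⟨y, rfl⟩ := Ideal.Quotient.mk_surjective x
  induction y using TensorProduct.induction_on with
  | zero => rw [map_zero]; exact zero_mem _
  | add y z hy hz => rw [map_add]; exact add_mem hy hz
  | tmul a l =>
    have : a ⊗ₜ[k] l = (a ⊗ₜ[k] (1 : L)) * ((1 : K) ⊗ₜ[k] l) := by simp
    rw [this, map_mul]
    refine mul_mem (IntermediateField.subset_adjoin _ _ ⟨a, rfl⟩) ?_
    exact IntermediateField.algebraMap_mem _ l
end
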